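/- There exists an absolute constant c > 0 such that the following holds. Suppose that A ⊆ {1, …, N} contains no configuration of the form x, x+y, x+y² with y a nonzero integer (i.e. there are no integers x and y with y ≠ 0 such that x, x+y and x+y² all lie in A). Then |A| = O(N/(log N)^c), i.e. there is an absolute constant C > 0 with |A| ≤ C·N/(log N)^c for all N ≥ 2. -/

import Mathlib

open Finset ComplexConjugate
open scoped BigOperators

namespace NR

section basics
variable {ι κ : Type*} [Fintype ι] [Fintype κ]

lemma ec {ι E : Type*} [Fintype ι] [AddCommMonoid E] [Module ℚ≥0 E] {f g : ι → E} (h : ∀ i, f i = g i) : 𝔼 i, f i = 𝔼 i, g i :=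
  Finset.expect_congr rfl fun i _ => h i

lemma el {ι : Type*} [Fintype ι] [Nonempty ι] {f : ι → ℝ} {a : ℝ} (h : ∀ i, f i ≤ a) : 𝔼 i, f i ≤ a :=
  Finset.expect_le Finset.univ_nonempty fun i _ => h i

lemma nexp_le (f : ι → ℂ) : ‖𝔼 i, f i‖ ≤ 𝔼 i, ‖f i‖ := by
  rw [Fintype.expect_eq_sum_div_card, Fintype.expect_eq_sum_div_card, norm_div]
  simp only [Complex.norm_natCast]
  gcongr
  exact norm_sum_le _ _

lemma exp_mono {X Y : ι → ℝ} (h : ∀ i, X i ≤ Y i) : 𝔼 i, X i ≤ 𝔼 i, Y i :=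
  Finset.expect_le_expect (fun i _ => h i)

lemma exp_nonneg {X : ι → ℝ} (h : ∀ i, 0 ≤ X i) : 0 ≤ 𝔼 i, X i :=
  Finset.expect_nonneg (fun i _ => h i)

lemma exp_le_one {X : ι → ℝ} (h : ∀ i, X i ≤ 1) : 𝔼 i, X i ≤ 1 := by
  rcases isEmpty_or_nonempty ι with h1 | h1
  · simp
  · exact expect_le univ_nonempty (fun i _ => h i)

lemma nexp_le_one {f : ι → ℂ} (h : ∀ i, ‖f i‖ ≤ 1) : ‖𝔼 i, f i‖ ≤ 1 :=
  (nexp_le f).trans (exp_le_one h)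

lemma exp_sq_le (X : ι → ℝ) : (𝔼 i, X i)^2 ≤ 𝔼 i, X i^2 := by
  rcases isEmpty_or_nonempty ι with h1 | h1
  · simp
  · have := Finset.expect_mul_sq_le_sq_mul_sq univ X (fun _ => (1:ℝ))
    simpa using this

lemma exp_pow_le (X : ι → ℝ) (h : ∀ i, 0 ≤ X i) (k : ℕ) :
    (𝔼 i, X i)^(2^k) ≤ 𝔼 i, X i^(2^k) := by
  induction k with
  | zero => simp
  | succ k ih =>
    rw [pow_succ 2 k, pow_mul]
    calc ((𝔼 i, X i)^(2^k))^2 ≤ (𝔼 i, X i^(2^k))^2 := by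
          apply pow_le_pow_left₀ _ ih
          exact pow_nonneg (exp_nonneg h) _
      _ ≤ 𝔼 i, (X i^(2^k))^2 := exp_sq_le _
      _ = _ := by simp only [pow_mul]

lemma nexp_pow_le (f : ι → ℂ) (k : ℕ) : ‖𝔼 i, f i‖^(2^k) ≤ 𝔼 i, ‖f i‖^(2^k) :=
  (pow_le_pow_left₀ (norm_nonneg _) (nexp_le f) _).trans
    (exp_pow_le _ (fun _ => norm_nonneg _) k)

lemma cs_kill (A B : ι → ℂ) (hA : ∀ i, ‖A i‖ ≤ 1) :
    ‖𝔼 i, A i * B i‖^2 ≤ 𝔼 i, ‖B i‖^2 := by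
  have h1 := nexp_pow_le (fun i => A i * B i) 1
  simp only [pow_one] at h1
  refine h1.trans (exp_mono fun i => ?_)
  rw [norm_mul]
  have : ‖A i‖ * ‖B i‖ ≤ ‖B i‖ := mul_le_of_le_one_left (norm_nonneg _) (hA i)
  exact pow_le_pow_left₀ (by positivity) this 2

lemma conj_exp (F : ι → ℂ) : conj (𝔼 i, F i) = 𝔼 i, conj (F i) := map_expect _ _ _

lemma ofReal_exp (F : ι → ℝ) : ((𝔼 i, F i : ℝ) : ℂ) = 𝔼 i, (F i : ℂ) :=
  map_expect Complex.ofRealHom _ _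

lemma exp_mul_exp (F : ι → ℂ) (G : κ → ℂ) : (𝔼 i, F i) * (𝔼 k, G k) = 𝔼 i, 𝔼 k, F i * G k := by
  rw [expect_mul]
  simp only [mul_expect]

lemma normsq_exp (F : ι → ℂ) : ((‖𝔼 i, F i‖^2 : ℝ) : ℂ) = 𝔼 i, 𝔼 i', F i * conj (F i') := by
  rw [← exp_mul_exp, ← conj_exp, Complex.mul_conj, Complex.normSq_eq_norm_sq]

lemma nsq (z : ℂ) : ((‖z‖^2 : ℝ) : ℂ) = z * conj z := by
  rw [Complex.mul_conj, Complex.normSq_eq_norm_sq]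

lemma norm_real {x : ℝ} (h : 0 ≤ x) : ‖(x:ℂ)‖ = x := by simp [h]

lemma exp_comm (F : ι → κ → ℂ) : 𝔼 i, 𝔼 k, F i k = 𝔼 k, 𝔼 i, F i k := Finset.expect_comm _ _ _
lemma exp_commR (F : ι → κ → ℝ) : 𝔼 i, 𝔼 k, F i k = 𝔼 k, 𝔼 i, F i k := Finset.expect_comm _ _ _

lemma expsq_eq (F : ι → κ → ℂ) :
    ((𝔼 i, ‖𝔼 k, F i k‖^2 : ℝ) : ℂ) = 𝔼 k, 𝔼 k', 𝔼 i, F i k * conj (F i k') := by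
  rw [ofReal_exp]
  simp only [normsq_exp]
  rw [exp_comm]
  refine ec fun k => ?_
  rw [exp_comm]

lemma expsq_le (F : ι → κ → ℂ) :
    𝔼 i, ‖𝔼 k, F i k‖^2 ≤ 𝔼 k, 𝔼 k', ‖𝔼 i, F i k * conj (F i k')‖ := by
  have h0 : 0 ≤ 𝔼 i, ‖𝔼 k, F i k‖^2 := exp_nonneg fun i => by positivity
  rw [← norm_real h0, expsq_eq]
  refine (nexp_le _).trans (exp_mono fun k => nexp_le _)

lemma kill (A : ι → ℂ) (F : ι → κ → ℂ) (hA : ∀ i, ‖A i‖ ≤ 1) :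
    ‖𝔼 i, A i * 𝔼 k, F i k‖^2 ≤ 𝔼 k, 𝔼 k', ‖𝔼 i, F i k * conj (F i k')‖ :=
  (cs_kill A _ hA).trans (expsq_le F)

lemma exp_prod (F : ι × κ → ℂ) : 𝔼 p, F p = 𝔼 i, 𝔼 k, F (i,k) := by
  rw [← Finset.univ_product_univ, Finset.expect_product]
lemma exp_prodR (F : ι × κ → ℝ) : 𝔼 p, F p = 𝔼 i, 𝔼 k, F (i,k) := by
  rw [← Finset.univ_product_univ, Finset.expect_product]

lemma exp_inj (i : ι → κ) (hi : Function.Injective i) (Y : κ → ℝ) (hY : ∀ k, 0 ≤ Y k)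
    (c : ℝ) (hc : (Fintype.card κ : ℝ) ≤ c * Fintype.card ι) :
    𝔼 a, Y (i a) ≤ c * 𝔼 b, Y b := by
  rcases isEmpty_or_nonempty ι with h1 | h1
  · simp only [Fintype.card_eq_zero, Nat.cast_zero, mul_zero] at hc
    have : IsEmpty κ := by
      rw [← Fintype.card_eq_zero_iff]
      have : (Fintype.card κ : ℝ) = 0 := le_antisymm hc (by positivity)
      exact_mod_cast this
    simp
  · rw [Fintype.expect_eq_sum_div_card, Fintype.expect_eq_sum_div_card]
    have hι : (0:ℝ) < Fintype.card ι := by exact_mod_cast Fintype.card_pos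
    have hκ : (0:ℝ) < Fintype.card κ := by
      have : Nonempty κ := ⟨i (Classical.arbitrary ι)⟩
      exact_mod_cast Fintype.card_pos
    have hs : ∑ a, Y (i a) ≤ ∑ b, Y b := by
      classical
      rw [← Finset.sum_image (f := Y) (fun a _ b _ h => hi h)]
      exact Finset.sum_le_sum_of_subset_of_nonneg (Finset.subset_univ _) (fun k _ _ => hY k)
    have h0 : 0 ≤ ∑ b, Y b := Finset.sum_nonneg fun k _ => hY k
    rw [div_le_iff₀ hι]
    calc ∑ a, Y (i a) ≤ ∑ b, Y b := hs
      _ = (∑ b, Y b) / Fintype.card κ * Fintype.card κ := by field_simp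
      _ ≤ (∑ b, Y b) / Fintype.card κ * (c * Fintype.card ι) := by gcongr
      _ = _ := by ring

lemma many [Nonempty ι] (X : ι → ℝ) (h1 : ∀ i, X i ≤ 1) (δ : ℝ) (hδ : 0 ≤ δ) (h : 2 * δ ≤ 𝔼 i, X i) :
    δ * Fintype.card ι ≤ ((Finset.univ.filter fun i => δ ≤ X i).card : ℝ) := by
  rw [Fintype.expect_eq_sum_div_card, le_div_iff₀ (by exact_mod_cast Fintype.card_pos)] at h
  have : ∑ i, X i ≤ ∑ i, ((if δ ≤ X i then 1 else 0) + δ) := by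
    apply Finset.sum_le_sum
    intro i _
    split_ifs with hh
    · linarith [h1 i]
    · push Not at hh; linarith
  rw [Finset.sum_add_distrib] at this
  simp only [Finset.sum_boole, Finset.sum_const, Finset.card_univ, nsmul_eq_mul] at this
  nlinarith

lemma exp_ind (p : ι → Prop) [DecidablePred p] :
    (𝔼 i, if p i then (1:ℝ) else 0) * Fintype.card ι = ((Finset.univ.filter p).card : ℝ) := by
  rcases isEmpty_or_nonempty ι with h1 | h1
  · simp
  · rw [Fintype.expect_eq_sum_div_card]
    have : (0:ℝ) < Fintype.card ι := by exact_mod_cast Fintype.card_pos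
    simp
end basics
end NR

namespace NR

section zm
set_option linter.unusedSectionVars false
variable {n : ℕ} [NeZero n]

lemma shift (c : ZMod n) (f : ZMod n → ℂ) : 𝔼 j, f (j + c) = 𝔼 j, f j :=
  Fintype.expect_equiv (Equiv.addRight c) _ _ (fun _ => rfl)
lemma shiftR (c : ZMod n) (f : ZMod n → ℝ) : 𝔼 j, f (j + c) = 𝔼 j, f j :=
  Fintype.expect_equiv (Equiv.addRight c) _ _ (fun _ => rfl)
lemma shiftL (c : ZMod n) (f : ZMod n → ℂ) : 𝔼 j, f (c + j) = 𝔼 j, f j :=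
  Fintype.expect_equiv (Equiv.addLeft c) _ _ (fun _ => rfl)

lemma shc (c : ZMod n) {f g : ZMod n → ℂ} (h : ∀ j, f j = g (j + c)) : 𝔼 j, f j = 𝔼 j, g j := by
  rw [← shift c g]; exact ec fun j => h j
lemma shcR (c : ZMod n) {f g : ZMod n → ℝ} (h : ∀ j, f j = g (j + c)) : 𝔼 j, f j = 𝔼 j, g j := by
  rw [← shiftR c g]; exact ec fun j => h j

noncomputable def e (x : ZMod n) : ℂ := ZMod.stdAddChar x

lemma e_add (x y : ZMod n) : e (x + y) = e x * e y := by simp [e, AddChar.map_add_eq_mul]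
lemma e_zero : e (0 : ZMod n) = 1 := by simp [e]
lemma norm_e (x : ZMod n) : ‖e x‖ = 1 := by simp [e]
lemma e_neg (x : ZMod n) : e (-x) = conj (e x) := by
  rw [e, AddChar.map_neg_eq_conj]; rfl
lemma e_mul_conj (x : ZMod n) : e x * conj (e x) = 1 := by
  rw [← e_neg, ← e_add, add_neg_cancel, e_zero]

lemma e_sub (x y : ZMod n) : e (x - y) = e x * conj (e y) := by
  rw [sub_eq_add_neg, e_add, e_neg]

lemma sum_e (x : ZMod n) : ∑ ξ, e (ξ * x) = if x = 0 then (n:ℂ) else 0 := by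
  have := AddChar.sum_mulShift x (ZMod.isPrimitive_stdAddChar n)
  simpa [e] using this

noncomputable def hat (f : ZMod n → ℂ) (ξ : ZMod n) : ℂ := 𝔼 x, f x * e (ξ * x)

lemma hat_le_one {f : ZMod n → ℂ} (hf : ∀ x, ‖f x‖ ≤ 1) (ξ : ZMod n) : ‖hat f ξ‖ ≤ 1 :=
  nexp_le_one fun x => by rw [norm_mul, norm_e, mul_one]; exact hf x

lemma inversion (f : ZMod n → ℂ) (x : ZMod n) : ∑ ξ, hat f ξ * e (-(ξ * x)) = f x := by
  simp only [hat, expect_mul]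
  rw [← Finset.expect_sum_comm]
  have : ∀ y : ZMod n, ∑ ξ, f y * e (ξ * y) * e (-(ξ * x)) = if y = x then (n:ℂ) * f x else 0 := by
    intro y
    have h : ∀ ξ, f y * e (ξ * y) * e (-(ξ * x)) = f y * e (ξ * (y - x)) := by
      intro ξ; rw [mul_assoc, ← e_add]; congr 2; ring
    simp only [h]
    rw [← Finset.mul_sum, sum_e]
    simp only [sub_eq_zero]
    split_ifs with hh
    · rw [hh, mul_comm]
    · simp
  simp only [this]
  rw [Fintype.expect_eq_sum_div_card]
  simp [NeZero.ne n]

lemma parseval (f : ZMod n → ℂ) : ∑ ξ, ‖hat f ξ‖^2 = 𝔼 x, ‖f x‖^2 := by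
  have h : ((∑ ξ, ‖hat f ξ‖^2 : ℝ) : ℂ) = ((𝔼 x, ‖f x‖^2 : ℝ) : ℂ) := by
    rw [ofReal_exp]
    push_cast
    have h1 : ∀ ξ, ((‖hat f ξ‖ : ℂ))^2 = 𝔼 x, hat f ξ * e (-(ξ * x)) * conj (f x) := by
      intro ξ
      have := nsq (hat f ξ)
      push_cast at this
      rw [this]
      nth_rw 2 [hat]
      rw [conj_exp, mul_expect]
      refine ec fun x => ?_
      rw [map_mul, e_neg]; ring
    simp only [h1]
    rw [← Finset.expect_sum_comm]
    refine ec fun x => ?_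
    rw [← Finset.sum_mul, inversion]
    have := nsq (f x)
    push_cast at this
    rw [this]
  exact_mod_cast h

noncomputable def Dl (d : ZMod n) (f : ZMod n → ℂ) : ZMod n → ℂ := fun x => f x * conj (f (x + d))

lemma Dl_bdd {f : ZMod n → ℂ} (hf : ∀ x, ‖f x‖ ≤ 1) (d : ZMod n) : ∀ x, ‖Dl d f x‖ ≤ 1 := by
  intro x
  rw [Dl, norm_mul, RCLike.norm_conj]
  exact mul_le_one₀ (hf _) (norm_nonneg _) (hf _)

lemma Dl_comm (d d' : ZMod n) (f : ZMod n → ℂ) : Dl d (Dl d' f) = Dl d' (Dl d f) := by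
  funext x
  simp only [Dl, map_mul, Complex.conj_conj]
  rw [add_right_comm x d d']
  ring

lemma autoc (F : ZMod n → ℂ) : 𝔼 d, 𝔼 x, Dl d F x = ((‖𝔼 x, F x‖^2 : ℝ) : ℂ) := by
  rw [normsq_exp, exp_comm]
  refine ec fun x => ?_
  simp only [Dl]
  exact shiftL x (fun y => F x * conj (F y))

noncomputable def G : ℕ → (ZMod n → ℂ) → ℝ
  | 0, f => ‖𝔼 x, f x‖^2
  | (s+1), f => 𝔼 d, G s (Dl d f)

lemma G_nonneg (s : ℕ) (f : ZMod n → ℂ) : 0 ≤ G s f := by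
  induction s generalizing f with
  | zero => simp only [G]; positivity
  | succ s ih => simp only [G]; exact exp_nonneg fun d => ih _

lemma G_le_one (s : ℕ) {f : ZMod n → ℂ} (hf : ∀ x, ‖f x‖ ≤ 1) : G s f ≤ 1 := by
  induction s generalizing f with
  | zero => simp only [G]; exact pow_le_one₀ (norm_nonneg _) (nexp_le_one hf)
  | succ s ih => simp only [G]; exact exp_le_one fun d => ih (Dl_bdd hf d)

lemma hat_autoc (f : ZMod n → ℂ) (ξ : ZMod n) :
    hat (fun d => 𝔼 x, Dl d f x) ξ = ((‖hat f (-ξ)‖^2 : ℝ) : ℂ) := by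
  rw [hat, hat, normsq_exp]
  simp only [expect_mul]
  rw [exp_comm]
  refine ec fun x => ?_
  rw [← shiftL x (fun y => f x * e (-ξ * x) * conj (f y * e (-ξ * y)))]
  refine ec fun d => ?_
  have : ξ * d = -ξ * x + -(-ξ * (x + d)) := by ring
  rw [Dl, this, e_add, e_neg, map_mul]
  ring

lemma G_one (f : ZMod n → ℂ) : G 1 f = ∑ ξ, ‖hat f ξ‖^4 := by
  have : G 1 f = 𝔼 d, ‖(fun d => 𝔼 x, Dl d f x) d‖^2 := rfl
  rw [this, ← parseval]
  rw [← Equiv.sum_comp (Equiv.neg (ZMod n))]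
  refine Finset.sum_congr rfl fun ξ _ => ?_
  rw [hat_autoc, norm_real (by positivity), Equiv.neg_apply, neg_neg]
  ring

lemma G_one_le {f : ZMod n → ℂ} (hf : ∀ x, ‖f x‖ ≤ 1) : ∃ ξ, G 1 f ≤ ‖hat f ξ‖^2 := by
  obtain ⟨ξ, _, hξ⟩ := Finset.exists_max_image (univ : Finset (ZMod n))
    (fun ξ => ‖hat f ξ‖) univ_nonempty
  refine ⟨ξ, ?_⟩
  rw [G_one]
  calc ∑ ζ, ‖hat f ζ‖^4 ≤ ∑ ζ, ‖hat f ξ‖^2 * ‖hat f ζ‖^2 := by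
        refine Finset.sum_le_sum fun ζ hζ => ?_
        have := hξ ζ hζ
        calc ‖hat f ζ‖^4 = ‖hat f ζ‖^2 * ‖hat f ζ‖^2 := by ring
          _ ≤ _ := by gcongr
    _ = ‖hat f ξ‖^2 * 𝔼 x, ‖f x‖^2 := by rw [← Finset.mul_sum, parseval]
    _ ≤ ‖hat f ξ‖^2 := by
        refine mul_le_of_le_one_right (by positivity) (exp_le_one fun x => ?_)
        exact pow_le_one₀ (norm_nonneg _) (hf x)

def PD (h : ZMod n → ℝ) : Prop := ∀ α, ∃ v : ℝ, 0 ≤ v ∧ hat (fun d => (h d : ℂ)) α = v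

lemma PD_exp {ι : Type*} [Fintype ι] (h : ι → ZMod n → ℝ) (hh : ∀ i, PD (h i)) :
    PD (fun d => 𝔼 i, h i d) := by
  intro α
  choose v hv0 hv using fun i => hh i α
  refine ⟨𝔼 i, v i, exp_nonneg hv0, ?_⟩
  rw [ofReal_exp]
  simp only [← hv, hat, ofReal_exp, expect_mul]
  rw [exp_comm]

lemma PD_G (s : ℕ) (f : ZMod n → ℂ) : PD (fun d => G s (Dl d f)) := by
  induction s generalizing f with
  | zero =>
    intro α
    refine ⟨𝔼 d', ‖hat (Dl d' f) (-α)‖^2, exp_nonneg fun _ => by positivity, ?_⟩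
    rw [ofReal_exp]
    simp only [← hat_autoc]
    simp only [hat, G]
    rw [exp_comm]
    refine ec fun d => ?_
    rw [← autoc]
    simp only [expect_mul, Dl_comm d]
  | succ s ih =>
    have := PD_exp (fun d' d => G s (Dl d (Dl d' f))) (fun d' => ih _)
    convert this using 2 with d
    simp only [G]
    refine ec fun d' => ?_
    rw [Dl_comm]

lemma lemR {ι : Type*} [Fintype ι] (dir : ι → ZMod n) (S : Finset (ZMod n)) (ε : ℝ) (hε : 0 ≤ ε)
    (hS : ∀ α, α ∉ S → ‖𝔼 p, e (α * dir p)‖ ≤ ε) (h : ZMod n → ℝ) (hp : PD h)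
    (h0 : ∀ d, 0 ≤ h d) (h1 : ∀ d, h d ≤ 1) :
    𝔼 p, h (dir p) ≤ S.card * (𝔼 d, h d) + ε := by
  choose v hv0 hv using hp
  have hvle : ∀ α, v α ≤ 𝔼 d, h d := by
    intro α
    have : v α = ‖hat (fun d => (h d : ℂ)) α‖ := by rw [hv, norm_real (hv0 α)]
    rw [this]
    refine (nexp_le _).trans (exp_mono fun d => ?_)
    rw [norm_mul, norm_e, mul_one, norm_real (h0 d)]
  have hsum : ∑ α, v α ≤ 1 := by
    have := inversion (fun d => (h d : ℂ)) 0
    simp only [hv, mul_zero, neg_zero, e_zero, mul_one] at this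
    have h2 : ∑ α, v α = h 0 := by exact_mod_cast this
    rw [h2]; exact h1 0
  have hinv : ((𝔼 p, h (dir p) : ℝ) : ℂ) = ∑ α, (v α : ℂ) * 𝔼 p, e (-α * dir p) := by
    rw [ofReal_exp]
    simp only [mul_expect]
    rw [← Finset.expect_sum_comm]
    refine ec fun p => ?_
    rw [← inversion (fun d => (h d : ℂ))]
    simp only [hv, neg_mul]
  have hneg : ∀ α, ‖𝔼 p, e (-α * dir p)‖ = ‖𝔼 p, e (α * dir p)‖ := by
    intro α
    rw [← RCLike.norm_conj, conj_exp]
    congr 1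
    refine ec fun p => ?_
    rw [neg_mul, e_neg, Complex.conj_conj]
  have hle1 : ∀ α, ‖𝔼 p, e (α * dir p)‖ ≤ 1 := fun α => nexp_le_one fun p => (norm_e _).le
  have hnn : 0 ≤ 𝔼 p, h (dir p) := exp_nonneg fun p => h0 _
  classical
  have hE := exp_nonneg h0
  rw [← norm_real hnn, hinv]
  calc _ ≤ ∑ α, v α * ‖𝔼 p, e (α * dir p)‖ := by
        refine (norm_sum_le _ _).trans (Finset.sum_le_sum fun α _ => ?_)
        rw [norm_mul, norm_real (hv0 α), hneg]
    _ ≤ ∑ α, ((if α ∈ S then 𝔼 d, h d else 0) + v α * ε) := by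
        refine Finset.sum_le_sum fun α _ => ?_
        split_ifs with ha
        · have := mul_le_of_le_one_right (hv0 α) (hle1 α)
          have := mul_nonneg (hv0 α) hε
          linarith [hvle α]
        · rw [zero_add]
          exact mul_le_mul_of_nonneg_left (hS α ha) (hv0 α)
    _ = S.card * (𝔼 d, h d) + (∑ α, v α) * ε := by
        rw [Finset.sum_add_distrib, ← Finset.sum_mul]
        simp
    _ ≤ _ := by
        have := mul_le_of_le_one_left hε hsum
        linarith
end zm
end NR

namespace NR

section lin
set_option linter.unusedSectionVars false
variable {n : ℕ} [NeZero n] {ι : Type*} [Fintype ι]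

noncomputable def Q (z : ι → ZMod n) (c : ZMod n) (g : ZMod n → ℂ) : ℝ :=
  𝔼 j, ‖𝔼 r, g (j + c * z r)‖^2

lemma Q_nonneg (z : ι → ZMod n) (c : ZMod n) (g : ZMod n → ℂ) : 0 ≤ Q z c g :=
  exp_nonneg fun _ => by positivity

lemma Q_le_one (z : ι → ZMod n) (c : ZMod n) {g : ZMod n → ℂ} (hg : ∀ x, ‖g x‖ ≤ 1) :
    Q z c g ≤ 1 :=
  exp_le_one fun _ => pow_le_one₀ (norm_nonneg _) (nexp_le_one fun _ => hg _)

lemma Q_shift (z : ι → ZMod n) (c : ZMod n) (g : ZMod n → ℂ) (a : ZMod n) :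
    Q z c (fun x => g (x + a)) = Q z c g := by
  rw [Q, Q]
  refine shcR a fun j => ?_
  simp only [add_right_comm j a]

lemma Q_eq (z : ι → ZMod n) (c : ZMod n) (g : ZMod n → ℂ) :
    ((Q z c g : ℝ) : ℂ) = 𝔼 r, 𝔼 r', 𝔼 j, Dl (c * (z r' - z r)) g j := by
  rw [Q, expsq_eq]
  refine ec fun r => ec fun r' => ?_
  refine shc (c * z r) fun j => ?_
  rw [Dl]; congr 3; ring

lemma exp_Q (z : ι → ZMod n) (c : ZMod n) (g : ZMod n → ℂ) :
    𝔼 d, Q z c (Dl d g) = 𝔼 r, 𝔼 r', G 0 (Dl (c * (z r' - z r)) g) := by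
  have : ((𝔼 d, Q z c (Dl d g) : ℝ) : ℂ) = ((𝔼 r, 𝔼 r', G 0 (Dl (c * (z r' - z r)) g) : ℝ) : ℂ) := by
    simp only [ofReal_exp, Q_eq]
    rw [exp_comm]
    refine ec fun r => ?_
    rw [exp_comm]
    refine ec fun r' => ?_
    simp only [G]
    rw [← autoc]
    simp only [Dl_comm]
  exact_mod_cast this

lemma L2_2 (z : ι → ZMod n) (l1 l4 : ZMod n) (g1 g4 : ZMod n → ℂ) (h4 : ∀ x, ‖g4 x‖ ≤ 1) :
    ‖𝔼 t, 𝔼 j, g1 (j + l1 * z t) * g4 (j + l4 * z t)‖^2 ≤ Q z (l1 - l4) g1 := by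
  have : 𝔼 t, 𝔼 j, g1 (j + l1 * z t) * g4 (j + l4 * z t)
      = 𝔼 j, g4 j * 𝔼 t, g1 (j + (l1 - l4) * z t) := by
    simp only [mul_expect]
    rw [exp_comm (ι := ZMod n)]
    refine ec fun t => ?_
    refine shc (l4 * z t) fun j => ?_
    rw [mul_comm]; congr 2; ring
  rw [this]
  exact cs_kill _ _ h4

lemma sq_exp_exp_le {α β : Type*} [Fintype α] [Fintype β] (X : α → β → ℝ) (h : ∀ a b, 0 ≤ X a b) (k : ℕ) :
    (𝔼 a, 𝔼 b, X a b)^(2^k) ≤ 𝔼 a, 𝔼 b, X a b^(2^k) :=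
  (exp_pow_le _ (fun a => exp_nonneg (h a)) k).trans (exp_mono fun a => exp_pow_le _ (h a) k)

lemma L2_3 (z : ι → ZMod n) (l1 l3 l4 : ZMod n) (g1 g3 g4 : ZMod n → ℂ)
    (h3 : ∀ x, ‖g3 x‖ ≤ 1) (h4 : ∀ x, ‖g4 x‖ ≤ 1) :
    ‖𝔼 t, 𝔼 t', 𝔼 j, g1 (j + l1 * (z t + z t')) * g3 (j + l3 * (z t + z t')) *
      g4 (j + l4 * (z t + z t'))‖^4 ≤
      𝔼 t, 𝔼 s, Q z (l1 - l4) (Dl ((l1 - l3) * (z s - z t)) g1) := by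
  have : 𝔼 t, 𝔼 t', 𝔼 j, g1 (j + l1 * (z t + z t')) * g3 (j + l3 * (z t + z t')) *
      g4 (j + l4 * (z t + z t'))
      = 𝔼 p : ι × ZMod n, g3 (p.2 + l3 * z p.1) * 𝔼 t, (g1 (p.2 + l1 * z p.1 + (l1 - l3) * z t) *
        g4 (p.2 + l4 * z p.1 + (l4 - l3) * z t)) := by
    simp only [mul_expect]
    rw [exp_comm (ι := ι × ZMod n)]
    refine ec fun t => ?_
    rw [exp_prod]
    refine ec fun t' => ?_
    refine shc (l3 * z t) fun j => ?_
    rw [← mul_assoc, mul_comm (g3 _)]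
    ring_nf
  rw [this]
  have hk := kill (fun p : ι × ZMod n => g3 (p.2 + l3 * z p.1)) (fun p t => (g1 (p.2 + l1 * z p.1 + (l1 - l3) * z t) *
        g4 (p.2 + l4 * z p.1 + (l4 - l3) * z t))) (fun p => h3 _)
  rw [show (4:ℕ) = 2 * 2 from rfl, pow_mul]
  refine (pow_le_pow_left₀ (by positivity) hk 2).trans ?_
  refine (sq_exp_exp_le _ (fun _ _ => norm_nonneg _) 1).trans ?_
  refine exp_mono fun t => exp_mono fun s => ?_
  rw [← Q_shift _ _ _ ((l1 - l3) * z t)]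
  refine le_trans (le_of_eq ?_) (L2_2 z l1 l4 _ (fun x => Dl ((l4 - l3) * (z s - z t)) g4
    (x + (l4 - l3) * z t)) (fun x => Dl_bdd h4 _ _))
  congr 2
  rw [exp_prod]
  refine ec fun t' => ec fun j => ?_
  simp only [Dl, map_mul]
  ring_nf

lemma L2_4 (z : ι → ZMod n) (l1 l2 l3 l4 : ZMod n) (g1 g2 g3 g4 : ZMod n → ℂ)
    (h2 : ∀ x, ‖g2 x‖ ≤ 1) (h3 : ∀ x, ‖g3 x‖ ≤ 1) (h4 : ∀ x, ‖g4 x‖ ≤ 1) :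
    ‖𝔼 t1, 𝔼 t, 𝔼 t', 𝔼 j, g1 (j + l1 * (z t1 + z t + z t')) * g2 (j + l2 * (z t1 + z t + z t')) *
      g3 (j + l3 * (z t1 + z t + z t')) * g4 (j + l4 * (z t1 + z t + z t'))‖^8 ≤
      𝔼 t1, 𝔼 s1, 𝔼 t, 𝔼 s, Q z (l1 - l4) (Dl ((l1 - l3) * (z s - z t))
        (Dl ((l1 - l2) * (z s1 - z t1)) g1)) := by
  have : 𝔼 t1, 𝔼 t, 𝔼 t', 𝔼 j, g1 (j + l1 * (z t1 + z t + z t')) * g2 (j + l2 * (z t1 + z t + z t')) *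
      g3 (j + l3 * (z t1 + z t + z t')) * g4 (j + l4 * (z t1 + z t + z t'))
      = 𝔼 p : ι × ι × ZMod n, g2 (p.2.2 + l2 * (z p.1 + z p.2.1)) * 𝔼 t,
        (g1 (p.2.2 + l1 * (z p.1 + z p.2.1) + (l1 - l2) * z t) *
        g3 (p.2.2 + l3 * (z p.1 + z p.2.1) + (l3 - l2) * z t) *
        g4 (p.2.2 + l4 * (z p.1 + z p.2.1) + (l4 - l2) * z t)) := by
    simp only [mul_expect]
    rw [exp_comm (ι := ι × ι × ZMod n)]
    refine ec fun t => ?_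
    rw [exp_prod]
    refine ec fun t' => ?_
    rw [exp_prod]
    refine ec fun t'' => ?_
    refine shc (l2 * z t) fun j => ?_
    rw [← mul_assoc, ← mul_assoc, mul_comm (g2 _)]
    ring_nf
  rw [this]
  have hk := kill (fun p : ι × ι × ZMod n => g2 (p.2.2 + l2 * (z p.1 + z p.2.1))) (fun p t =>
        (g1 (p.2.2 + l1 * (z p.1 + z p.2.1) + (l1 - l2) * z t) *
        g3 (p.2.2 + l3 * (z p.1 + z p.2.1) + (l3 - l2) * z t) *
        g4 (p.2.2 + l4 * (z p.1 + z p.2.1) + (l4 - l2) * z t))) (fun p => h2 _)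
  rw [show (8:ℕ) = 2 * 4 from rfl, pow_mul]
  refine (pow_le_pow_left₀ (by positivity) hk 4).trans ?_
  refine (sq_exp_exp_le _ (fun _ _ => norm_nonneg _) 2).trans ?_
  refine exp_mono fun t => exp_mono fun s => ?_
  have key := L2_3 z l1 l3 l4 (fun x => Dl ((l1 - l2) * (z s - z t)) g1
    (x + (l1 - l2) * z t)) (fun x => Dl ((l3 - l2) * (z s - z t)) g3
    (x + (l3 - l2) * z t)) (fun x => Dl ((l4 - l2) * (z s - z t)) g4
    (x + (l4 - l2) * z t)) (fun x => Dl_bdd h3 _ _) (fun x => Dl_bdd h4 _ _)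
  refine le_trans (le_of_eq ?_) (key.trans (le_of_eq ?_))
  · congr 2
    rw [exp_prod]
    refine ec fun t' => ?_
    rw [exp_prod]
    refine ec fun t'' => ec fun j => ?_
    simp only [Dl, map_mul]
    ring_nf
  · refine ec fun t' => ec fun s' => ?_
    rw [← Q_shift z _ (Dl _ (Dl _ _)) ((l1 - l2) * z t)]
    congr 1
    funext x
    simp only [Dl]
    ring_nf

lemma L3 {κ : Type*} [Fintype κ] (z : ι → ZMod n) (a c : κ → ZMod n) (g : ZMod n → ℂ)
    (hg : ∀ x, ‖g x‖ ≤ 1) :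
    (𝔼 i, Q z (a i) (Dl (c i) g))^8 ≤
      𝔼 i, 𝔼 i', 𝔼 s, 𝔼 s', Q z (a i') (Dl (a i * (z s' - z s)) (Dl (c i - c i') g)) := by
  set A : κ → ZMod n → ℂ := fun i j => 𝔼 s, Dl (c i) g (j + a i * z s) with hA
  have hA1 : ∀ i j, ‖A i j‖ ≤ 1 := fun i j => nexp_le_one fun s => Dl_bdd hg _ _
  have e1 : ((𝔼 i, Q z (a i) (Dl (c i) g) : ℝ) : ℂ) =
      𝔼 j, g j * 𝔼 q : κ × ι, (conj (g (j + c q.1)) * conj (A q.1 (j - a q.1 * z q.2))) := by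
    simp only [mul_expect]
    rw [exp_comm (ι := ZMod n), exp_prod, ofReal_exp]
    refine ec fun i => ?_
    simp only
    rw [Q, ofReal_exp]
    simp only [nsq]
    have : ∀ j, (𝔼 r, Dl (c i) g (j + a i * z r)) * conj (𝔼 r, Dl (c i) g (j + a i * z r))
      = 𝔼 r, Dl (c i) g (j + a i * z r) * conj (A i j) := by
      intro j; rw [expect_mul]
    simp only [this]
    rw [exp_comm (ι := ZMod n)]
    refine ec fun s => ?_
    refine shc (a i * z s) fun j => ?_
    rw [Dl, add_sub_cancel_right]; ring
  have hn : 0 ≤ 𝔼 i, Q z (a i) (Dl (c i) g) := exp_nonneg fun i => Q_nonneg _ _ _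
  rw [← norm_real hn, e1]
  have s1 := cs_kill g (fun j => 𝔼 q : κ × ι, (conj (g (j + c q.1)) * conj (A q.1 (j - a q.1 * z q.2)))) hg
  rw [show (8:ℕ) = 2 * 4 from rfl, pow_mul]
  refine (pow_le_pow_left₀ (by positivity) s1 4).trans ?_
  have hn2 : 0 ≤ 𝔼 j, ‖𝔼 q : κ × ι, (conj (g (j + c q.1)) * conj (A q.1 (j - a q.1 * z q.2)))‖^2 :=
    exp_nonneg fun _ => by positivity
  rw [← norm_real hn2, expsq_eq]
  have e2 : 𝔼 q : κ × ι, 𝔼 q' : κ × ι, 𝔼 j, conj (g (j + c q.1)) * conj (A q.1 (j - a q.1 * z q.2)) *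
      conj (conj (g (j + c q'.1)) * conj (A q'.1 (j - a q'.1 * z q'.2))) =
      𝔼 i, 𝔼 i', 𝔼 p : ι × ZMod n, conj (A i p.2) * 𝔼 s, (conj (g (p.2 + c i + a i * z s)) *
        g (p.2 + c i' + a i * z s) * A i' (p.2 + a i * z s - a i' * z p.1)) := by
    rw [exp_prod]
    refine ec fun i => ?_
    simp only [exp_prod (ι := κ)]
    rw [exp_comm (ι := ι)]
    refine ec fun i' => ?_
    simp only [mul_expect]
    rw [exp_comm (ι := ι × ZMod n)]
    refine ec fun s => ?_
    rw [exp_prod]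
    refine ec fun s' => ?_
    refine shc (-(a i * z s)) fun j => ?_
    simp only [map_mul, Complex.conj_conj]
    ring_nf
  rw [e2]
  refine (nexp_pow_le _ 2).trans (exp_mono fun i => ?_)
  refine (nexp_pow_le _ 2).trans (exp_mono fun i' => ?_)
  have hk := kill (fun p : ι × ZMod n => conj (A i p.2)) (fun p s => (conj (g (p.2 + c i + a i * z s)) *
        g (p.2 + c i' + a i * z s) * A i' (p.2 + a i * z s - a i' * z p.1)))
        (fun p => by rw [RCLike.norm_conj]; exact hA1 _ _)
  rw [show (2^2:ℕ) = 2 * 2 from rfl, pow_mul]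
  refine (pow_le_pow_left₀ (by positivity) hk 2).trans ?_
  refine (sq_exp_exp_le _ (fun _ _ => norm_nonneg _) 1).trans ?_
  refine exp_mono fun s => exp_mono fun s' => ?_
  set W : ZMod n → ℂ := fun x => Dl (a i * (z s' - z s)) (Dl (c i - c i') g) (x + c i' + a i * z s)
    with hW
  have e3 : 𝔼 p : ι × ZMod n, conj (g (p.2 + c i + a i * z s)) *
        g (p.2 + c i' + a i * z s) * A i' (p.2 + a i * z s - a i' * z p.1) * conj (
        conj (g (p.2 + c i + a i * z s')) *
        g (p.2 + c i' + a i * z s') * A i' (p.2 + a i * z s' - a i' * z p.1)) =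
      𝔼 j, (A i' (j + a i * z s) * conj (A i' (j + a i * z s'))) * 𝔼 r, W (j + a i' * z r) := by
    rw [exp_prod]
    simp only [mul_expect]
    rw [exp_comm (ι := ZMod n)]
    refine ec fun r => ?_
    refine shc (-(a i' * z r)) fun j => ?_
    simp only [hW, Dl, map_mul, Complex.conj_conj]
    ring_nf
  rw [e3]
  refine (cs_kill _ _ fun j => ?_).trans (le_of_eq ?_)
  · rw [norm_mul, RCLike.norm_conj]
    exact mul_le_one₀ (hA1 _ _) (norm_nonneg _) (hA1 _ _)
  · have := Q_shift z (a i') (Dl (a i * (z s' - z s)) (Dl (c i - c i') g)) (c i' + a i * z s)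
    rw [← this, Q]
    simp only [hW, add_assoc]
end lin
end NR

namespace NR

section box
set_option linter.unusedSectionVars false
variable {n : ℕ} [NeZero n] {M : ℕ}

abbrev T3 (M : ℕ) := Fin M × Fin M × Fin M

def Vt (w : ℤ) (t : T3 M) (v : Fin M) : ℤ :=
  ((v:ℕ):ℤ) + ((t.1:ℕ):ℤ) + ((t.2.1:ℕ):ℤ) + ((t.2.2:ℕ):ℤ) + w

noncomputable def T (w : ℤ) (f0 : ZMod n → Fin M → ℂ) (f1 : ZMod n → ℤ → ℂ)
    (f2 : Fin M → ZMod n → ℂ) : ℂ :=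
  𝔼 t : T3 M, 𝔼 j, 𝔼 v, 𝔼 u, f0 j u * f1 j (Vt w t v) *
    f2 u (j + (((Vt w t v - ((u:ℕ):ℤ))^2 : ℤ) : ZMod n))

lemma box (w : ℤ) (f0 : ZMod n → Fin M → ℂ) (f1 : ZMod n → ℤ → ℂ)
    (f2 : Fin M → ZMod n → ℂ) (h0 : ∀ j u, ‖f0 j u‖ ≤ 1) (h1 : ∀ j V, ‖f1 j V‖ ≤ 1) :
    ‖T w f0 f1 f2‖^4 ≤ 𝔼 t : T3 M, 𝔼 j, 𝔼 u, 𝔼 u',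
      ‖𝔼 v, f2 u (j + (((Vt w t v - ((u:ℕ):ℤ))^2 : ℤ) : ZMod n)) *
       conj (f2 u' (j + (((Vt w t v - ((u':ℕ):ℤ))^2 : ℤ) : ZMod n)))‖^2 := by
  refine (nexp_pow_le _ 2).trans (exp_mono fun t => ?_)
  have e1 : 𝔼 j, 𝔼 v, 𝔼 u, f0 j u * f1 j (Vt w t v) *
    f2 u (j + (((Vt w t v - ((u:ℕ):ℤ))^2 : ℤ) : ZMod n)) =
    𝔼 p : ZMod n × Fin M, f1 p.1 (Vt w t p.2) * 𝔼 u, f0 p.1 u *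
      f2 u (p.1 + (((Vt w t p.2 - ((u:ℕ):ℤ))^2 : ℤ) : ZMod n)) := by
    rw [exp_prod]
    refine ec fun j => ec fun v => ?_
    rw [mul_expect]
    refine ec fun u => ?_
    ring
  rw [e1, show (2^2:ℕ) = 2 * 2 from rfl, pow_mul]
  refine (pow_le_pow_left₀ (by positivity) (cs_kill _ _ fun p => h1 _ _) 2).trans ?_
  have hn : 0 ≤ 𝔼 p : ZMod n × Fin M, ‖𝔼 u, f0 p.1 u *
      f2 u (p.1 + (((Vt w t p.2 - ((u:ℕ):ℤ))^2 : ℤ) : ZMod n))‖^2 :=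
    exp_nonneg fun _ => by positivity
  rw [← norm_real hn, expsq_eq]
  have e2 : 𝔼 u, 𝔼 u', 𝔼 p : ZMod n × Fin M, f0 p.1 u *
      f2 u (p.1 + (((Vt w t p.2 - ((u:ℕ):ℤ))^2 : ℤ) : ZMod n)) * conj (f0 p.1 u' *
      f2 u' (p.1 + (((Vt w t p.2 - ((u':ℕ):ℤ))^2 : ℤ) : ZMod n))) =
      𝔼 q : ZMod n × Fin M × Fin M, (f0 q.1 q.2.1 * conj (f0 q.1 q.2.2)) *
        𝔼 v, f2 q.2.1 (q.1 + (((Vt w t v - ((q.2.1:ℕ):ℤ))^2 : ℤ) : ZMod n)) *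
       conj (f2 q.2.2 (q.1 + (((Vt w t v - ((q.2.2:ℕ):ℤ))^2 : ℤ) : ZMod n))) := by
    simp only [exp_prod]
    rw [exp_comm (ι := ZMod n)]
    refine ec fun u => ?_
    rw [exp_comm (ι := ZMod n)]
    refine ec fun u' => ec fun j => ?_
    rw [mul_expect]
    refine ec fun v => ?_
    rw [map_mul]; ring
  rw [e2]
  refine (cs_kill _ _ fun q => ?_).trans (le_of_eq ?_)
  · rw [norm_mul, RCLike.norm_conj]
    exact mul_le_one₀ (h0 _ _) (norm_nonneg _) (h0 _ _)
  · simp only [exp_prodR]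

def zf (t : Fin M) : ZMod n := ((t:ℕ) : ZMod n)

noncomputable def BoxN (m k : ℤ) (f : ZMod n → ℂ) : ℝ :=
  𝔼 t1 : Fin M, 𝔼 s1 : Fin M, 𝔼 t : Fin M, 𝔼 s : Fin M,
    Q (zf (M := M)) (2 * ((k + m : ℤ) : ZMod n)) (Dl (2 * (k : ZMod n) * (zf s - zf t))
      (Dl (2 * (m : ZMod n) * (zf s1 - zf t1)) f))

lemma BoxN_nonneg (m k : ℤ) (f : ZMod n → ℂ) : 0 ≤ BoxN (M := M) m k f :=
  exp_nonneg fun _ => exp_nonneg fun _ => exp_nonneg fun _ => exp_nonneg fun _ => Q_nonneg _ _ _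

lemma BoxN_le_one (m k : ℤ) {f : ZMod n → ℂ} (hf : ∀ x, ‖f x‖ ≤ 1) : BoxN (M := M) m k f ≤ 1 :=
  exp_le_one fun _ => exp_le_one fun _ => exp_le_one fun _ => exp_le_one fun _ =>
    Q_le_one _ _ (Dl_bdd (Dl_bdd hf _) _)

lemma BoxN_shift (m k : ℤ) (f : ZMod n → ℂ) (a : ZMod n) :
    BoxN (M := M) m k (fun x => f (x + a)) = BoxN (M := M) m k f := by
  refine ec fun t1 => ec fun s1 =>
    ec fun t => ec fun s => ?_
  refine Eq.trans ?_ (Q_shift _ _ _ a)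
  congr 1
  funext x
  simp only [Dl]
  ring_nf

lemma L1 (w : ℤ) (f0 : ZMod n → Fin M → ℂ) (f1 : ZMod n → ℤ → ℂ)
    (f2 : Fin M → ZMod n → ℂ) (h0 : ∀ j u, ‖f0 j u‖ ≤ 1) (h1 : ∀ j V, ‖f1 j V‖ ≤ 1)
    (h2 : ∀ u j, ‖f2 u j‖ ≤ 1) :
    ‖T w f0 f1 f2‖^32 ≤ 𝔼 u : Fin M, 𝔼 u' : Fin M, 𝔼 v : Fin M, 𝔼 v' : Fin M,
      BoxN (M := M) (((v:ℕ):ℤ) - ((v':ℕ):ℤ)) (((u':ℕ):ℤ) - ((u:ℕ):ℤ)) (f2 u) := by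
  rw [show (32:ℕ) = 4 * 2^3 from rfl, pow_mul]
  refine (pow_le_pow_left₀ (by positivity) (box w f0 f1 f2 h0 h1) _).trans ?_
  set X : ℝ := 𝔼 t : T3 M, 𝔼 j, 𝔼 u, 𝔼 u',
      ‖𝔼 v, f2 u (j + (((Vt w t v - ((u:ℕ):ℤ))^2 : ℤ) : ZMod n)) *
       conj (f2 u' (j + (((Vt w t v - ((u':ℕ):ℤ))^2 : ℤ) : ZMod n)))‖^2 with hX
  have hn : 0 ≤ X := exp_nonneg fun _ => exp_nonneg fun _ => exp_nonneg fun _ => exp_nonneg fun _ => by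
    positivity
  set P : Fin M → Fin M → Fin M → Fin M → T3 M → ZMod n → ℂ := fun u u' v v' t j =>
    f2 u (j + (((Vt w t v - ((u:ℕ):ℤ))^2 : ℤ) : ZMod n)) *
       conj (f2 u' (j + (((Vt w t v - ((u':ℕ):ℤ))^2 : ℤ) : ZMod n))) *
       conj (f2 u (j + (((Vt w t v' - ((u:ℕ):ℤ))^2 : ℤ) : ZMod n)) *
       conj (f2 u' (j + (((Vt w t v' - ((u':ℕ):ℤ))^2 : ℤ) : ZMod n)))) with hP
  have e1 : (X : ℂ) = 𝔼 u, 𝔼 u', 𝔼 v, 𝔼 v', 𝔼 t, 𝔼 j, P u u' v v' t j := by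
    rw [hX]
    simp only [ofReal_exp, normsq_exp]
    have := fun (a : T3 M) => exp_comm (fun (j : ZMod n) u => 𝔼 u', 𝔼 v, 𝔼 v', P u u' v v' a j)
    simp only [hP] at this ⊢
    simp only [this]
    rw [exp_comm (ι := T3 M)]
    refine ec fun u => ?_
    have := fun (a : T3 M) => exp_comm (fun (j : ZMod n) u' => 𝔼 v, 𝔼 v', P u u' v v' a j)
    simp only [hP] at this ⊢
    simp only [this]
    rw [exp_comm (ι := T3 M)]
    refine ec fun u' => ?_
    have := fun (a : T3 M) => exp_comm (fun (j : ZMod n) v => 𝔼 v', P u u' v v' a j)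
    simp only [hP] at this ⊢
    simp only [this]
    rw [exp_comm (ι := T3 M)]
    refine ec fun v => ?_
    have := fun (a : T3 M) => exp_comm (fun (j : ZMod n) v' => P u u' v v' a j)
    simp only [hP] at this ⊢
    simp only [this]
    rw [exp_comm (ι := T3 M)]
  rw [← norm_real hn, e1]
  refine (nexp_pow_le _ 3).trans (exp_mono fun u => ?_)
  refine (nexp_pow_le _ 3).trans (exp_mono fun u' => ?_)
  refine (nexp_pow_le _ 3).trans (exp_mono fun v => ?_)
  refine (nexp_pow_le _ 3).trans (exp_mono fun v' => ?_)
  set a : Fin M → Fin M → ZMod n := fun v u => ((((v:ℕ):ℤ) + w - ((u:ℕ):ℤ) : ℤ) : ZMod n) with ha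
  have key := L2_4 (zf (n := n) (M := M)) (2 * a v u) (2 * a v' u) (2 * a v u') (2 * a v' u')
    (fun x => f2 u (x + a v u ^ 2)) (fun x => conj (f2 u (x + a v' u ^ 2)))
    (fun x => conj (f2 u' (x + a v u' ^ 2))) (fun x => f2 u' (x + a v' u' ^ 2))
    (fun x => by rw [RCLike.norm_conj]; exact h2 _ _)
    (fun x => by rw [RCLike.norm_conj]; exact h2 _ _)  (fun x => h2 _ _)
  refine le_trans (le_of_eq ?_) (key.trans (le_of_eq ?_))
  · congr 2
    simp only [exp_prod]
    refine ec fun t1 => ec fun t =>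
      ec fun t' => ?_
    refine shc ((zf t1 + zf t + zf t')^2) fun j => ?_
    simp only [hP, ha, Vt, zf, map_mul, Complex.conj_conj]
    push_cast
    ring_nf
  · rw [← BoxN_shift _ _ _ (a v u ^ 2)]
    refine ec fun t1 => ec fun s1 =>
      ec fun t => ec fun s => ?_
    have h1 : 2 * a v u - 2 * a v' u' = 2 * (((((u':ℕ):ℤ) - ((u:ℕ):ℤ)) + (((v:ℕ):ℤ) - ((v':ℕ):ℤ)) : ℤ) : ZMod n) := by
      simp only [ha]; push_cast; ring
    have h2 : 2 * a v u - 2 * a v u' = 2 * ((((u':ℕ):ℤ) - ((u:ℕ):ℤ) : ℤ) : ZMod n) := by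
      simp only [ha]; push_cast; ring
    have h3 : 2 * a v u - 2 * a v' u = 2 * ((((v:ℕ):ℤ) - ((v':ℕ):ℤ) : ℤ) : ZMod n) := by
      simp only [ha]; push_cast; ring
    rw [h1, h2, h3]

abbrev I (M : ℕ) := ↥(Finset.Icc (-(M:ℤ)) M)

lemma card_I : Fintype.card (I M) = 2 * M + 1 := by
  rw [Fintype.card_coe, Int.card_Icc]; omega

instance : Nonempty (I M) := ⟨⟨0, by simp⟩⟩

noncomputable def tri (M : ℕ) (f : ZMod n → ℂ) : ℝ := 𝔼 m : I M, 𝔼 k : I M, BoxN (M := M) m k f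

lemma tri_nonneg (f : ZMod n → ℂ) : 0 ≤ tri M f :=
  exp_nonneg fun _ => exp_nonneg fun _ => BoxN_nonneg _ _ _

lemma tri_le_one {f : ZMod n → ℂ} (hf : ∀ x, ‖f x‖ ≤ 1) : tri M f ≤ 1 :=
  exp_le_one fun _ => exp_le_one fun _ => BoxN_le_one _ _ hf

lemma L1' (hM : 1 ≤ M) (w : ℤ) (f0 : ZMod n → Fin M → ℂ) (f1 : ZMod n → ℤ → ℂ)
    (f2 : Fin M → ZMod n → ℂ) (h0 : ∀ j u, ‖f0 j u‖ ≤ 1) (h1 : ∀ j V, ‖f1 j V‖ ≤ 1)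
    (h2 : ∀ u j, ‖f2 u j‖ ≤ 1) :
    ‖T w f0 f1 f2‖^32 ≤ 9 * 𝔼 u : Fin M, tri M (f2 u) := by
  have : NeZero M := ⟨by omega⟩
  refine (L1 w f0 f1 f2 h0 h1 h2).trans ?_
  rw [mul_expect]
  refine exp_mono fun u => ?_
  have hc : (Fintype.card (I M) : ℝ) ≤ 3 * Fintype.card (Fin M) := by
    rw [card_I, Fintype.card_fin]; push_cast
    have : (1:ℝ) ≤ M := by exact_mod_cast hM
    linarith
  have hin : ∀ v : Fin M, Function.Injective
      (fun u : Fin M => (⟨((u:ℕ):ℤ) - ((v:ℕ):ℤ), by rw [Finset.mem_Icc]; omega⟩ : I M)) := by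
    intro v a b hab
    simp only [Subtype.mk.injEq] at hab
    ext; omega
  have s1 : ∀ k : ℤ, 𝔼 v : Fin M, 𝔼 v' : Fin M, BoxN (M := M) (((v:ℕ):ℤ) - ((v':ℕ):ℤ)) k (f2 u)
      ≤ 3 * 𝔼 m : I M, BoxN (M := M) m k (f2 u) := by
    intro k
    rw [exp_commR]
    calc _ ≤ 𝔼 v' : Fin M, 3 * 𝔼 m : I M, BoxN (M := M) m k (f2 u) := exp_mono fun v' =>
          exp_inj _ (hin v') (fun m : I M => BoxN (M := M) m k (f2 u)) (fun m => BoxN_nonneg _ _ _) 3 hc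
      _ = _ := Fintype.expect_const _
  calc _ ≤ 𝔼 u' : Fin M, 3 * 𝔼 m : I M, BoxN (M := M) m (((u':ℕ):ℤ) - ((u:ℕ):ℤ)) (f2 u) :=
        exp_mono fun u' => s1 _
    _ ≤ 3 * 𝔼 k : I M, 3 * 𝔼 m : I M, BoxN (M := M) m k (f2 u) :=
        exp_inj _ (hin u) (fun k : I M => 3 * 𝔼 m : I M, BoxN (M := M) m k (f2 u))
          (fun k => mul_nonneg (by norm_num) (exp_nonneg fun _ => BoxN_nonneg _ _ _)) 3 hc
    _ = _ := by rw [← mul_expect, tri, exp_commR]; ring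
end box
end NR

namespace NR

section arith
set_option linter.unusedSectionVars false
variable {n : ℕ} [NeZero n]

def nrm (x : ZMod n) : ℕ := x.valMinAbs.natAbs

lemma nrm_add (x y : ZMod n) : nrm (x + y) ≤ nrm x + nrm y :=
  (ZMod.natAbs_valMinAbs_add_le x y).trans (Int.natAbs_add_le _ _)
lemma nrm_neg (x : ZMod n) : nrm (-x) = nrm x := ZMod.natAbs_valMinAbs_neg x
lemma nrm_sub (x y : ZMod n) : nrm (x - y) ≤ nrm x + nrm y := by
  rw [sub_eq_add_neg, ← nrm_neg y]; exact nrm_add _ _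
lemma nrm_int_le (k : ℤ) : nrm (k : ZMod n) ≤ k.natAbs := by
  apply ZMod.natAbs_min_of_le_div_two n
  · exact ZMod.coe_valMinAbs _
  · exact ZMod.natAbs_valMinAbs_le _
lemma nrm_int_eq (k : ℤ) (h : 2 * k.natAbs < n) : nrm (k : ZMod n) = k.natAbs := by
  rw [nrm, (ZMod.valMinAbs_spec (k : ZMod n) k).2 ⟨rfl, by constructor <;> omega⟩]
lemma nrm_int_mul (k : ℤ) (x : ZMod n) : nrm ((k : ZMod n) * x) ≤ k.natAbs * nrm x := by
  have h := nrm_int_le (n := n) (k * x.valMinAbs)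
  rw [Int.natAbs_mul] at h
  simpa [nrm] using h
lemma nrm_nat_mul (k : ℕ) (x : ZMod n) : nrm ((k : ZMod n) * x) ≤ k * nrm x := by
  have := nrm_int_mul (k : ℤ) x
  simpa using this
lemma nrm_le (x : ZMod n) : 2 * nrm x ≤ n := by
  have := ZMod.natAbs_valMinAbs_le x
  unfold nrm; omega

lemma e_eq (x : ZMod n) : e x = Complex.exp (Complex.I * ((2 * Real.pi * x.valMinAbs / n : ℝ) : ℂ)) := by
  have := ZMod.stdAddChar_coe (N := n) x.valMinAbs
  rw [ZMod.coe_valMinAbs] at this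
  rw [e, this]; push_cast; ring_nf

lemma abs_ang (x : ZMod n) : |2 * Real.pi * (x.valMinAbs:ℝ) / n| = 2 * Real.pi * nrm x / n := by
  rw [abs_div, abs_mul, abs_of_pos Real.two_pi_pos, Nat.abs_cast, nrm, Nat.cast_natAbs, Int.cast_abs]

lemma e_sub_one_le (x : ZMod n) : ‖e x - 1‖ ≤ 7 * nrm x / n := by
  rw [e_eq]
  refine Real.norm_exp_I_mul_ofReal_sub_one_le.trans ?_
  rw [Real.norm_eq_abs, abs_ang]
  have := Real.pi_lt_d2
  gcongr
  linarith

lemma le_e_sub_one (x : ZMod n) : 4 * (nrm x : ℝ) / n ≤ ‖e x - 1‖ := by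
  rw [e_eq, Complex.norm_exp_I_mul_ofReal_sub_one, norm_mul, Real.norm_eq_abs, Real.norm_eq_abs]
  have hn : (0:ℝ) < n := by exact_mod_cast Nat.pos_of_ne_zero (NeZero.ne n)
  have hp := Real.pi_pos
  have h1 : |2 * Real.pi * (x.valMinAbs:ℝ) / n / 2| = Real.pi * nrm x / n := by
    rw [abs_div, abs_ang, abs_of_pos (by norm_num : (0:ℝ) < 2)]; ring
  have h2 : (2 * nrm x : ℝ) ≤ n := by exact_mod_cast nrm_le x
  have := Real.mul_abs_le_abs_sin (x := 2 * Real.pi * (x.valMinAbs:ℝ) / n / 2) (by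
    rw [h1, div_le_iff₀ hn]; nlinarith)
  rw [h1] at this
  have h3 : 2 / Real.pi * (Real.pi * nrm x / n) = 2 * nrm x / n := by field_simp
  rw [h3] at this
  rw [abs_of_pos (by norm_num : (0:ℝ) < 2)]
  calc 4 * (nrm x : ℝ) / n = 2 * (2 * nrm x / n) := by ring
    _ ≤ _ := by gcongr

lemma e_nsmul (x : ZMod n) (k : ℕ) : e (x * (k : ZMod n)) = e x ^ k := by
  induction k with
  | zero => simp [e_zero]
  | succ k ih => rw [Nat.cast_succ, mul_add, mul_one, e_add, ih, pow_succ]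

lemma geom (x : ZMod n) (L : ℕ) : ‖∑ v ∈ range L, e (x * (v : ZMod n))‖ * (2 * nrm x) ≤ n := by
  have hn : (0:ℝ) < n := by exact_mod_cast Nat.pos_of_ne_zero (NeZero.ne n)
  simp only [e_nsmul]
  have h1 := geom_sum_mul (e x) L
  have h2 : ‖(∑ i ∈ range L, e x ^ i) * (e x - 1)‖ ≤ 2 := by
    rw [h1]
    refine (norm_sub_le _ _).trans ?_
    rw [norm_pow, norm_e]; norm_num
  rw [norm_mul] at h2
  have h3 := le_e_sub_one x
  have h4 : ‖∑ i ∈ range L, e x ^ i‖ * (4 * (nrm x : ℝ) / n) ≤ 2 :=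
    (mul_le_mul_of_nonneg_left h3 (norm_nonneg _)).trans h2
  rw [← mul_div_assoc, div_le_iff₀ hn] at h4
  linarith

set_option maxHeartbeats 1000000 in
lemma MR {M K : ℕ} (hn : n = 64 * M^2) (hK : 2 ≤ K) (hM : K^16 ≤ M) (θ : ZMod n) (B : Finset ℤ)
    (hB : ∀ b ∈ B, |b| ≤ 2 * M) (hθ : ∀ b ∈ B, nrm ((b : ZMod n) * θ) ≤ K * M)
    (hc : M ≤ K * B.card) : ∃ r : ℕ, 1 ≤ r ∧ r ≤ K^16 ∧ nrm ((r : ZMod n) * θ) ≤ K^16 := by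
  have hK0 : 0 < K := by omega
  have hK3 : 41 * K^3 ≤ M := by
    calc 41 * K^3 ≤ 2^6 * K^3 := by omega
      _ ≤ K^6 * K^3 := by gcongr
      _ = K^9 := by ring
      _ ≤ K^16 := Nat.pow_le_pow_right hK0 (by norm_num)
      _ ≤ M := hM
  have hM5 : 5 * K ≤ M := by
    have : K * 1 ≤ K * K^2 := by gcongr; exact Nat.one_le_pow _ _ hK0
    nlinarith
  have hM0 : 0 < M := by omega
  obtain ⟨r, hr1, hr8, hrp⟩ : ∃ r : ℕ, 1 ≤ r ∧ r ≤ 8 * K ∧ nrm ((r : ZMod n) * θ) ≤ 2 * K * M := by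
    have hcB : 5 ≤ B.card := by
      by_contra h
      have : K * B.card ≤ K * 4 := by gcongr; omega
      omega
    set D := M / (4 * K) with hD
    have hD1 : D * (4 * K) ≤ M := Nat.div_mul_le_self _ _
    have hD2 : M < (D + 1) * (4 * K) := by
      have := Nat.lt_div_mul_add (a := M) (b := 4 * K) (by omega)
      rw [← hD] at this; nlinarith
    have h4D : 4 * D ≤ B.card := by
      have : K * (4 * D) ≤ K * B.card := by nlinarith
      exact Nat.le_of_mul_le_mul_left this hK0
    have hD2' : (M:ℤ) < (D + 1) * (4 * K) := by exact_mod_cast hD2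
    have hmap : ∀ b ∈ B, b / (8 * K : ℤ) ∈ Finset.Icc (-((D:ℤ) + 1)) D := by
      intro b hb
      have := abs_le.1 (hB b hb)
      have h8 : (0:ℤ) < 8 * K := by positivity
      rw [Finset.mem_Icc]
      constructor
      · rw [Int.le_ediv_iff_mul_le h8]; nlinarith
      · rw [← Int.lt_add_one_iff, Int.ediv_lt_iff_lt_mul h8]; nlinarith
    obtain ⟨b, hb, b', hb', hne, heq⟩ := Finset.exists_ne_map_eq_of_card_lt_of_maps_to (by
      rw [Int.card_Icc]; omega) hmap
    have h8 : (0:ℤ) < 8 * K := by positivity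
    have e1 := Int.emod_add_mul_ediv b (8 * K)
    have e2 := Int.emod_add_mul_ediv b' (8 * K)
    have e3 := Int.emod_nonneg b h8.ne'
    have e4 := Int.emod_lt_of_pos b h8
    have e5 := Int.emod_nonneg b' h8.ne'
    have e6 := Int.emod_lt_of_pos b' h8
    rw [heq] at e1
    have hdiff : (b - b').natAbs ≤ 8 * K := by omega
    refine ⟨(b - b').natAbs, by omega, hdiff, ?_⟩
    have hx : nrm (((b - b' : ℤ) : ZMod n) * θ) ≤ 2 * K * M := by
      push_cast
      rw [sub_mul]
      refine (nrm_sub _ _).trans ?_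
      have := hθ b hb
      have := hθ b' hb'
      linarith
    rcases Int.natAbs_eq (b - b') with h | h
    · rw [h] at hx; simpa using hx
    · rw [h, Int.cast_neg, neg_mul, nrm_neg] at hx; simpa using hx
  set ψ : ℤ := ((r : ZMod n) * θ).valMinAbs with hψ
  set p := nrm ((r : ZMod n) * θ) with hp
  have hpψ : ψ.natAbs = p := rfl
  refine ⟨r, hr1, ?_, ?_⟩
  · calc r ≤ 8 * K := hr8
      _ ≤ 2^3 * K := by omega
      _ ≤ K^3 * K := by gcongr
      _ = K^4 := by ring
      _ ≤ K^16 := Nat.pow_le_pow_right hK0 (by norm_num)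
  have hr0 : (0:ℤ) < r := by exact_mod_cast hr1
  have claim : ∀ b ∈ B, ∀ b' ∈ B, b ≤ b' → (r:ℤ) ∣ b' - b → (b' - b) * K ≤ M →
      (b' - b).natAbs * p ≤ 16 * K^2 * M := by
    intro b hb b' hb' hbb ⟨i, hi⟩ hW
    have hi0 : 0 ≤ i := by
      by_contra h
      push Not at h
      nlinarith
    have hib : i ≤ b' - b := by nlinarith
    lift i to ℕ using hi0
    have hx : nrm (((b' - b : ℤ) : ZMod n) * θ) ≤ 2 * K * M := by
      push_cast
      rw [sub_mul]
      refine (nrm_sub _ _).trans ?_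
      have := hθ b hb
      have := hθ b' hb'
      linarith
    have hx2 : ((b' - b : ℤ) : ZMod n) * θ = (((i:ℤ) * ψ : ℤ) : ZMod n) := by
      rw [hi]; push_cast; rw [hψ, ZMod.coe_valMinAbs]; ring
    have hiM : i * K ≤ M := by
      have : (i:ℤ) * K ≤ M := le_trans (by gcongr) hW
      exact_mod_cast this
    rw [hx2, nrm_int_eq] at hx
    · rw [Int.natAbs_mul, Int.natAbs_natCast, hpψ] at hx
      rw [hi, Int.natAbs_mul, Int.natAbs_natCast, Int.natAbs_natCast]
      calc r * i * p = r * (i * p) := by ring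
        _ ≤ 8 * K * (2 * K * M) := by gcongr
        _ = _ := by ring
    · rw [Int.natAbs_mul, Int.natAbs_natCast, hpψ, hn]
      calc 2 * (i * p) ≤ 2 * (i * (2 * K * M)) := by gcongr
        _ = 4 * (i * K) * M := by ring
        _ ≤ 4 * M * M := by gcongr
        _ < 64 * M^2 := by nlinarith
  set m := M / (41 * K^3) with hm
  have hm1 : m * (41 * K^3) ≤ M := Nat.div_mul_le_self _ _
  have hm2 : M < (m + 1) * (41 * K^3) := by
    have := Nat.lt_div_mul_add (a := M) (b := 41 * K^3) (by positivity)
    rw [← hm] at this; nlinarith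
  have hm0 : 1 ≤ m := by
    rw [hm, Nat.one_le_div_iff (by positivity)]; exact hK3
  set W : ℤ := ((M / K : ℕ) : ℤ) + 1 with hW
  have hW0 : 0 < W := by positivity
  have hWK : (M:ℤ) < W * K := by
    have := Nat.lt_div_mul_add (a := M) (b := K) (by omega)
    have h2 : (M:ℤ) < ((M / K : ℕ) : ℤ) * K + K := by exact_mod_cast this
    rw [hW]; linarith
  have hWK2 : (W - 1) * K ≤ M := by
    have := Nat.div_mul_le_self M K
    rw [hW, add_sub_cancel_right]; exact_mod_cast this
  have hmap : ∀ b ∈ B, (b % (r:ℤ), b / W) ∈ Finset.Ico (0:ℤ) r ×ˢ Finset.Icc (-(2 * K : ℤ)) (2 * K) := by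
    intro b hb
    have := abs_le.1 (hB b hb)
    rw [Finset.mem_product, Finset.mem_Ico, Finset.mem_Icc]
    refine ⟨⟨Int.emod_nonneg b hr0.ne', Int.emod_lt_of_pos b hr0⟩, ?_, ?_⟩
    · simp only
      rw [Int.le_ediv_iff_mul_le hW0]; nlinarith
    · simp only
      rw [← Int.lt_add_one_iff, Int.ediv_lt_iff_lt_mul hW0]; nlinarith
  have hcard : (Finset.Ico (0:ℤ) r ×ˢ Finset.Icc (-(2 * K : ℤ)) (2 * K)).card * m < B.card := by
    rw [Finset.card_product, Int.card_Ico, Int.card_Icc]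
    have h1 : ((r:ℤ) - 0).toNat = r := by omega
    have h2 : (2 * (K:ℤ) + 1 - -(2 * K)).toNat = 4 * K + 1 := by omega
    rw [h1, h2]
    have h3 : r * (4 * K + 1) * m ≤ 40 * K^2 * m := by
      apply Nat.mul_le_mul_right m
      calc r * (4 * K + 1) ≤ 8 * K * (5 * K) := by gcongr; omega
        _ = _ := by ring
    have h4 : K * (40 * K^2 * m) < K * B.card := by
      have : 0 < m * K^3 := by positivity
      calc K * (40 * K^2 * m) = 40 * (m * K^3) := by ring
        _ < m * (41 * K^3) := by nlinarith
        _ ≤ M := hm1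
        _ ≤ _ := hc
    have := Nat.lt_of_mul_lt_mul_left h4
    omega
  obtain ⟨y, -, hy⟩ := Finset.exists_lt_card_fiber_of_mul_lt_card_of_maps_to hmap hcard
  set F := B.filter fun b => (b % (r:ℤ), b / W) = y with hF
  have hFn : F.Nonempty := Finset.card_pos.1 (by omega)
  have hmin := F.min'_mem hFn
  have hmax := F.max'_mem hFn
  have hsub : F ⊆ Finset.Icc (F.min' hFn) (F.max' hFn) := fun x hx =>
    Finset.mem_Icc.2 ⟨F.min'_le x hx, F.le_max' x hx⟩
  have hcl := Finset.card_le_card hsub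
  rw [Int.card_Icc] at hcl
  have hle := F.min'_le _ hmax
  set b := F.min' hFn
  set b' := F.max' hFn
  rw [hF, mem_filter] at hmin hmax
  have hbe := hmin.2.trans hmax.2.symm
  rw [Prod.mk.injEq] at hbe
  have hdvd : (r:ℤ) ∣ b' - b := Int.ModEq.dvd hbe.1
  have hlt : b' - b ≤ W - 1 := by
    have e1 := Int.emod_add_mul_ediv b W
    have e2 := Int.emod_add_mul_ediv b' W
    have e3 := Int.emod_nonneg b hW0.ne'
    have e6 := Int.emod_lt_of_pos b' hW0
    rw [hbe.2] at e1
    linarith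
  have := claim b hmin.1 b' hmax.1 hle hdvd ((mul_le_mul_of_nonneg_right hlt (by positivity)).trans hWK2)
  have hmb : m ≤ (b' - b).natAbs := by omega
  have hfin : m * p ≤ m * (1312 * K^5) := by
    calc m * p ≤ (b' - b).natAbs * p := by gcongr
      _ ≤ 16 * K^2 * M := this
      _ ≤ 16 * K^2 * (2 * m * (41 * K^3)) := by
          gcongr
          nlinarith
      _ = _ := by ring
  have hp2 : p ≤ 1312 * K^5 := Nat.le_of_mul_le_mul_left hfin hm0
  calc p ≤ 1312 * K^5 := hp2
    _ ≤ 2^11 * K^5 := by omega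
    _ ≤ K^11 * K^5 := by gcongr
    _ = K^16 := by ring

open Classical in
noncomputable def Maj (R : ℕ) : Finset (ZMod n) :=
  Finset.univ.filter fun ξ => ∃ r : ℕ, 1 ≤ r ∧ r ≤ R ∧ nrm ((r : ZMod n) * ξ) ≤ R

lemma mem_Maj {R : ℕ} {ξ : ZMod n} :
    ξ ∈ Maj R ↔ ∃ r : ℕ, 1 ≤ r ∧ r ≤ R ∧ nrm ((r : ZMod n) * ξ) ≤ R := by
  simp [Maj]

lemma Maj_card (R : ℕ) : (Maj (n := n) R).card ≤ R * ((2 * R + 1) * R) := by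
  classical
  have hn : 0 < n := Nat.pos_of_ne_zero (NeZero.ne n)
  have h : ∀ ξ : ZMod n, ∃ r : ℕ, ξ ∈ Maj R → (1 ≤ r ∧ r ≤ R ∧ nrm ((r : ZMod n) * ξ) ≤ R) := by
    intro ξ
    by_cases hx : ξ ∈ Maj R
    · obtain ⟨r, hr⟩ := mem_Maj.1 hx
      exact ⟨r, fun _ => hr⟩
    · exact ⟨0, fun h => absurd h hx⟩
  choose r hr using h
  have := Finset.card_le_card_of_injOn (s := Maj (n := n) R)
    (t := Finset.Icc 1 R ×ˢ (Finset.Icc (-(R:ℤ)) R ×ˢ Finset.range R))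
    (fun ξ => (r ξ, ((r ξ : ZMod n) * ξ).valMinAbs, (r ξ * ξ.val) / n)) (by
      intro ξ hξ
      have := hr ξ hξ
      simp only [Finset.coe_product, Set.mem_prod, Finset.mem_coe, Finset.mem_Icc, mem_range]
      refine ⟨⟨this.1, this.2.1⟩, ?_, ?_⟩
      · have := this.2.2
        unfold nrm at this
        omega
      · rw [Nat.div_lt_iff_lt_mul hn]
        calc r ξ * ξ.val < r ξ * n := by
              apply Nat.mul_lt_mul_of_pos_left (ZMod.val_lt ξ) this.1
          _ ≤ R * n := by gcongr; exact this.2.1) (by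
      intro ξ hξ ζ hζ heq
      simp only [Prod.mk.injEq] at heq
      obtain ⟨h1, h2, h3⟩ := heq
      have hpos := (hr ξ hξ).1
      rw [← h1] at h2 h3
      have h4 := ZMod.injective_valMinAbs h2
      have h5 : ((r ξ * ξ.val : ℕ) : ZMod n) = ((r ξ * ζ.val : ℕ) : ZMod n) := by
        push_cast; simpa using h4
      rw [ZMod.natCast_eq_natCast_iff'] at h5
      have h6 : r ξ * ξ.val = r ξ * ζ.val := by
        rw [← Nat.div_add_mod (r ξ * ξ.val) n, ← Nat.div_add_mod (r ξ * ζ.val) n, h3, h5]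
      exact ZMod.val_injective n (Nat.eq_of_mul_eq_mul_left hpos h6))
  rw [Finset.card_product, Finset.card_product, Nat.card_Icc, Int.card_Icc, card_range] at this
  refine this.trans (le_of_eq ?_)
  congr 1
  congr 1
  omega
end arith
end NR

namespace NR

section weyl
set_option linter.unusedSectionVars false
variable {n : ℕ} [NeZero n]

lemma sum_Ico_int (a b : ℤ) (F : ℤ → ℂ) :
    ∑ v ∈ Finset.Ico a b, F v = ∑ i ∈ range (b - a).toNat, F (i + a) := by
  refine Finset.sum_bij' (fun v _ => (v - a).toNat) (fun i _ => (i:ℤ) + a) ?_ ?_ ?_ ?_ ?_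
  · intro v hv
    rw [Finset.mem_Ico] at hv
    rw [mem_range]; omega
  · intro v hv
    rw [mem_range] at hv
    rw [Finset.mem_Ico]; omega
  · intro v hv
    rw [Finset.mem_Ico] at hv
    omega
  · intro v hv
    simp
  · intro v hv
    rw [Finset.mem_Ico] at hv
    congr 1; omega

lemma geomInt (x : ZMod n) (a b : ℤ) :
    ‖∑ v ∈ Finset.Ico a b, e (x * (v : ZMod n))‖ * (2 * nrm x) ≤ n := by
  rw [sum_Ico_int]
  have : ∀ i : ℕ, e (x * (((i:ℤ) + a : ℤ) : ZMod n)) = e (x * (a : ZMod n)) * e (x * (i : ZMod n)) := by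
    intro i; rw [← e_add]; congr 1; push_cast; ring
  simp only [this]
  rw [← Finset.mul_sum, norm_mul, norm_e, one_mul]
  exact geom x _

lemma sum_shift (F : ℤ → ℂ) (hF : ∀ v, ‖F v‖ ≤ 1) (M s : ℕ) :
    ‖∑ v ∈ range M, F (v + s) - ∑ v ∈ range M, F v‖ ≤ 2 * s := by
  induction s with
  | zero => simp
  | succ s ih =>
    have h1 : ∑ v ∈ range M, F (v + ((s + 1 : ℕ) : ℤ)) - ∑ v ∈ range M, F (v + s) =
        F (M + s) - F s := by
      have e1 := Finset.sum_range_succ (fun v : ℕ => F (v + s)) M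
      have e2 := Finset.sum_range_succ' (fun v : ℕ => F (v + s)) M
      have e3 : ∀ v : ℕ, F (v + ((s + 1 : ℕ) : ℤ)) = F (((v + 1 : ℕ) : ℤ) + s) := by
        intro v; congr 1; push_cast; ring
      simp only [e3]
      rw [e1] at e2
      simp only [Nat.cast_zero, zero_add] at e2
      linear_combination -e2
    calc _ = ‖(F (M + s) - F s) + (∑ v ∈ range M, F (v + s) - ∑ v ∈ range M, F v)‖ := by
          rw [← h1]; congr 1; ring
      _ ≤ (1 + 1) + 2 * s := by
          refine (norm_add_le _ _).trans (add_le_add ((norm_sub_le _ _).trans (add_le_add (hF _) (hF _))) ih)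
      _ = _ := by push_cast; ring

lemma weyl1 {M K : ℕ} (hn : n = 64 * M^2) (hK : 2 ≤ K) (hM : K^160 ≤ M) (α β : ZMod n)
    (h : (M:ℝ) ≤ K * ‖∑ v ∈ range M, e (α * ((v:ℤ) : ZMod n)^2 + β * ((v:ℤ) : ZMod n))‖) :
    ∃ r : ℕ, 1 ≤ r ∧ r ≤ K^161 ∧ nrm ((r : ZMod n) * α) ≤ K^160 := by
  set F : ℤ → ℂ := fun v => e (α * (v : ZMod n)^2 + β * (v : ZMod n)) with hF
  have hM0 : 0 < M := lt_of_lt_of_le (by positivity) hM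
  set N : ℤ → ℝ := fun h => ‖∑ v ∈ Finset.Ico (max 0 (-h)) (min (M:ℤ) (M - h)), F (v + h) * conj (F v)‖ with hN
  have hS : ‖∑ v ∈ range M, F v‖^2 ≤ ∑ h ∈ Finset.Icc (-(M:ℤ)) M, N h := by
    have e1 : ((‖∑ v ∈ range M, F v‖^2 : ℝ) : ℂ) =
        ∑ h ∈ Finset.Icc (-(M:ℤ)) M, ∑ v ∈ Finset.Ico (max 0 (-h)) (min (M:ℤ) (M - h)), F (v + h) * conj (F v) := by
      rw [nsq, map_sum]
      have e0 : ∀ G : ℤ → ℂ, ∑ v ∈ range M, G v = ∑ v ∈ Finset.Ico (0:ℤ) M, G v := by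
        intro G; rw [sum_Ico_int]; simp
      rw [e0 F, e0 (fun v => conj (F v)), Finset.sum_mul_sum]
      rw [← Finset.sum_product', ]
      rw [Finset.sum_sigma' (Finset.Icc (-(M:ℤ)) M)]
      refine Finset.sum_bij' (fun p _ => ⟨p.1 - p.2, p.2⟩) (fun q _ => (q.2 + q.1, q.2)) ?_ ?_ ?_ ?_ ?_
      · rintro ⟨a, b⟩ h
        simp only [Finset.mem_product, Finset.mem_Ico, Finset.mem_sigma, Finset.mem_Icc, max_le_iff, lt_min_iff] at h ⊢
        omega
      · rintro ⟨a, b⟩ h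
        simp only [Finset.mem_product, Finset.mem_Ico, Finset.mem_sigma, Finset.mem_Icc, max_le_iff, lt_min_iff] at h ⊢
        omega
      · rintro ⟨a, b⟩ h
        simp
      · rintro ⟨a, b⟩ h
        simp
      · rintro ⟨a, b⟩ h
        simp
    rw [← norm_real (x := ‖∑ v ∈ range M, F v‖^2) (by positivity), e1]
    exact norm_sum_le _ _
  have hNM : ∀ h, N h ≤ M := by
    intro h
    refine (norm_sum_le _ _).trans ?_
    have : ∀ v, ‖F (v + h) * conj (F v)‖ = 1 := by
      intro v; rw [norm_mul, RCLike.norm_conj, hF]; simp only [norm_e, mul_one]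
    simp only [this, Finset.sum_const, nsmul_eq_mul, mul_one, Int.card_Ico]
    have h2 : (min (M:ℤ) (M - h) - max 0 (-h)).toNat ≤ M := by omega
    exact_mod_cast h2
  have hNg : ∀ h : ℤ, N h * (2 * nrm ((h : ZMod n) * (2 * α))) ≤ n := by
    intro h
    have : ∀ v : ℤ, F (v + h) * conj (F v) = e (α * (h : ZMod n)^2 + β * (h : ZMod n)) * e ((h : ZMod n) * (2 * α) * (v : ZMod n)) := by
      intro v
      rw [hF]; simp only
      rw [← e_sub, ← e_add]; congr 1; push_cast; ring
    simp only [hN, this]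
    rw [← Finset.mul_sum, norm_mul, norm_e, one_mul]
    exact geomInt _ _ _
  have hMR : (0:ℝ) < M := by exact_mod_cast hM0
  have hM1 : (1:ℝ) ≤ M := by exact_mod_cast hM0
  have hKR : (2:ℝ) ≤ K := by exact_mod_cast hK
  classical
  set B := (Finset.Icc (-(M:ℤ)) M).filter fun h => (M:ℝ) ≤ 6 * K^2 * N h with hB
  have hBc : (M:ℝ) ≤ 2 * K^2 * B.card := by
    have h1 : (M:ℝ)^2 ≤ K^2 * ∑ h ∈ Finset.Icc (-(M:ℤ)) M, N h := by
      calc (M:ℝ)^2 ≤ (K * ‖∑ v ∈ range M, F v‖)^2 := pow_le_pow_left₀ (by positivity) h 2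
        _ = K^2 * ‖∑ v ∈ range M, F v‖^2 := by ring
        _ ≤ _ := by gcongr
    have h2 : 6 * (K:ℝ)^2 * ∑ h ∈ Finset.Icc (-(M:ℤ)) M, N h ≤
        ∑ h ∈ Finset.Icc (-(M:ℤ)) M, ((if (M:ℝ) ≤ 6 * K^2 * N h then 6 * (K:ℝ)^2 * M else 0) + (M:ℝ)) := by
      rw [Finset.mul_sum]
      refine Finset.sum_le_sum fun h _ => ?_
      split_ifs with hh
      · have := hNM h
        have : 6 * (K:ℝ)^2 * N h ≤ 6 * (K:ℝ)^2 * M := by gcongr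
        linarith
      · push Not at hh; linarith
    rw [Finset.sum_add_distrib, ← Finset.sum_filter, Finset.sum_const, Finset.sum_const, ← hB,
      nsmul_eq_mul, nsmul_eq_mul, Int.card_Icc] at h2
    have h3 : ((M:ℤ) + 1 - -(M:ℤ)).toNat = 2 * M + 1 := by omega
    rw [h3] at h2
    push_cast at h2
    have h4 : 6 * (M:ℝ)^2 ≤ B.card * (6 * K^2 * M) + (2 * M + 1) * M := by linarith
    have h5 : 6 * (M:ℝ)^2 ≤ B.card * (6 * K^2 * M) + 3 * M * M := by nlinarith
    have h6 : (M:ℝ) * M ≤ M * (2 * K^2 * B.card) := by nlinarith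
    exact le_of_mul_le_mul_left h6 hMR
  have hBn : ∀ b ∈ B, nrm ((b : ZMod n) * (2 * α)) ≤ K^10 * M := by
    intro b hb
    have h1 := (Finset.mem_filter.1 hb).2
    have h2 := hNg b
    have h3 : (M:ℝ) * (2 * nrm ((b : ZMod n) * (2 * α))) ≤ 6 * K^2 * n := by
      calc (M:ℝ) * (2 * nrm ((b : ZMod n) * (2 * α))) ≤ 6 * K^2 * N b * (2 * nrm ((b : ZMod n) * (2 * α))) := by gcongr
        _ = 6 * K^2 * (N b * (2 * nrm ((b : ZMod n) * (2 * α)))) := by ring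
        _ ≤ _ := by gcongr
    have hnR : (n:ℝ) = 64 * M^2 := by rw [hn]; push_cast; ring
    rw [hnR] at h3
    have h4 : (M:ℝ) * nrm ((b : ZMod n) * (2 * α)) ≤ M * (192 * K^2 * M) := by nlinarith
    have h5 := le_of_mul_le_mul_left h4 hMR
    have h6 : nrm ((b : ZMod n) * (2 * α)) ≤ 192 * K^2 * M := by exact_mod_cast h5
    refine h6.trans ?_
    gcongr
    calc 192 * K^2 ≤ 2^8 * K^2 := by omega
      _ ≤ K^8 * K^2 := by gcongr
      _ = _ := by ring
  have hK1 : 2 ≤ K^10 := hK.trans (Nat.le_self_pow (by norm_num) K)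
  obtain ⟨r, h1, h2, h3⟩ := MR hn hK1 (by rw [← pow_mul]; exact hM) (2 * α) B (by
    intro b hb
    have := Finset.mem_Icc.1 (Finset.mem_filter.1 hb).1
    rw [abs_le]; omega) hBn (by
    have h1 : M ≤ 2 * K^2 * B.card := by exact_mod_cast hBc
    refine h1.trans ?_
    gcongr
    calc 2 * K^2 ≤ K * K^2 := by gcongr
      _ = K^3 := by ring
      _ ≤ K^10 := Nat.pow_le_pow_right (by omega) (by norm_num))
  rw [← pow_mul] at h2 h3
  refine ⟨2 * r, by omega, ?_, ?_⟩
  · calc 2 * r ≤ K * K^160 := by gcongr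
      _ = _ := by ring
  · refine le_trans (le_of_eq ?_) h3
    congr 1; push_cast; ring

lemma weyl {M K : ℕ} (hn : n = 64 * M^2) (hK : 2 ≤ K) (hM : K^400 ≤ M) (α β : ZMod n)
    (h : (1:ℝ) ≤ K * ‖𝔼 v : Fin M, e (α * (((v:ℕ):ℤ) : ZMod n)^2 + β * (((v:ℕ):ℤ) : ZMod n))‖) :
    ∃ r : ℕ, 1 ≤ r ∧ r ≤ K^400 ∧ nrm ((r : ZMod n) * α) ≤ K^400 ∧
      nrm ((r : ZMod n) * β) ≤ K^400 * M := by
  set F : ℤ → ℂ := fun v => e (α * (v : ZMod n)^2 + β * (v : ZMod n)) with hF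
  have hK0 : 0 < K := by omega
  have hM0 : 0 < M := lt_of_lt_of_le (by positivity) hM
  have hMR : (0:ℝ) < M := by exact_mod_cast hM0
  have hKR : (2:ℝ) ≤ K := by exact_mod_cast hK
  have hKp : ∀ a b : ℕ, a ≤ b → K^a ≤ K^b := fun a b hab => Nat.pow_le_pow_right hK0 hab
  have hF1 : ∀ v, ‖F v‖ = 1 := fun v => norm_e _
  have hsum : (M:ℝ) ≤ K * ‖∑ v ∈ range M, F v‖ := by
    rw [Fintype.expect_eq_sum_div_card, Fintype.card_fin, norm_div, Complex.norm_natCast,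
      ← mul_div_assoc, le_div_iff₀ hMR, one_mul, Fin.sum_univ_eq_sum_range (fun v : ℕ => F v)] at h
    exact h
  obtain ⟨r, hr1, hr2, hr3⟩ := weyl1 hn hK ((hKp 160 400 (by norm_num)).trans hM) α β hsum
  refine ⟨r, hr1, hr2.trans (hKp _ _ (by norm_num)), hr3.trans (hKp _ _ (by norm_num)), ?_⟩
  set P := K^161 with hP
  have hP16 : 16 * K ≤ P := by
    calc 16 * K ≤ K^4 * K := by
          have : 2^4 ≤ K^4 := by gcongr
          exact Nat.mul_le_mul_right K this
      _ = K^5 := by ring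
      _ ≤ _ := hKp _ _ (by norm_num)
  have hr3' : nrm ((r : ZMod n) * α) ≤ P := hr3.trans (hKp _ _ (by norm_num))
  have hPM : P^2 ≤ M := by rw [hP, ← pow_mul]; exact (hKp _ _ (by norm_num)).trans hM
  have hP0 : 0 < P := by positivity
  set L := M / P^2 with hL
  have hL1 : 1 ≤ L := by rw [hL, Nat.one_le_div_iff (by positivity)]; exact hPM
  have hL2 : L * P^2 ≤ M := Nat.div_mul_le_self _ _
  have hL3 : M ≤ 2 * L * P^2 := by
    have := Nat.lt_div_mul_add (a := M) (b := P^2) (by positivity)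
    rw [← hL] at this; nlinarith
  have hLR : (0:ℝ) < L := by exact_mod_cast hL1
  have hPR : (16:ℝ) * K ≤ P := by exact_mod_cast hP16
  have hP0R : (0:ℝ) < P := by exact_mod_cast hP0
  have hL2R : (L:ℝ) * P^2 ≤ M := by exact_mod_cast hL2
  set H : ℤ → ℂ := fun v => ∑ i ∈ range L, F (v + ((r * i : ℕ) : ℤ)) with hH
  have havg : ‖(L:ℂ) * ∑ v ∈ range M, F v - ∑ v ∈ range M, H v‖ ≤ L * (2 * P * L) := by
    have : (L:ℂ) * ∑ v ∈ range M, F v - ∑ v ∈ range M, H v = - ∑ i ∈ range L,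
        (∑ v ∈ range M, F (v + ((r * i : ℕ) : ℤ)) - ∑ v ∈ range M, F v) := by
      rw [Finset.sum_sub_distrib, Finset.sum_comm]
      simp
    rw [this, norm_neg]
    refine (norm_sum_le _ _).trans ?_
    refine (Finset.sum_le_card_nsmul _ _ (2 * P * L : ℝ) fun i hi => ?_).trans (by simp)
    refine (sum_shift F (fun v => (hF1 v).le) M (r * i)).trans ?_
    have hi' := (Finset.mem_range.1 hi).le
    have : 2 * (r * i) ≤ 2 * P * L := by
      calc 2 * (r * i) ≤ 2 * (P * L) := by gcongr
        _ = _ := by ring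
    exact_mod_cast this
  have hHv : ∀ v ∈ range M, ‖H v‖ ≤ ‖∑ i ∈ range L, e ((r : ZMod n) * β * (i : ZMod n))‖ + L * (1 / (4 * K)) := by
    intro v hv
    have hv' := (Finset.mem_range.1 hv).le
    have e1 : H v = F v * ∑ i ∈ range L, (e ((r : ZMod n) * β * (i : ZMod n)) +
        e ((r : ZMod n) * β * (i : ZMod n)) * (e (((2 * v * i + r * i^2 : ℕ) : ZMod n) * ((r : ZMod n) * α)) - 1)) := by
      rw [Finset.mul_sum]
      refine Finset.sum_congr rfl fun i _ => ?_
      have : ∀ a b : ℂ, a + a * (b - 1) = a * b := fun a b => by ring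
      rw [this, ← e_add, hF]
      simp only
      rw [← e_add]
      congr 1; push_cast; ring
    rw [e1, norm_mul, hF1, one_mul, Finset.sum_add_distrib]
    refine (norm_add_le _ _).trans (add_le_add le_rfl ?_)
    refine (norm_sum_le _ _).trans ?_
    refine (Finset.sum_le_card_nsmul _ _ (1 / (4 * K) : ℝ) fun i hi => ?_).trans (by simp)
    have hi' := (Finset.mem_range.1 hi).le
    rw [norm_mul, norm_e, one_mul]
    refine (e_sub_one_le _).trans ?_
    have h1 : nrm (((2 * v * i + r * i^2 : ℕ) : ZMod n) * ((r : ZMod n) * α)) * P ≤ 3 * M^2 := by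
      calc _ ≤ (2 * v * i + r * i^2) * nrm ((r : ZMod n) * α) * P := by
            gcongr; exact nrm_nat_mul _ _
        _ ≤ (2 * M * L + P * L^2) * P * P := by gcongr
        _ = 2 * M * (L * P^2) + P * L * (L * P^2) := by ring
        _ ≤ 2 * M * M + M * M := by
            gcongr
            calc P * L = L * P^1 := by ring
              _ ≤ L * P^2 := by gcongr; norm_num
              _ ≤ M := hL2
        _ = _ := by ring
    have h1R : (nrm (((2 * v * i + r * i^2 : ℕ) : ZMod n) * ((r : ZMod n) * α)) : ℝ) * P ≤ 3 * M^2 := by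
      exact_mod_cast h1
    have hnR : (n:ℝ) = 64 * M^2 := by rw [hn]; push_cast; ring
    rw [hnR, div_le_div_iff₀ (by positivity) (by positivity)]
    set x := (nrm (((2 * v * i + r * i^2 : ℕ) : ZMod n) * ((r : ZMod n) * α)) : ℝ)
    have hx0 : 0 ≤ x := Nat.cast_nonneg _
    have : x * (16 * K) ≤ x * P := by gcongr
    nlinarith
  set E := ‖∑ i ∈ range L, e ((r : ZMod n) * β * (i : ZMod n))‖ with hE
  have hfinal : (L:ℝ) ≤ 2 * K * E := by
    have h1 : ‖∑ v ∈ range M, H v‖ ≤ M * (E + L * (1 / (4 * K))) := by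
      refine (norm_sum_le _ _).trans ?_
      exact (Finset.sum_le_card_nsmul _ _ _ hHv).trans (by rw [card_range, nsmul_eq_mul])
    have h2 : (L:ℝ) * ‖∑ v ∈ range M, F v‖ ≤ L * (2 * P * L) + M * (E + L * (1 / (4 * K))) := by
      have : (L:ℝ) * ‖∑ v ∈ range M, F v‖ = ‖(L:ℂ) * ∑ v ∈ range M, F v‖ := by
        rw [norm_mul, Complex.norm_natCast]
      rw [this]
      calc _ = ‖((L:ℂ) * ∑ v ∈ range M, F v - ∑ v ∈ range M, H v) + ∑ v ∈ range M, H v‖ := by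
            congr 1; ring
        _ ≤ _ := (norm_add_le _ _).trans (add_le_add havg h1)
    have h3 : (L:ℝ) * M ≤ K * (L * (2 * P * L) + M * (E + L * (1 / (4 * K)))) := by
      calc (L:ℝ) * M ≤ L * (K * ‖∑ v ∈ range M, F v‖) := by gcongr
        _ = K * (L * ‖∑ v ∈ range M, F v‖) := by ring
        _ ≤ _ := by gcongr
    have h4 : (K:ℝ) * (L * (1 / (4 * K))) = L / 4 := by field_simp
    have h5 : (K:ℝ) * (L * (2 * P * L)) ≤ L * M / 8 := by
      have : (16:ℝ) * ((K:ℝ) * ((P:ℝ) * (L:ℝ))) ≤ (M:ℝ) := by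
        calc (16:ℝ) * ((K:ℝ) * ((P:ℝ) * (L:ℝ))) = (16 * K) * (P * L) := by ring
          _ ≤ P * (P * L) := mul_le_mul_of_nonneg_right hPR (by positivity)
          _ = L * P^2 := by ring
          _ ≤ M := hL2R
      nlinarith
    have h6 : (M:ℝ) * L ≤ M * (2 * K * E) := by
      have : (K:ℝ) * (M * (E + L * (1 / (4 * K)))) = M * (K * E) + M * (L / 4) := by
        rw [← h4]; ring
      have hE0 : 0 ≤ E := norm_nonneg _
      have : (0:ℝ) ≤ M * (K * E) := by positivity
      nlinarith
    exact le_of_mul_le_mul_left h6 hMR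
  have hg := geom ((r : ZMod n) * β) L
  rw [← hE] at hg
  set y := nrm ((r : ZMod n) * β) with hy
  have h1 : (L:ℝ) * y ≤ K * n := by
    calc (L:ℝ) * y ≤ 2 * K * E * y := by gcongr
      _ = K * (E * (2 * y)) := by ring
      _ ≤ _ := by gcongr
  have h1' : L * y ≤ K * n := by exact_mod_cast h1
  have h2 : L * y ≤ L * (128 * K * P^2 * M) := by
    calc L * y ≤ K * n := h1'
      _ = 64 * K * M * M := by rw [hn]; ring
      _ ≤ 64 * K * M * (2 * L * P^2) := by gcongr
      _ = _ := by ring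
  refine (Nat.le_of_mul_le_mul_left h2 hL1).trans ?_
  gcongr
  calc 128 * K * P^2 ≤ K^7 * K * P^2 := by
        gcongr
        calc 128 = 2^7 := by norm_num
          _ ≤ K^7 := by gcongr
    _ = K^330 := by rw [hP]; ring
    _ ≤ K^400 := hKp _ _ (by norm_num)
end weyl
end NR

namespace NR

section L4
set_option linter.unusedSectionVars false
variable {n : ℕ} [NeZero n]

lemma sol_count {M K : ℕ} (hn : n = 64 * M^2) (hM0 : 0 < M) (k k' : ℤ) (hk : |k| ≤ M) (hk' : |k'| ≤ M)
    (h1 : (M:ℤ) ≤ K * |k'|) (h2 : Int.gcd k k' ≤ K) (d : ZMod n) :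
    ((Finset.univ.filter fun p : Fin M × Fin M =>
      2 * (k : ZMod n) * zf p.1 - 2 * (k' : ZMod n) * zf p.2 = d).card) ≤ K^2 + 1 := by
  classical
  have hk0 : k' ≠ 0 := by
    rintro rfl; simp at h1; omega
  set g := Int.gcd k k' with hg
  have hg0 : 0 < g := Int.gcd_pos_of_ne_zero_right _ hk0
  obtain ⟨q, hq⟩ : (g:ℤ) ∣ k' := Int.gcd_dvd_right _ _
  obtain ⟨l, hl⟩ : (g:ℤ) ∣ k := Int.gcd_dvd_left _ _
  have hcop : IsCoprime l q := by
    have h := Int.isCoprime_iff_gcd_eq_one (m := l) (n := q)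
    rw [h]
    have : Int.gcd ((g:ℤ) * l) ((g:ℤ) * q) = g * Int.gcd l q := by
      rw [Int.gcd_mul_left]; simp
    rw [← hl, ← hq, ← hg] at this
    exact Nat.eq_of_mul_eq_mul_left hg0 (by omega)
  have hq0 : q ≠ 0 := by rintro rfl; simp at hq; exact hk0 hq
  set Q := q.natAbs with hQ
  have hQ0 : 0 < Q := Int.natAbs_pos.2 hq0
  have hMQ : M ≤ K^2 * Q := by
    have : |k'| = g * Q := by rw [hq, abs_mul, hQ, Int.natCast_natAbs]; simp
    rw [this] at h1
    have h3 : M ≤ K * (g * Q) := by exact_mod_cast h1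
    calc M ≤ K * (g * Q) := h3
      _ ≤ K * (K * Q) := by gcongr
      _ = _ := by ring
  have key : ∀ p p' : Fin M × Fin M,
      2 * (k : ZMod n) * zf p.1 - 2 * (k' : ZMod n) * zf p.2 = d →
      2 * (k : ZMod n) * zf p'.1 - 2 * (k' : ZMod n) * zf p'.2 = d →
      k * (((p.1:ℕ):ℤ) - ((p'.1:ℕ):ℤ)) = k' * (((p.2:ℕ):ℤ) - ((p'.2:ℕ):ℤ)) := by
    intro p p' e1 e2
    set x : ℤ := ((p.1:ℕ):ℤ) - ((p'.1:ℕ):ℤ) with hx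
    set y : ℤ := ((p.2:ℕ):ℤ) - ((p'.2:ℕ):ℤ) with hy
    have hxb : |x| ≤ M := by rw [abs_le]; have := p.1.2; have := p'.1.2; omega
    have hyb : |y| ≤ M := by rw [abs_le]; have := p.2.2; have := p'.2.2; omega
    have e3 : ((2 * (k * x - k' * y) : ℤ) : ZMod n) = 0 := by
      push_cast [hx, hy]
      simp only [zf] at e1 e2
      linear_combination e1 - e2
    rw [ZMod.intCast_zmod_eq_zero_iff_dvd] at e3
    have e4 : 2 * (k * x - k' * y) = 0 := by
      refine Int.eq_zero_of_abs_lt_dvd e3 ?_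
      have a1 : |k * x| ≤ M * M := by rw [abs_mul]; gcongr
      have a2 : |k' * y| ≤ M * M := by rw [abs_mul]; gcongr
      rw [abs_le] at a1 a2
      have hnZ : (n:ℤ) = 64 * M^2 := by rw [hn]; push_cast; ring
      rw [hnZ, abs_lt]
      have hM' : (0:ℤ) < M := by exact_mod_cast hM0
      constructor <;> nlinarith
    linarith
  have := Finset.card_le_card_of_injOn (s := Finset.univ.filter fun p : Fin M × Fin M =>
      2 * (k : ZMod n) * zf p.1 - 2 * (k' : ZMod n) * zf p.2 = d) (t := Finset.range (K^2 + 1))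
    (fun p => (p.1:ℕ) / Q) (by
      intro p _
      rw [Finset.mem_coe, mem_range]
      refine Nat.lt_succ_of_le ?_
      refine Nat.div_le_of_le_mul ?_
      have := p.1.2
      nlinarith) (by
      intro p hp p' hp' he
      rw [Finset.mem_coe, mem_filter] at hp hp'
      have hkk := key p p' hp.2 hp'.2
      simp only at he
      have h3 : l * (((p.1:ℕ):ℤ) - ((p'.1:ℕ):ℤ)) = q * (((p.2:ℕ):ℤ) - ((p'.2:ℕ):ℤ)) := by
        have : (g:ℤ) * (l * (((p.1:ℕ):ℤ) - ((p'.1:ℕ):ℤ))) = g * (q * (((p.2:ℕ):ℤ) - ((p'.2:ℕ):ℤ))) := by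
          rw [← mul_assoc, ← mul_assoc, ← hl, ← hq]; exact hkk
        exact mul_left_cancel₀ (by exact_mod_cast hg0.ne') this
      have h4 : q ∣ ((p.1:ℕ):ℤ) - ((p'.1:ℕ):ℤ) :=
        hcop.symm.dvd_of_dvd_mul_left (Dvd.intro _ h3.symm)
      have h5 : ((p.1:ℕ):ℤ) - ((p'.1:ℕ):ℤ) = 0 := by
        have h6 : (Q:ℤ) ∣ ((p.1:ℕ):ℤ) - ((p'.1:ℕ):ℤ) := by rw [hQ]; exact Int.natAbs_dvd.2 h4
        refine Int.eq_zero_of_abs_lt_dvd h6 ?_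
        have a1 := Nat.div_add_mod (p.1:ℕ) Q
        have a2 := Nat.div_add_mod (p'.1:ℕ) Q
        have a3 := Nat.mod_lt (p.1:ℕ) hQ0
        have a4 := Nat.mod_lt (p'.1:ℕ) hQ0
        rw [he] at a1
        rw [abs_lt]
        constructor <;> omega
      have h7 : ((p.2:ℕ):ℤ) - ((p'.2:ℕ):ℤ) = 0 := by
        rw [h5, mul_zero] at h3
        exact (mul_eq_zero.1 h3.symm).resolve_left hq0
      ext <;> omega)
  simpa using this

lemma dens {M K : ℕ} (hn : n = 64 * M^2) (hM0 : 0 < M) (k k' : ℤ) (hk : |k| ≤ M) (hk' : |k'| ≤ M)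
    (h1 : (M:ℤ) ≤ K * |k'|) (h2 : Int.gcd k k' ≤ K) (c : ZMod n) (H : ZMod n → ℝ) (hH : ∀ d, 0 ≤ H d) :
    𝔼 p : Fin M × Fin M, H (2 * (k : ZMod n) * zf p.1 - 2 * (k' : ZMod n) * zf p.2 + c) ≤
      64 * (K^2 + 1) * 𝔼 d, H d := by
  classical
  have hMR : (0:ℝ) < M := by exact_mod_cast hM0
  have hnR : (n:ℝ) = 64 * M^2 := by rw [hn]; push_cast; ring
  rw [← shcR c (f := fun d => H (d + c)) (g := H) (fun j => rfl)]
  rw [Fintype.expect_eq_sum_div_card, Fintype.expect_eq_sum_div_card, Fintype.card_prod, Fintype.card_fin,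
    ZMod.card, hnR]
  have : ∑ p : Fin M × Fin M, H (2 * (k : ZMod n) * zf p.1 - 2 * (k' : ZMod n) * zf p.2 + c) ≤
      (K^2+1) * ∑ d, H (d + c) := by
    rw [← Finset.sum_fiberwise (s := univ)
      (g := fun p : Fin M × Fin M => 2 * (k : ZMod n) * zf p.1 - 2 * (k' : ZMod n) * zf p.2), Finset.mul_sum]
    refine Finset.sum_le_sum fun d _ => ?_
    rw [Finset.sum_congr rfl (g := fun _ => H (d + c)) (by
      intro p hp; rw [(Finset.mem_filter.1 hp).2]), Finset.sum_const, nsmul_eq_mul]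
    refine mul_le_mul_of_nonneg_right ?_ (hH _)
    exact_mod_cast sol_count hn hM0 k k' hk hk' h1 h2 d
  push_cast
  rw [div_le_iff₀ (by positivity)]
  refine this.trans (le_of_eq ?_)
  field_simp

lemma mult_count (M g : ℕ) (hg : 0 < g) (hgM : g ≤ M) :
    (((Finset.Icc (-(M:ℤ)) M).filter fun k => (g:ℤ) ∣ k).card : ℝ) ≤ 3 * M / g := by
  have h : ((Finset.Icc (-(M:ℤ)) M).filter fun k => (g:ℤ) ∣ k).card ≤ 2 * (M / g) + 1 := by
    have := Finset.card_le_card_of_injOn (s := (Finset.Icc (-(M:ℤ)) M).filter fun k => (g:ℤ) ∣ k)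
      (t := Finset.Icc (-((M/g : ℕ):ℤ)) ((M/g:ℕ):ℤ)) (fun k => k / g) (by
        intro k hk
        rw [Finset.mem_coe, mem_filter, Finset.mem_Icc] at hk
        obtain ⟨⟨a, b⟩, q, rfl⟩ := hk
        have hg' : (0:ℤ) < g := by exact_mod_cast hg
        rw [Finset.mem_coe, Finset.mem_Icc]
        simp only
        rw [Int.mul_ediv_cancel_left _ hg'.ne']
        push_cast
        have h1 : q ≤ (M:ℤ) / g := by rw [Int.le_ediv_iff_mul_le hg']; linarith
        have h2 : -q ≤ (M:ℤ) / g := by rw [Int.le_ediv_iff_mul_le hg']; linarith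
        constructor <;> linarith) (by
        intro k hk k' hk' he
        rw [Finset.mem_coe, mem_filter] at hk hk'
        simp only at he
        rw [← Int.ediv_mul_cancel hk.2, ← Int.ediv_mul_cancel hk'.2, he])
    rw [Int.card_Icc] at this
    omega
  have hgR : (0:ℝ) < g := by exact_mod_cast hg
  rw [le_div_iff₀ hgR]
  have h2 : (2 * (M / g) + 1) * g ≤ 3 * M := by
    have := Nat.div_mul_le_self M g
    nlinarith
  have h3 : ((Finset.Icc (-(M:ℤ)) M).filter fun k => (g:ℤ) ∣ k).card * g ≤ 3 * M :=
    (Nat.mul_le_mul_right g h).trans h2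
  exact_mod_cast h3

def good (M K : ℕ) (k k' : ℤ) : Prop := (M:ℤ) ≤ K * |k'| ∧ Int.gcd k k' ≤ K

open Classical in
lemma bad_count (M K : ℕ) (hK : 1 ≤ K) (hM : K ≤ M) :
    𝔼 k : I M, 𝔼 k' : I M, (if good M K k k' then (0:ℝ) else 1) ≤ 4 / K := by
  have hMR : (1:ℝ) ≤ M := by exact_mod_cast hK.trans hM
  have hKR : (1:ℝ) ≤ K := by exact_mod_cast hK
  have hKM : (K:ℝ) ≤ M := by exact_mod_cast hM
  set J := Finset.Icc (-(M:ℤ)) M with hJ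
  have hJc : (J.card : ℝ) = 2 * M + 1 := by
    have : J.card = 2 * M + 1 := by rw [hJ, Int.card_Icc]; omega
    rw [this]; push_cast; ring
  have h1 : ∑ k ∈ J, ∑ k' ∈ J, (if good M K k k' then (0:ℝ) else 1) ≤
      ∑ k ∈ J, ∑ k' ∈ J, ((if (K:ℤ) * |k'| < M then (1:ℝ) else 0) +
        ∑ g ∈ Finset.Ioc K M, (if (g:ℤ) ∣ k then (1:ℝ) else 0) * (if (g:ℤ) ∣ k' then (1:ℝ) else 0)) := by
    refine Finset.sum_le_sum fun k hk => Finset.sum_le_sum fun k' hk' => ?_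
    have hs : ∀ g ∈ Finset.Ioc K M, 0 ≤ (if (g:ℤ) ∣ k then (1:ℝ) else 0) * (if (g:ℤ) ∣ k' then (1:ℝ) else 0) :=
      fun g _ => by positivity
    have hs0 := Finset.sum_nonneg hs
    split_ifs with a b b
    · linarith
    · linarith
    · linarith
    · have hb : ¬ Int.gcd k k' ≤ K := fun hh => a ⟨by omega, hh⟩
      have hk0 : k' ≠ 0 := by rintro rfl; simp at b; omega
      have hgm : Int.gcd k k' ∈ Finset.Ioc K M := by
        rw [Finset.mem_Ioc]
        refine ⟨by omega, ?_⟩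
        have := Int.le_of_dvd (abs_pos.2 hk0) ((dvd_abs _ _).2 (Int.gcd_dvd_right k k'))
        have h3 := Finset.mem_Icc.1 hk'
        have : |k'| ≤ M := abs_le.2 h3
        omega
      have := Finset.single_le_sum hs hgm
      rw [if_pos (Int.gcd_dvd_right k k'), if_pos (Int.gcd_dvd_left k k')] at this
      linarith
  have h2 : ∑ k' ∈ J, (if (K:ℤ) * |k'| < M then (1:ℝ) else 0) ≤ 2 * M / K + 1 := by
    rw [← Finset.sum_filter, Finset.sum_const, nsmul_eq_mul, mul_one]
    have h3 : (J.filter fun k' => (K:ℤ) * |k'| < M).card ≤ 2 * (M / K) + 1 := by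
      have := Finset.card_le_card (s := J.filter fun k' => (K:ℤ) * |k'| < M)
        (t := Finset.Icc (-((M/K : ℕ):ℤ)) ((M/K:ℕ):ℤ)) (by
        intro k hk
        rw [mem_filter] at hk
        rw [Finset.mem_Icc, ← abs_le]
        have hK' : (0:ℤ) < K := by exact_mod_cast hK
        push_cast
        rw [Int.le_ediv_iff_mul_le hK']; linarith [hk.2])
      rw [Int.card_Icc] at this
      omega
    have h4 : ((J.filter fun k' => (K:ℤ) * |k'| < M).card:ℝ) ≤ 2 * ((M / K : ℕ):ℝ) + 1 := by exact_mod_cast h3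
    have h5 : ((M / K : ℕ):ℝ) ≤ (M:ℝ) / K := Nat.cast_div_le
    rw [mul_div_assoc]; linarith
  have h3 : ∀ g ∈ Finset.Ioc K M, ∑ k ∈ J, (if (g:ℤ) ∣ k then (1:ℝ) else 0) ≤ 3 * M / g := by
    intro g hg
    rw [Finset.mem_Ioc] at hg
    rw [← Finset.sum_filter, Finset.sum_const, nsmul_eq_mul, mul_one]
    exact mult_count M g (by omega) hg.2
  have h4 : ∑ k ∈ J, ∑ k' ∈ J, ∑ g ∈ Finset.Ioc K M, (if (g:ℤ) ∣ k then (1:ℝ) else 0) * (if (g:ℤ) ∣ k' then (1:ℝ) else 0)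
      ≤ 9 * M^2 / K := by
    have e1 : ∑ k ∈ J, ∑ k' ∈ J, ∑ g ∈ Finset.Ioc K M, (if (g:ℤ) ∣ k then (1:ℝ) else 0) * (if (g:ℤ) ∣ k' then (1:ℝ) else 0)
       = ∑ g ∈ Finset.Ioc K M, (∑ k ∈ J, (if (g:ℤ) ∣ k then (1:ℝ) else 0)) * (∑ k ∈ J, (if (g:ℤ) ∣ k then (1:ℝ) else 0)) := by
      simp only [Finset.sum_mul_sum]
      rw [Finset.sum_comm]
      conv_rhs => rw [Finset.sum_comm]
      rw [Finset.sum_comm]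
      refine Finset.sum_congr rfl fun k _ => ?_
      rw [Finset.sum_comm]
    rw [e1]
    calc _ ≤ ∑ g ∈ Finset.Ioc K M, (3 * M / g : ℝ) * (3 * M / g) := by
          refine Finset.sum_le_sum fun g hg => ?_
          have : 0 ≤ ∑ k ∈ J, (if (g:ℤ) ∣ k then (1:ℝ) else 0) := Finset.sum_nonneg fun _ _ => by positivity
          exact mul_le_mul (h3 g hg) (h3 g hg) this (by positivity)
      _ = 9 * M^2 * ∑ g ∈ Finset.Ioc K M, ((g:ℝ)^2)⁻¹ := by
          rw [Finset.mul_sum]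
          refine Finset.sum_congr rfl fun g _ => ?_
          rw [div_mul_div_comm, div_eq_mul_inv, sq (g:ℝ)]; ring
      _ ≤ 9 * M^2 * (1 / K) := by
          gcongr
          have := sum_Ioc_inv_sq_le_sub (α := ℝ) (k := K) (n := M) (by omega) hM
          have h0 : (0:ℝ) ≤ (M:ℝ)⁻¹ := by positivity
          rw [one_div]; linarith
      _ = _ := by ring
  have h5 : ∑ k ∈ J, ∑ k' ∈ J, (if good M K k k' then (0:ℝ) else 1) ≤ (2 * M + 1) * (2 * M / K + 1) + 9 * M^2/K := by
    refine h1.trans ?_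
    simp only [Finset.sum_add_distrib]
    refine add_le_add ?_ h4
    rw [Finset.sum_const, nsmul_eq_mul, hJc]
    gcongr
  have e0 : ∀ F : ℤ → ℝ, 𝔼 k : I M, F k = (∑ k ∈ J, F k) / (2 * M + 1) := by
    intro F
    rw [Fintype.expect_eq_sum_div_card, card_I, Finset.sum_coe_sort J F]; push_cast; rfl
  have e1 : 𝔼 k : I M, 𝔼 k' : I M, (if good M K k k' then (0:ℝ) else 1) =
      (∑ k ∈ J, ∑ k' ∈ J, (if good M K k k' then (0:ℝ) else 1)) / (2 * M + 1) / (2 * M + 1) := by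
    have : ∀ k : I M, 𝔼 k' : I M, (if good M K k k' then (0:ℝ) else 1) =
      (∑ k' ∈ J, (if good M K k k' then (0:ℝ) else 1)) / (2 * M + 1) := fun k =>
        e0 (fun k' => if good M K k k' then (0:ℝ) else 1)
    simp only [this]
    rw [e0 (fun k => (∑ k' ∈ J, (if good M K k k' then (0:ℝ) else 1)) / (2 * M + 1)), ← Finset.sum_div]
  rw [e1, div_div, div_le_iff₀ (by positivity)]
  refine h5.trans ?_
  have h6 : (1:ℝ) ≤ M / K := by rw [le_div_iff₀ (by linarith)]; linarith
  set y := (M:ℝ) / K with hy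
  have e2 : 2 * (M:ℝ) / K = 2 * y := by rw [hy]; ring
  have e3 : 9 * (M:ℝ)^2 / K = 9 * M * y := by rw [hy]; ring
  have e4 : 4 / (K:ℝ) * ((2 * M + 1) * (2 * M + 1)) = 16 * M * y + 16 * y + 4 / K := by
    rw [hy]; field_simp; ring
  rw [e2, e3, e4]
  have : 0 ≤ 4 / (K:ℝ) := by positivity
  nlinarith

end L4
end NR

namespace NR

section L4b
set_option linter.unusedSectionVars false
variable {n : ℕ} [NeZero n] {M : ℕ}

abbrev Pm (M : ℕ) := I (2 * M) × Fin M × Fin M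

def dir (p : Pm M) : ZMod n := 2 * ((p.1 : ℤ) : ZMod n) * (zf p.2.2 - zf p.2.1)

noncomputable def W (M : ℕ) (f : ZMod n → ℂ) : ℝ :=
  𝔼 p1 : Pm M, 𝔼 p2 : Pm M, 𝔼 p3 : Pm M, G 0 (Dl (dir p3) (Dl (dir p2) (Dl (dir p1) f)))

lemma dom_I (m : ℤ) (hm : |m| ≤ M) (Y : ℤ → ℝ) (hY : ∀ k, 0 ≤ Y k) :
    𝔼 k : I M, Y (k + m) ≤ 2 * 𝔼 b : I (2 * M), Y b := by
  refine exp_inj (ι := I M) (κ := I (2*M)) (fun k => ⟨k + m, ?_⟩) ?_ (fun b => Y b) (fun b => hY _) 2 ?_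
  · have := Finset.mem_Icc.1 k.2
    rw [abs_le] at hm
    rw [Finset.mem_Icc]; push_cast; constructor <;> linarith
  · intro a b hab
    simp only [Subtype.mk.injEq, add_left_inj] at hab
    exact Subtype.ext hab
  · rw [card_I, card_I]; push_cast; linarith

open Classical in
lemma L4a {K : ℕ} (hn : n = 64 * M^2) (hK : 1 ≤ K) (hM : K ≤ M) (m : I M) (g : ZMod n → ℂ) (hg : ∀ x, ‖g x‖ ≤ 1) :
    (𝔼 k : I M, 𝔼 t : Fin M, 𝔼 s : Fin M,
      Q (zf (M := M)) (2 * (((k:ℤ) + m : ℤ) : ZMod n)) (Dl (2 * ((k:ℤ) : ZMod n) * (zf s - zf t)) g))^8 ≤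
    64 * (K^2 + 1) * 4 * (𝔼 p2 : Pm M, 𝔼 p3 : Pm M, G 0 (Dl (dir p3) (Dl (dir p2) g))) + 4 / K := by
  have hM0 : 0 < M := by omega
  have hmb : |(m:ℤ)| ≤ M := abs_le.2 (Finset.mem_Icc.1 m.2)
  have e1 := L3 (κ := I M × Fin M × Fin M) (zf (n := n) (M := M)) (fun i => 2 * (((i.1:ℤ) + m : ℤ) : ZMod n))
    (fun i => 2 * ((i.1:ℤ) : ZMod n) * (zf i.2.2 - zf i.2.1)) g hg
  simp only [exp_prodR] at e1
  refine e1.trans ?_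
  clear e1
  set H : I M → I M → ZMod n → ℝ := fun k k' d => 𝔼 s : Fin M, 𝔼 s' : Fin M,
    Q (zf (M := M)) (2 * (((k':ℤ) + m : ℤ) : ZMod n)) (Dl (2 * (((k:ℤ) + m : ℤ) : ZMod n) * (zf s' - zf s)) (Dl d g)) with hH
  have hH0 : ∀ k k' d, 0 ≤ H k k' d := fun k k' d => exp_nonneg fun _ => exp_nonneg fun _ => Q_nonneg _ _ _
  have hH1 : ∀ k k' d, H k k' d ≤ 1 := fun k k' d => exp_le_one fun _ => exp_le_one fun _ =>
    Q_le_one _ _ (Dl_bdd (Dl_bdd hg _) _)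
  have step1 : ∀ k k' : I M, 𝔼 t : Fin M, 𝔼 s : Fin M, 𝔼 t' : Fin M, 𝔼 s' : Fin M,
      H k k' (2 * ((k:ℤ) : ZMod n) * (zf s - zf t) - 2 * ((k':ℤ) : ZMod n) * (zf s' - zf t')) ≤
      64 * (K^2+1) * (𝔼 d, H k k' d) + (if good M K k k' then (0:ℝ) else 1) := by
    intro k k'
    split_ifs with hgd
    · rw [add_zero]
      have : Nonempty (Fin M) := ⟨⟨0, hM0⟩⟩
      have : ∀ t : Fin M, 𝔼 s : Fin M, 𝔼 t' : Fin M, 𝔼 s' : Fin M,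
        H k k' (2 * ((k:ℤ) : ZMod n) * (zf s - zf t) - 2 * ((k':ℤ) : ZMod n) * (zf s' - zf t')) ≤
        64 * (K^2+1) * (𝔼 d, H k k' d) := by
        intro t
        rw [exp_commR]
        refine el fun t' => ?_
        rw [← exp_prodR (fun p : Fin M × Fin M => H k k' (2 * ((k:ℤ) : ZMod n) * (zf p.1 - zf t) - 2 * ((k':ℤ) : ZMod n) * (zf p.2 - zf t')))]
        refine le_trans (le_of_eq ?_) (dens hn hM0 k k' (abs_le.2 (Finset.mem_Icc.1 k.2)) (abs_le.2 (Finset.mem_Icc.1 k'.2))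
          hgd.1 hgd.2 (-(2 * ((k:ℤ) : ZMod n) * zf t) + 2 * ((k':ℤ) : ZMod n) * zf t') (H k k') (hH0 k k'))
        refine ec fun p => ?_
        congr 1; ring
      exact el fun t => this t
    · have h1 : 0 ≤ 64 * ((K:ℝ)^2+1) * (𝔼 d, H k k' d) := mul_nonneg (by positivity) (exp_nonneg (hH0 k k'))
      have h2 := exp_le_one (X := fun t : Fin M => 𝔼 s : Fin M, 𝔼 t' : Fin M, 𝔼 s' : Fin M,
        H k k' (2 * ((k:ℤ) : ZMod n) * (zf s - zf t) - 2 * ((k':ℤ) : ZMod n) * (zf s' - zf t')))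
        (fun t => exp_le_one fun s => exp_le_one fun t' => exp_le_one fun s' => hH1 _ _ _)
      linarith
  have step2 : ∀ k k' : I M, 𝔼 d, H k k' d = 𝔼 s : Fin M, 𝔼 s' : Fin M, 𝔼 r : Fin M, 𝔼 r' : Fin M,
      G 0 (Dl (2 * (((k':ℤ) + m : ℤ) : ZMod n) * (zf r' - zf r)) (Dl (2 * (((k:ℤ) + m : ℤ) : ZMod n) * (zf s' - zf s)) g)) := by
    intro k k'
    rw [hH]; simp only
    rw [exp_commR]
    refine ec fun s => ?_
    rw [exp_commR]
    refine ec fun s' => ?_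
    rw [← exp_Q]
    refine ec fun d => ?_
    rw [Dl_comm]
  have step3 : 𝔼 k : I M, 𝔼 k' : I M, 𝔼 d, H k k' d ≤
      4 * (𝔼 p2 : Pm M, 𝔼 p3 : Pm M, G 0 (Dl (dir p3) (Dl (dir p2) g))) := by
    set Z : ℤ → ℤ → ℝ := fun b b' => 𝔼 s : Fin M, 𝔼 s' : Fin M, 𝔼 r : Fin M, 𝔼 r' : Fin M,
      G 0 (Dl (2 * (b' : ZMod n) * (zf r' - zf r)) (Dl (2 * (b : ZMod n) * (zf s' - zf s)) g)) with hZ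
    have hZ0 : ∀ b b', 0 ≤ Z b b' := fun b b' => exp_nonneg fun _ => exp_nonneg fun _ => exp_nonneg fun _ =>
      exp_nonneg fun _ => G_nonneg _ _
    have a1 : 𝔼 k : I M, 𝔼 k' : I M, 𝔼 d, H k k' d ≤ 𝔼 k : I M, 2 * 𝔼 b' : I (2*M), Z (k + m) b' := by
      refine exp_mono fun k => ?_
      refine le_trans (le_of_eq ?_) (dom_I (M := M) m hmb (Z (k + m)) (hZ0 _))
      refine ec fun k' => ?_
      rw [step2]
    have a2 := dom_I (M := M) m hmb (fun b => 2 * 𝔼 b' : I (2*M), Z b b') (fun b => mul_nonneg (by norm_num) (exp_nonneg fun b' => hZ0 _ _))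
    refine (a1.trans a2).trans (le_of_eq ?_)
    have a3 : 2 * 𝔼 b : I (2*M), 2 * 𝔼 b' : I (2*M), Z b b' = 4 * 𝔼 b : I (2*M), 𝔼 b' : I (2*M), Z b b' := by
      rw [← mul_expect]; ring
    rw [a3]
    congr 1
    simp only [exp_prodR]
    refine ec fun b => ?_
    simp only [hZ]
    rw [exp_commR]
    refine ec fun s => ?_
    rw [exp_commR]
    rfl
  calc _ = 𝔼 k : I M, 𝔼 k' : I M, 𝔼 t : Fin M, 𝔼 s : Fin M, 𝔼 t' : Fin M, 𝔼 s' : Fin M,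
      H k k' (2 * ((k:ℤ) : ZMod n) * (zf s - zf t) - 2 * ((k':ℤ) : ZMod n) * (zf s' - zf t')) := by
        refine ec fun k => ?_
        have : ∀ t : Fin M, ∀ F : Fin M → I M → ℝ, 𝔼 s : Fin M, 𝔼 k' : I M, F s k' = 𝔼 k' : I M, 𝔼 s : Fin M, F s k' :=
          fun _ F => exp_commR F
        conv_rhs => rw [exp_commR]
        refine ec fun t => ?_
        rw [exp_commR]
    _ ≤ 𝔼 k : I M, 𝔼 k' : I M, (64 * (K^2+1) * (𝔼 d, H k k' d) + (if good M K k k' then (0:ℝ) else 1)) :=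
        exp_mono fun k => exp_mono fun k' => step1 k k'
    _ = 64 * (K^2+1) * (𝔼 k : I M, 𝔼 k' : I M, 𝔼 d, H k k' d) + 𝔼 k : I M, 𝔼 k' : I M, (if good M K k k' then (0:ℝ) else 1) := by
        simp only [expect_add_distrib, mul_expect]
    _ ≤ 64 * (K^2+1) * (4 * (𝔼 p2 : Pm M, 𝔼 p3 : Pm M, G 0 (Dl (dir p3) (Dl (dir p2) g)))) + 4 / K := by
        refine add_le_add (mul_le_mul_of_nonneg_left step3 (by positivity)) (bad_count M K hK hM)
    _ = _ := by ring

lemma L4 {K : ℕ} (hn : n = 64 * M^2) (hK : 1 ≤ K) (hM : K ≤ M) (f : ZMod n → ℂ) (hf : ∀ x, ‖f x‖ ≤ 1) :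
    (tri M f)^8 ≤ 64 * (K^2 + 1) * 8 * W M f + 4 / K := by
  have h1 : (tri M f)^8 ≤ 𝔼 m : I M, 𝔼 t1 : Fin M, 𝔼 s1 : Fin M, (𝔼 k : I M, 𝔼 t : Fin M, 𝔼 s : Fin M,
      Q (zf (M := M)) (2 * (((k:ℤ) + m : ℤ) : ZMod n)) (Dl (2 * ((k:ℤ) : ZMod n) * (zf s - zf t))
        (Dl (2 * ((m:ℤ) : ZMod n) * (zf s1 - zf t1)) f)))^8 := by
    have n4 : ∀ (m : I M) (t1 s1 : Fin M), 0 ≤ (𝔼 k : I M, 𝔼 t : Fin M, 𝔼 s : Fin M,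
      Q (zf (M := M)) (2 * (((k:ℤ) + m : ℤ) : ZMod n)) (Dl (2 * ((k:ℤ) : ZMod n) * (zf s - zf t))
        (Dl (2 * ((m:ℤ) : ZMod n) * (zf s1 - zf t1)) f))) := fun m t1 s1 => exp_nonneg fun _ => exp_nonneg fun _ => exp_nonneg fun _ => Q_nonneg _ _ _
    have e1 : tri M f = 𝔼 m : I M, 𝔼 t1 : Fin M, 𝔼 s1 : Fin M, (𝔼 k : I M, 𝔼 t : Fin M, 𝔼 s : Fin M,
      Q (zf (M := M)) (2 * (((k:ℤ) + m : ℤ) : ZMod n)) (Dl (2 * ((k:ℤ) : ZMod n) * (zf s - zf t))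
        (Dl (2 * ((m:ℤ) : ZMod n) * (zf s1 - zf t1)) f))) := by
      simp only [tri, BoxN]
      refine ec fun m => ?_
      rw [exp_commR]
      refine ec fun t1 => ?_
      rw [exp_commR]
    rw [e1, show 8 = 2^3 by norm_num]
    refine (exp_pow_le _ (fun m => exp_nonneg fun t1 => exp_nonneg fun s1 => n4 m t1 s1) 3).trans (exp_mono fun m => ?_)
    refine (exp_pow_le _ (fun t1 => exp_nonneg fun s1 => n4 m t1 s1) 3).trans (exp_mono fun t1 => ?_)
    exact (exp_pow_le _ (fun s1 => n4 m t1 s1) 3)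
  rcases Nat.eq_zero_or_pos M with h0 | hM0
  · omega
  have : Nonempty (Fin M) := ⟨⟨0, hM0⟩⟩
  set Y : ℤ → ℝ := fun b => 𝔼 t1 : Fin M, 𝔼 s1 : Fin M,
    𝔼 p2 : Pm M, 𝔼 p3 : Pm M, G 0 (Dl (dir p3) (Dl (dir p2) (Dl (2 * (b : ZMod n) * (zf s1 - zf t1)) f))) with hY
  have hY0 : ∀ b, 0 ≤ Y b := fun b => exp_nonneg fun _ => exp_nonneg fun _ => exp_nonneg fun _ => exp_nonneg fun _ => G_nonneg _ _
  have hYW : 𝔼 b : I (2 * M), Y b = W M f := by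
    rw [W, exp_prodR]
    refine ec fun b => ?_
    rw [exp_prodR]; rfl
  have h2 := dom_I (M := M) 0 (by simp) Y hY0
  rw [hYW] at h2
  simp only [add_zero] at h2
  refine h1.trans ?_
  calc _ ≤ 𝔼 m : I M, 𝔼 t1 : Fin M, 𝔼 s1 : Fin M, (64 * (K^2 + 1) * 4 *
      (𝔼 p2 : Pm M, 𝔼 p3 : Pm M, G 0 (Dl (dir p3) (Dl (dir p2) (Dl (2 * ((m:ℤ) : ZMod n) * (zf s1 - zf t1)) f)))) + 4 / (K:ℝ)) :=
        exp_mono fun m => exp_mono fun t1 => exp_mono fun s1 => L4a hn hK hM m _ (Dl_bdd hf _)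
    _ = 64 * (K^2+1) * 4 * (𝔼 m : I M, Y m) + 4 / K := by
        simp only [expect_add_distrib, hY, mul_expect, Fintype.expect_const]
    _ ≤ 64 * (K^2+1) * 4 * (2 * W M f) + 4 / K := by
        gcongr
    _ = _ := by ring

lemma dir_sum (hn : n = 64 * M^2) {K : ℕ} (hK : 2 ≤ K) (hM : K^112 ≤ M) (α : ZMod n)
    (h : α ∉ Maj (K^113)) : ‖𝔼 p : Pm M, e (α * dir p)‖ ≤ 1 / K := by
  by_contra hcon
  push Not at hcon
  apply h
  have hK0 : 0 < K := by omega
  have hKR : (2:ℝ) ≤ K := by exact_mod_cast hK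
  have hM0 : 0 < M := lt_of_lt_of_le (by positivity) hM
  have hMR : (0:ℝ) < M := by exact_mod_cast hM0
  have e1 : 𝔼 p : Pm M, e (α * dir p) = ((𝔼 b : I (2*M), ‖𝔼 t : Fin M, e (α * (2 * ((b:ℤ) : ZMod n) * zf t))‖^2 : ℝ) : ℂ) := by
    rw [exp_prod, ofReal_exp]
    refine ec fun b => ?_
    rw [exp_prod, normsq_exp, exp_comm]
    refine ec fun t => ec fun s => ?_
    rw [← e_sub]; congr 1; simp only [dir]; ring
  set X : I (2*M) → ℝ := fun b => ‖𝔼 t : Fin M, e (α * (2 * ((b:ℤ) : ZMod n) * zf t))‖^2 with hX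
  have hX1 : ∀ b, X b ≤ 1 := fun b => pow_le_one₀ (norm_nonneg _) (nexp_le_one fun _ => (norm_e _).le)
  rw [e1, norm_real (exp_nonneg fun b => by positivity)] at hcon
  have hm := many X hX1 (1 / (2 * K)) (by positivity) (by
    refine le_trans (le_of_eq ?_) hcon.le
    field_simp)
  set B := (Finset.univ.filter fun i => 1 / (2 * (K:ℝ)) ≤ X i) with hB
  have hKp : ∀ a b : ℕ, a ≤ b → K^a ≤ K^b := fun a b hab => Nat.pow_le_pow_right hK0 hab
  have h64 : 64 * K ≤ K^7 := by
    calc 64 * K = 2^6 * K := by ring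
      _ ≤ K^6 * K := by gcongr
      _ = _ := by ring
  obtain ⟨r, r1, r2, r3⟩ := MR hn (K := K^7) (hK.trans (Nat.le_self_pow (by norm_num) K)) (by rw [← pow_mul]; exact hM) (2 * α)
    (B.map ⟨Subtype.val, Subtype.val_injective⟩) (by
      intro b hb
      rw [Finset.mem_map] at hb
      obtain ⟨b, _, rfl⟩ := hb
      have := Finset.mem_Icc.1 b.2
      rw [abs_le]
      push_cast at this
      exact this) (by
      intro b hb
      rw [Finset.mem_map] at hb
      obtain ⟨b, hb, rfl⟩ := hb
      have hb := (Finset.mem_filter.1 hb).2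
      show nrm (((b:ℤ):ZMod n) * (2 * α)) ≤ K^7 * M
      have hg := geom (((b:ℤ):ZMod n) * (2 * α)) M
      have e2 : 𝔼 t : Fin M, e (α * (2 * ((b:ℤ) : ZMod n) * zf t)) =
          (∑ v ∈ range M, e (((b:ℤ):ZMod n) * (2 * α) * (v : ZMod n))) / M := by
        rw [Fintype.expect_eq_sum_div_card, Fintype.card_fin,
          ← Fin.sum_univ_eq_sum_range (fun v : ℕ => e (((b:ℤ):ZMod n) * (2 * α) * (v : ZMod n)))]
        congr 1
        refine Finset.sum_congr rfl fun t _ => ?_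
        congr 1; simp only [zf]; ring
      simp only [hX] at hb
      rw [e2, norm_div, Complex.norm_natCast] at hb
      set E := ‖∑ v ∈ range M, e (((b:ℤ):ZMod n) * (2 * α) * (v : ZMod n))‖ with hE
      have hE1 : E / M ≤ 1 := by
        have := nexp_le_one (f := fun t : Fin M => e (α * (2 * ((b:ℤ) : ZMod n) * zf t))) (fun _ => (norm_e _).le)
        rwa [e2, norm_div, Complex.norm_natCast, ← hE] at this
      have hE0 : 0 ≤ E / M := by positivity
      have hE2 : 1 / (2 * (K:ℝ)) ≤ E / M := by nlinarith
      rw [div_le_div_iff₀ (by positivity) hMR] at hE2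
      have hnR : (n:ℝ) = 64 * M^2 := by rw [hn]; push_cast; ring
      rw [hnR] at hg
      set y := nrm (((b:ℤ):ZMod n) * (2 * α)) with hy
      have h3 : (M:ℝ) * y ≤ M * (64 * K * M) := by
        calc (M:ℝ) * y = 1 * M * y := by ring
          _ ≤ E * (2 * K) * y := by gcongr
          _ = K * (E * (2 * y)) := by ring
          _ ≤ K * (64 * M^2) := by gcongr
          _ = _ := by ring
      have h4 := le_of_mul_le_mul_left h3 hMR
      have h5 : y ≤ 64 * K * M := by exact_mod_cast h4
      exact h5.trans (Nat.mul_le_mul_right M h64)) (by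
      rw [Finset.card_map]
      rw [card_I, one_div, inv_mul_le_iff₀ (by positivity)] at hm
      have h3 : 2 * (2 * M) + 1 ≤ 2 * K * B.card := by exact_mod_cast hm
      have h4 : M ≤ K * B.card := by nlinarith
      refine h4.trans (Nat.mul_le_mul_right _ (Nat.le_self_pow (by norm_num) K)))
  rw [← pow_mul] at r2 r3
  rw [mem_Maj]
  refine ⟨2 * r, by omega, ?_, ?_⟩
  · calc 2 * r ≤ K * K^112 := by gcongr
      _ = _ := by ring
  · have : (((2 * r : ℕ) : ZMod n) * α) = (r : ZMod n) * (2 * α) := by push_cast; ring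
    rw [this]
    exact r3.trans (hKp _ _ (by norm_num))

lemma lemR' : ∃ C : ℕ, 1 ≤ C ∧ ∀ {n : ℕ} [NeZero n] {M : ℕ} (_ : n = 64 * M^2) {K : ℕ} (_ : 2 ≤ K) (_ : K^C ≤ M)
    (h : ZMod n → ℝ) (_ : PD h)
    (_ : ∀ d, 0 ≤ h d) (_ : ∀ d, h d ≤ 1) (_ : 1 ≤ K * 𝔼 p : Pm M, h (dir p)),
    1 ≤ (K:ℝ)^C * 𝔼 d, h d := by
  obtain ⟨C, hC⟩ : ∃ C : ℕ, C = 682 := ⟨_, rfl⟩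
  refine ⟨C, by omega, ?_⟩
  intro n _ M hn K hK hM h hp h0 h1 hh
  have hK0 : 0 < K := by omega
  have hKR : (2:ℝ) ≤ K := by exact_mod_cast hK
  have hKR0 : (0:ℝ) < K := by linarith
  obtain ⟨R, hR⟩ : ∃ R, R = (K^2)^113 := ⟨_, rfl⟩
  have hS := lemR (dir (n := n) (M := M)) (Maj R) (1 / ((K^2 : ℕ):ℝ)) (by positivity) (fun α hα =>
    dir_sum hn (K := K^2) (by nlinarith) (by
      rw [← pow_mul]; exact (Nat.pow_le_pow_right hK0 (by omega)).trans hM) α (by rwa [hR] at hα)) h hp h0 h1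
  have hc := Maj_card (n := n) R
  have hR1 : 1 ≤ R := by rw [hR]; exact Nat.one_le_pow _ _ (by positivity)
  have hc2 : K * (K * (Maj (n := n) R).card) ≤ K^C := by
    calc K * (K * (Maj (n := n) R).card) ≤ K * (K * (R * ((2 * R + 1) * R))) := by gcongr
      _ ≤ K * (K * (R * ((4 * R) * R))) := by gcongr; omega
      _ ≤ K * (K * (R * ((K^2 * R) * R))) := by gcongr; nlinarith
      _ = K^4 * R^3 := by ring
      _ = K^682 := by rw [hR, ← pow_mul, ← pow_mul, ← pow_add]
      _ = K^C := by rw [hC]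
  have hc3 : (K:ℝ) * (K * (Maj (n := n) R).card : ℝ) ≤ K^C := by exact_mod_cast hc2
  have hE : 0 ≤ 𝔼 d, h d := exp_nonneg h0
  have hE1 : (K:ℝ) * (1 / ((K^2 : ℕ):ℝ)) ≤ 1/2 := by
    push_cast
    have : (K:ℝ) * (1 / (K^2)) = 1 / K := by field_simp
    rw [this]
    exact one_div_le_one_div_of_le (by norm_num) hKR
  set S : ℝ := ((Maj (n := n) R).card : ℝ) with hSS
  have hS0 : 0 ≤ S := Nat.cast_nonneg _
  have h2 : 1 ≤ K * (S * (𝔼 d, h d)) + 1/2 := by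
    calc (1:ℝ) ≤ K * (S * (𝔼 d, h d) + 1 / ((K^2 : ℕ):ℝ)) :=
          hh.trans (by gcongr)
      _ = K * (S * (𝔼 d, h d)) + K * (1 / ((K^2 : ℕ):ℝ)) := by ring
      _ ≤ _ := by gcongr
  have h3 : 1 ≤ 2 * (K * (S * (𝔼 d, h d))) := by linarith
  calc (1:ℝ) ≤ 2 * (K * (S * (𝔼 d, h d))) := h3
    _ ≤ K * (K * (S * (𝔼 d, h d))) := by gcongr
    _ = K * (K * S) * 𝔼 d, h d := by ring
    _ ≤ _ := mul_le_mul_of_nonneg_right hc3 hE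

lemma tri_W : ∃ C : ℕ, 1 ≤ C ∧ ∀ {n : ℕ} [NeZero n] {M : ℕ} (_ : n = 64 * M^2) {K : ℕ} (_ : 2 ≤ K) (_ : K^C ≤ M)
    (f : ZMod n → ℂ) (_ : ∀ x, ‖f x‖ ≤ 1) (_ : 1 ≤ K * tri M f), 1 ≤ ((K^C : ℕ):ℝ) * W M f := by
  obtain ⟨C, hC⟩ : ∃ C : ℕ, C = 41 := ⟨_, rfl⟩
  refine ⟨C, by omega, ?_⟩
  intro n _ M hn K hK hM f hf h
  have hK0 : 0 < K := by omega
  have hKR : (2:ℝ) ≤ K := by exact_mod_cast hK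
  have hKR0 : (0:ℝ) < K := by linarith
  have hKp : ∀ a b : ℕ, a ≤ b → K^a ≤ K^b := fun a b hab => Nat.pow_le_pow_right hK0 hab
  have h8 : 8 * K^8 ≤ K^11 := by
    calc 8 * K^8 = 2^3 * K^8 := by ring
      _ ≤ K^3 * K^8 := by gcongr
      _ = K^11 := by ring
  have hW := L4 (K := 8 * K^8) hn (by nlinarith [hKp 0 8 (by norm_num)])
    (h8.trans ((hKp 11 C (by omega)).trans hM)) f hf
  have hW0 : 0 ≤ W M f := exp_nonneg fun _ => exp_nonneg fun _ => exp_nonneg fun _ => G_nonneg _ _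
  have ht : 1 ≤ (K:ℝ)^8 * (tri M f)^8 := by
    rw [← mul_pow]; exact one_le_pow₀ h
  push_cast at hW ⊢
  have e1 : (K:ℝ)^8 * (4 / (8 * K^8)) = 1/2 := by field_simp; norm_num
  have h1 : 1 ≤ (K:ℝ)^8 * (64 * ((8 * K^8)^2 + 1) * 8 * W M f) + 1/2 := by
    calc (1:ℝ) ≤ (K:ℝ)^8 * (tri M f)^8 := ht
      _ ≤ (K:ℝ)^8 * (64 * ((8 * K^8)^2 + 1) * 8 * W M f + 4 / (8 * K^8)) := by gcongr
      _ = _ := by rw [mul_add, e1]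
  have h1K : (1:ℝ) ≤ K^8 := one_le_pow₀ (by linarith)
  calc (1:ℝ) ≤ 2 * ((K:ℝ)^8 * (64 * ((8 * K^8)^2 + 1) * 8 * W M f)) := by linarith
    _ ≤ 2 * ((K:ℝ)^8 * (64 * ((8 * K^8)^2 + (8 * K^8)^2) * 8 * W M f)) := by
        gcongr; nlinarith
    _ = 2^17 * K^24 * W M f := by ring
    _ ≤ K^17 * K^24 * W M f := by gcongr
    _ = _ := by rw [hC]; ring

lemma Main1 : ∃ C : ℕ, 1 ≤ C ∧ ∀ {n : ℕ} [NeZero n] {M : ℕ} (_ : n = 64 * M^2) {K : ℕ} (_ : 2 ≤ K) (_ : K^C ≤ M)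
    (f : ZMod n → ℂ) (_ : ∀ x, ‖f x‖ ≤ 1) (_ : 1 ≤ K * tri M f), 1 ≤ ((K^C : ℕ):ℝ) * G 3 f := by
  obtain ⟨C1, hC1, H1⟩ := tri_W
  obtain ⟨C2, hC2, H2⟩ := lemR'
  have b1 : 1 ≤ C1 * C2 := Nat.mul_pos hC1 hC2
  have b2 : 1 ≤ C1 * C2 * C2 := Nat.mul_pos b1 hC2
  have b3 : 1 ≤ C1 * C2 * C2 * C2 := Nat.mul_pos b2 hC2
  refine ⟨C1 * C2 * C2 * C2, b3, ?_⟩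
  intro n _ M hn K hK hM f hf h
  have hK0 : 0 < K := by omega
  have hKp : ∀ a b : ℕ, a ≤ b → K^a ≤ K^b := fun a b hab => Nat.pow_le_pow_right hK0 hab
  have hle : ∀ a, a ≤ C1 * C2 * C2 * C2 → K^a ≤ M := fun a ha => (hKp _ _ ha).trans hM
  have hl2 : C1 * C2 * C2 ≤ C1 * C2 * C2 * C2 := Nat.le_mul_of_pos_right _ hC2
  have hl1 : C1 * C2 ≤ C1 * C2 * C2 := Nat.le_mul_of_pos_right _ hC2
  have hl0 : C1 ≤ C1 * C2 := Nat.le_mul_of_pos_right _ hC2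
  have hWK := H1 hn hK (hle C1 (by omega)) f hf h
  have hnn : ∀ g : ZMod n → ℂ, ∀ s, 0 ≤ G s g := fun g s => G_nonneg s g
  have w1 : W M f = 𝔼 p3 : Pm M, 𝔼 p1 : Pm M, 𝔼 p2 : Pm M, G 0 (Dl (dir p3) (Dl (dir p2) (Dl (dir p1) f))) := by
    rw [W]
    conv_rhs => rw [exp_commR]
    refine ec fun p1 => ?_
    rw [exp_commR]
  have w2 : 𝔼 d, 𝔼 p1 : Pm M, 𝔼 p2 : Pm M, G 0 (Dl d (Dl (dir p2) (Dl (dir p1) f))) =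
      𝔼 p2 : Pm M, 𝔼 p1 : Pm M, G 1 (Dl (dir p2) (Dl (dir p1) f)) := by
    rw [exp_commR]
    conv_rhs => rw [exp_commR]
    refine ec fun p1 => ?_
    rw [exp_commR]
    rfl
  have w3 : 𝔼 d, 𝔼 p1 : Pm M, G 1 (Dl d (Dl (dir p1) f)) = 𝔼 p1 : Pm M, G 2 (Dl (dir p1) f) := by
    rw [exp_commR]
    rfl
  rw [w1] at hWK
  have s1 := H2 hn (K := K^C1) (hK.trans (Nat.le_self_pow (by omega) K)) (by
      rw [← pow_mul]; exact hle _ (by omega))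
    (fun d => 𝔼 p1 : Pm M, 𝔼 p2 : Pm M, G 0 (Dl d (Dl (dir p2) (Dl (dir p1) f))))
    (PD_exp _ fun p1 => PD_exp _ fun p2 => PD_G 0 _)
    (fun d => exp_nonneg fun _ => exp_nonneg fun _ => hnn _ _)
    (fun d => exp_le_one fun _ => exp_le_one fun _ => G_le_one 0 (Dl_bdd (Dl_bdd (Dl_bdd hf _) _) _)) hWK
  rw [w2, ← Nat.cast_pow, ← pow_mul] at s1
  have s2 := H2 hn (K := K^(C1*C2)) (hK.trans (Nat.le_self_pow (by omega) K)) (by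
      rw [← pow_mul]; exact hle _ (by omega))
    (fun d => 𝔼 p1 : Pm M, G 1 (Dl d (Dl (dir p1) f)))
    (PD_exp _ fun p1 => PD_G 1 _)
    (fun d => exp_nonneg fun _ => hnn _ _)
    (fun d => exp_le_one fun _ => G_le_one 1 (Dl_bdd (Dl_bdd hf _) _)) s1
  rw [w3, ← Nat.cast_pow, ← pow_mul] at s2
  have s3 := H2 hn (K := K^(C1*C2*C2)) (hK.trans (Nat.le_self_pow (by omega) K)) (by
      rw [← pow_mul]; exact hle _ (by omega))
    (fun d => G 2 (Dl d f))
    (PD_G 2 _)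
    (fun d => hnn _ _)
    (fun d => G_le_one 2 (Dl_bdd hf _)) s2
  rw [← Nat.cast_pow, ← pow_mul] at s3
  exact s3

end L4b
end NR

namespace NR

lemma exp_ex {ι : Type*} [Fintype ι] [Nonempty ι] (X : ι → ℝ) : ∃ i, 𝔼 j, X j ≤ X i := by
  obtain ⟨i, _, hi⟩ := Finset.exists_max_image (univ : Finset ι) X univ_nonempty
  exact ⟨i, expect_le univ_nonempty (fun j _ => hi j (mem_univ _))⟩

lemma pigeon {α β : Type*} [DecidableEq β] (s : Finset α) (t : Finset β) (f : α → β)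
    (hf : ∀ a ∈ s, f a ∈ t) (ht : t.Nonempty) : ∃ b ∈ t, s.card ≤ t.card * (s.filter fun a => f a = b).card := by
  obtain ⟨b, hb, h⟩ := Finset.exists_max_image t (fun b => (s.filter fun a => f a = b).card) ht
  refine ⟨b, hb, ?_⟩
  have := Finset.card_le_mul_card_image_of_maps_to (s := s) (t := t) (f := f) hf _ h
  rwa [mul_comm] at this

lemma weyl' : ∃ C : ℕ, 1 ≤ C ∧ ∀ {n : ℕ} [NeZero n] {M K : ℕ} (_ : n = 64 * M^2) (_ : 2 ≤ K) (_ : K^C ≤ M) (α β : ZMod n)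
    (_ : (1:ℝ) ≤ K * ‖𝔼 v : Fin M, e (α * (((v:ℕ):ℤ) : ZMod n)^2 + β * (((v:ℕ):ℤ) : ZMod n))‖),
    ∃ r : ℕ, 1 ≤ r ∧ r ≤ K^C ∧ nrm ((r : ZMod n) * α) ≤ K^C ∧
      nrm ((r : ZMod n) * β) ≤ K^C * M := 
  ⟨400, by norm_num, fun hn hK hM α β h => weyl hn hK hM α β h⟩

lemma BE : ∃ C : ℕ, 1 ≤ C ∧ ∀ {n : ℕ} [NeZero n] {M K : ℕ} (_ : n = 64 * M^2) (_ : 2 ≤ K) (_ : K^C ≤ M)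
    (w : ℤ) (_ : |w| ≤ 3 * M) (g0 : ZMod n → Fin M → ℂ) (g1 : ZMod n → ℤ → ℂ)
    (_ : ∀ j u, ‖g0 j u‖ ≤ 1) (_ : ∀ j V, ‖g1 j V‖ ≤ 1) (c : Fin M → ℂ) (_ : ∀ u, ‖c u‖ ≤ 1) (φ : Fin M → ZMod n)
    (_ : ∀ u, φ u ∈ Maj (K^C) → c u = 0),
    ‖T w g0 g1 (fun u j => c u * e (φ u * j))‖ ≤ 1 / K := by
  obtain ⟨C0, hC0, WY⟩ := weyl'
  obtain ⟨C1, hC1⟩ : ∃ C1, C1 = 5 * C0 := ⟨_, rfl⟩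
  obtain ⟨C2, hC2⟩ : ∃ C2, C2 = C1 + 5 := ⟨_, rfl⟩
  obtain ⟨C, hC⟩ : ∃ C, C = 1 + C1 + C2 * 16 := ⟨_, rfl⟩
  refine ⟨C, by omega, ?_⟩
  intro n _ M K hn hK hM w hw g0 g1 hg0 hg1 c hc φ hφ
  have hK0 : 0 < K := by omega
  have hKR : (2:ℝ) ≤ K := by exact_mod_cast hK
  have hKR0 : (0:ℝ) < K := by linarith
  have hKp : ∀ a b : ℕ, a ≤ b → K^a ≤ K^b := fun a b hab => Nat.pow_le_pow_right hK0 hab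
  have hM0 : 0 < M := lt_of_lt_of_le (by positivity) hM
  have : Nonempty (Fin M) := ⟨⟨0, hM0⟩⟩
  by_contra hcon
  push Not at hcon
  have hb := box w g0 g1 (fun u j => c u * e (φ u * j)) hg0 hg1
  have hT : 1 / (K:ℝ)^4 ≤ ‖T w g0 g1 (fun u j => c u * e (φ u * j))‖^4 := by
    rw [← one_div_pow]; exact pow_le_pow_left₀ (by positivity) hcon.le 4
  have hb := hT.trans hb
  obtain ⟨t, ht⟩ := exp_ex (fun t : T3 M => 𝔼 j, 𝔼 u : Fin M, 𝔼 u' : Fin M,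
      ‖𝔼 v : Fin M, (c u * e (φ u * (j + (((Vt w t v - ((u:ℕ):ℤ))^2 : ℤ) : ZMod n)))) *
       conj (c u' * e (φ u' * (j + (((Vt w t v - ((u':ℕ):ℤ))^2 : ℤ) : ZMod n))))‖^2)
  have ht := hb.trans ht
  clear hb
  obtain ⟨j, hj⟩ := exp_ex (fun j => 𝔼 u : Fin M, 𝔼 u' : Fin M,
      ‖𝔼 v : Fin M, (c u * e (φ u * (j + (((Vt w t v - ((u:ℕ):ℤ))^2 : ℤ) : ZMod n)))) *
       conj (c u' * e (φ u' * (j + (((Vt w t v - ((u':ℕ):ℤ))^2 : ℤ) : ZMod n))))‖^2)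
  have hj := ht.trans hj
  clear ht
  obtain ⟨u, hu⟩ := exp_ex (fun u : Fin M => 𝔼 u' : Fin M,
      ‖𝔼 v : Fin M, (c u * e (φ u * (j + (((Vt w t v - ((u:ℕ):ℤ))^2 : ℤ) : ZMod n)))) *
       conj (c u' * e (φ u' * (j + (((Vt w t v - ((u':ℕ):ℤ))^2 : ℤ) : ZMod n))))‖^2)
  have hu := hj.trans hu
  clear hj
  set s : ℤ := ((t.1:ℕ):ℤ) + ((t.2.1:ℕ):ℤ) + ((t.2.2:ℕ):ℤ) + w with hs
  set X : Fin M → ℝ := fun u' => ‖𝔼 v : Fin M, e ((φ u - φ u') * (((v:ℕ):ℤ) : ZMod n)^2 +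
    (2 * (φ u * ((s - ((u:ℕ):ℤ) : ℤ) : ZMod n) - φ u' * ((s - ((u':ℕ):ℤ) : ℤ) : ZMod n))) * (((v:ℕ):ℤ) : ZMod n))‖ with hX
  have hX1 : ∀ u', X u' ≤ 1 := fun u' => nexp_le_one fun _ => (norm_e _).le
  have hX0 : ∀ u', 0 ≤ X u' := fun u' => norm_nonneg _
  have hid : ∀ u' : Fin M, 𝔼 v : Fin M, (c u * e (φ u * (j + (((Vt w t v - ((u:ℕ):ℤ))^2 : ℤ) : ZMod n)))) *
       conj (c u' * e (φ u' * (j + (((Vt w t v - ((u':ℕ):ℤ))^2 : ℤ) : ZMod n)))) =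
      (c u * conj (c u') * e ((φ u - φ u') * j + φ u * ((s - ((u:ℕ):ℤ) : ℤ) : ZMod n)^2 - φ u' * ((s - ((u':ℕ):ℤ) : ℤ) : ZMod n)^2)) *
      𝔼 v : Fin M, e ((φ u - φ u') * (((v:ℕ):ℤ) : ZMod n)^2 +
    (2 * (φ u * ((s - ((u:ℕ):ℤ) : ℤ) : ZMod n) - φ u' * ((s - ((u':ℕ):ℤ) : ℤ) : ZMod n))) * (((v:ℕ):ℤ) : ZMod n)) := by
    intro u'
    rw [mul_expect]
    refine ec fun v => ?_
    rw [map_mul, mul_mul_mul_comm, ← e_sub, mul_assoc (c u * conj (c u')), ← e_add]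
    congr 2
    simp only [Vt, hs]
    push_cast
    ring
  have hle : ∀ u' : Fin M, ‖𝔼 v : Fin M, (c u * e (φ u * (j + (((Vt w t v - ((u:ℕ):ℤ))^2 : ℤ) : ZMod n)))) *
       conj (c u' * e (φ u' * (j + (((Vt w t v - ((u':ℕ):ℤ))^2 : ℤ) : ZMod n))))‖^2 ≤ ‖c u‖ * X u' := by
    intro u'
    rw [hid, norm_mul, norm_mul, norm_e, mul_one, norm_mul, RCLike.norm_conj]
    have h1 : ‖c u‖ * ‖c u'‖ * X u' ≤ ‖c u‖ * X u' := by
      have := mul_le_mul_of_nonneg_left (hc u') (norm_nonneg (c u))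
      rw [mul_one] at this
      exact mul_le_mul_of_nonneg_right this (hX0 u')
    have h2 : ‖c u‖ * X u' ≤ 1 := mul_le_one₀ (hc u) (hX0 u') (hX1 u')
    have h3 : 0 ≤ ‖c u‖ * ‖c u'‖ * X u' := mul_nonneg (by positivity) (hX0 u')
    calc _ = (‖c u‖ * ‖c u'‖ * X u')^2 := rfl
      _ ≤ ‖c u‖ * ‖c u'‖ * X u' := by nlinarith
      _ ≤ _ := h1
  have hu2 : 1 / (K:ℝ)^4 ≤ ‖c u‖ * 𝔼 u', X u' := by
    rw [mul_expect]
    exact hu.trans (exp_mono hle)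
  have hcu : c u ≠ 0 := by
    intro h0
    rw [h0, norm_zero, zero_mul] at hu2
    have : 0 < 1 / (K:ℝ)^4 := by positivity
    linarith
  apply hcu
  apply hφ
  have hu3 : 1 / (K:ℝ)^4 ≤ 𝔼 u', X u' := by
    refine hu2.trans ?_
    have := mul_le_mul_of_nonneg_right (hc u) (exp_nonneg hX0)
    rwa [one_mul] at this
  have hm := many X hX1 (1 / K^5) (by positivity) (by
    refine le_trans ?_ hu3
    rw [mul_one_div, div_le_div_iff₀ (by positivity) (by positivity)]
    have : (0:ℝ) < K^4 := by positivity
    calc 2 * (K:ℝ)^4 ≤ K * K^4 := by gcongr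
      _ = _ := by ring)
  set U := (Finset.univ.filter fun i => 1 / (K:ℝ)^5 ≤ X i) with hU
  rw [Fintype.card_fin, one_div, inv_mul_le_iff₀ (by positivity)] at hm
  have hmN : M ≤ K^5 * U.card := by exact_mod_cast hm
  have hWY : ∀ u' ∈ U, ∃ r : ℕ, 1 ≤ r ∧ r ≤ K^C1 ∧ nrm ((((((u':ℕ):ℤ) - ((u:ℕ):ℤ) : ℤ)) : ZMod n) * (((2 * r : ℕ) : ZMod n) * φ u)) ≤ K^C2 * M := by
    intro u' hu'
    have hu' := (Finset.mem_filter.1 hu').2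
    obtain ⟨r, r1, r2, r3, r4⟩ := WY (K := K^5) hn (hK.trans (Nat.le_self_pow (by norm_num) K)) (by
      rw [← pow_mul, ← hC1]; exact (hKp _ _ (by omega)).trans hM) (φ u - φ u')
      (2 * (φ u * ((s - ((u:ℕ):ℤ) : ℤ) : ZMod n) - φ u' * ((s - ((u':ℕ):ℤ) : ℤ) : ZMod n))) (by
        rw [div_le_iff₀ (by positivity)] at hu'
        push_cast
        push_cast [hX] at hu'
        linarith)
    rw [← pow_mul, ← hC1] at r2 r3 r4
    refine ⟨r, r1, r2, ?_⟩
    have e1 : (((((u':ℕ):ℤ) - ((u:ℕ):ℤ) : ℤ)) : ZMod n) * (((2 * r : ℕ) : ZMod n) * φ u) =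
      (r : ZMod n) * (2 * (φ u * ((s - ((u:ℕ):ℤ) : ℤ) : ZMod n) - φ u' * ((s - ((u':ℕ):ℤ) : ℤ) : ZMod n))) -
      ((2 * (s - ((u':ℕ):ℤ)) : ℤ) : ZMod n) * ((r : ZMod n) * (φ u - φ u')) := by
      push_cast; ring
    rw [e1]
    have hsb : (2 * (s - ((u':ℕ):ℤ))).natAbs ≤ 14 * M := by
      have a1 := t.1.2
      have a2 := t.2.1.2
      have a3 := t.2.2.2
      have a4 := u'.2
      rw [abs_le] at hw
      omega
    calc _ ≤ K^C1 * M + (14 * M) * K^C1 := by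
          refine (nrm_sub _ _).trans (add_le_add r4 ?_)
          refine (nrm_int_mul _ _).trans ?_
          exact Nat.mul_le_mul hsb r3
      _ ≤ 2^5 * (K^C1 * M) := by
          have : 0 ≤ K^C1 * M := Nat.zero_le _
          nlinarith
      _ ≤ K^5 * (K^C1 * M) := by gcongr
      _ = _ := by rw [hC2]; ring
  choose! r r1 r2 r3 using hWY
  classical
  obtain ⟨r0, hr0, hp⟩ := pigeon U (Finset.Icc 1 (K^C1)) r (fun a ha => Finset.mem_Icc.2 ⟨r1 a ha, r2 a ha⟩)
    ⟨1, Finset.mem_Icc.2 ⟨le_rfl, Nat.one_le_pow _ _ hK0⟩⟩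
  rw [Finset.mem_Icc] at hr0
  rw [Nat.card_Icc, Nat.add_sub_cancel] at hp
  obtain ⟨q, q1, q2, q3⟩ := MR (K := K^C2) hn (hK.trans (Nat.le_self_pow (by omega) K)) (by
    rw [← pow_mul]; exact (hKp _ _ (by omega)).trans hM) (((2 * r0 : ℕ) : ZMod n) * φ u)
    ((U.filter fun a => r a = r0).image fun u' : Fin M => ((u':ℕ):ℤ) - ((u:ℕ):ℤ)) (by
      intro b hb
      rw [Finset.mem_image] at hb
      obtain ⟨u', _, rfl⟩ := hb
      have := u.2
      have := u'.2
      rw [abs_le]; omega) (by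
      intro b hb
      rw [Finset.mem_image] at hb
      obtain ⟨u', hu', rfl⟩ := hb
      rw [mem_filter] at hu'
      have := r3 u' hu'.1
      rwa [hu'.2] at this) (by
      rw [Finset.card_image_of_injective _ (by
        intro a b hab
        simp only at hab
        ext; omega)]
      calc M ≤ K^5 * U.card := hmN
        _ ≤ K^5 * (K^C1 * _) := Nat.mul_le_mul_left _ hp
        _ = _ := by rw [hC2]; ring)
  rw [← pow_mul] at q2 q3
  rw [mem_Maj]
  refine ⟨q * (2 * r0), Nat.mul_pos q1 (by omega), ?_, ?_⟩
  · calc q * (2 * r0) ≤ K^(C2*16) * (K * K^C1) := by gcongr; exact hr0.2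
      _ = K^C := by rw [hC]; ring
  · have : ((q * (2 * r0) : ℕ) : ZMod n) * φ u = (q : ZMod n) * (((2 * r0 : ℕ) : ZMod n) * φ u) := by push_cast; ring
    rw [this]
    exact q3.trans (hKp _ _ (by omega))

end NR

namespace NR

section DL
set_option linter.unusedSectionVars false
variable {n : ℕ} [NeZero n] {U P : Type*} [Fintype U] [Fintype P] [Nonempty U] [Nonempty P]

open Classical in
lemma ind_sum (Mj : Finset (ZMod n)) (a b : ZMod n) (y : ZMod n → ℝ) (hy : ∀ ξ, 0 ≤ y ξ) :
    y a * (if a - b ∈ Mj then (1:ℝ) else 0) ≤ ∑ ξ ∈ Mj, y (b + ξ) := by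
  split_ifs with h
  · rw [mul_one]
    have := Finset.single_le_sum (f := fun ξ => y (b + ξ)) (fun ξ _ => hy _) h
    simpa using this
  · rw [mul_zero]; exact Finset.sum_nonneg fun ξ _ => hy _

lemma hat_sq (g : ZMod n → ℂ) (α : ZMod n) :
    ((‖hat g α‖^2 : ℝ) : ℂ) = 𝔼 k, e (-(α * k)) * 𝔼 x, Dl k g x := by
  rw [hat, normsq_exp]
  simp only [mul_expect]
  conv_rhs => rw [exp_comm]
  refine ec fun x => ?_
  refine shc (-x) (fun j => ?_)
  simp only [Dl]
  rw [map_mul, mul_mul_mul_comm, ← e_sub]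
  rw [show x + (j + -x) = j by ring, show α * x - α * j = -(α * (j + -x)) by ring]
  ring

lemma one_diff (h : ZMod n → ℂ) (α : ZMod n) :
    (𝔼 d, ‖hat (Dl d h) α‖)^2 ≤ G 1 h := by
  refine (exp_sq_le _).trans ?_
  have h0 : 0 ≤ 𝔼 d, ‖hat (Dl d h) α‖^2 := exp_nonneg fun d => by positivity
  rw [← norm_real h0, ofReal_exp]
  simp only [hat_sq]
  rw [exp_comm]
  refine (nexp_le _).trans ?_
  simp only [G]
  refine exp_mono fun k => ?_
  rw [← mul_expect, norm_mul, norm_e, one_mul]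
  have : 𝔼 d, 𝔼 x, Dl k (Dl d h) x = ((‖𝔼 x, Dl k h x‖^2 : ℝ):ℂ) := by
    rw [← autoc]
    simp only [Dl_comm k]
  rw [this, norm_real (by positivity)]

lemma bilin (g a b : ZMod n → ℂ) (ha : ∀ x, ‖a x‖ ≤ 1) (hb : ∀ x, ‖b x‖ ≤ 1) :
    ‖𝔼 d1, a d1 * 𝔼 d2, b d2 * g (d1 + d2)‖^4 ≤ G 1 g := by
  have h1 := kill a (fun d1 d2 => b d2 * g (d1 + d2)) ha
  have h2 : 𝔼 k, 𝔼 k', ‖𝔼 i, b k * g (i + k) * conj (b k' * g (i + k'))‖ ≤ 𝔼 d, ‖𝔼 x, Dl d g x‖ := by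
    have h3 : ∀ k k' : ZMod n, ‖𝔼 i, b k * g (i + k) * conj (b k' * g (i + k'))‖ ≤ ‖𝔼 x, Dl (k' - k) g x‖ := by
      intro k k'
      have : 𝔼 i, b k * g (i + k) * conj (b k' * g (i + k')) = b k * conj (b k') * 𝔼 x, Dl (k' - k) g x := by
        rw [mul_expect]
        refine shc k (fun j => ?_)
        simp only [Dl, map_mul]
        rw [show j + k + (k' - k) = j + k' by ring]
        ring
      rw [this, norm_mul, norm_mul, RCLike.norm_conj]
      have := mul_le_one₀ (hb k) (norm_nonneg _) (hb k')
      exact mul_le_of_le_one_left (norm_nonneg _) this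
    refine (exp_mono fun k => exp_mono fun k' => h3 k k').trans ?_
    have : ∀ k : ZMod n, 𝔼 k', ‖𝔼 x, Dl (k' - k) g x‖ = 𝔼 d, ‖𝔼 x, Dl d g x‖ := by
      intro k
      refine shcR (-k) (fun j => ?_)
      rw [sub_eq_add_neg]
    simp only [this, Fintype.expect_const]
    exact le_rfl
  calc _ = (‖𝔼 d1, a d1 * 𝔼 d2, b d2 * g (d1 + d2)‖^2)^2 := by ring
    _ ≤ (𝔼 d, ‖𝔼 x, Dl d g x‖)^2 := pow_le_pow_left₀ (by positivity) (h1.trans h2) 2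
    _ ≤ 𝔼 d, ‖𝔼 x, Dl d g x‖^2 := exp_sq_le _
    _ = G 1 g := rfl

lemma two_diff (h : ZMod n → ℂ) (hh : ∀ x, ‖h x‖ ≤ 1) (α β : ZMod n → ZMod n) :
    (𝔼 d1, 𝔼 d2, ‖hat (Dl d2 (Dl d1 h)) (α d1 + β d2)‖)^8 ≤ G 2 h := by
  have h0 : 0 ≤ 𝔼 d1, 𝔼 d2, ‖hat (Dl d2 (Dl d1 h)) (α d1 + β d2)‖^2 := exp_nonneg fun _ => exp_nonneg fun _ => by positivity
  have a1 : (𝔼 d1, 𝔼 d2, ‖hat (Dl d2 (Dl d1 h)) (α d1 + β d2)‖)^2 ≤ 𝔼 d1, 𝔼 d2, ‖hat (Dl d2 (Dl d1 h)) (α d1 + β d2)‖^2 :=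
    (exp_sq_le _).trans (exp_mono fun d1 => exp_sq_le _)
  have a2 : 𝔼 d1, 𝔼 d2, ‖hat (Dl d2 (Dl d1 h)) (α d1 + β d2)‖^2 ≤
      𝔼 k, 𝔼 x, ‖𝔼 d1, (e (-(α d1 * k)) * conj (Dl k h (x + d1))) * 𝔼 d2, (e (-(β d2 * k)) * (Dl k h x) * conj (Dl k h (x + d2))) * (fun y => Dl k h (x + y)) (d1 + d2)‖ := by
    have e1 : ((𝔼 d1, 𝔼 d2, ‖hat (Dl d2 (Dl d1 h)) (α d1 + β d2)‖^2 : ℝ) : ℂ) =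
      𝔼 k, 𝔼 x, 𝔼 d1, (e (-(α d1 * k)) * conj (Dl k h (x + d1))) * 𝔼 d2, (e (-(β d2 * k)) * (Dl k h x) * conj (Dl k h (x + d2))) * (fun y => Dl k h (x + y)) (d1 + d2) := by
      simp only [ofReal_exp, hat_sq]
      have : ∀ d1 : ZMod n, 𝔼 d2, 𝔼 k, e (-((α d1 + β d2) * k)) * 𝔼 x, Dl k (Dl d2 (Dl d1 h)) x =
          𝔼 k, 𝔼 d2, e (-((α d1 + β d2) * k)) * 𝔼 x, Dl k (Dl d2 (Dl d1 h)) x := fun d1 => exp_comm _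
      simp only [this]
      rw [exp_comm]
      refine ec fun k => ?_
      rw [exp_comm (ι := ZMod n) (κ := ZMod n) (fun x d1 => (e (-(α d1 * k)) * conj (Dl k h (x + d1))) * 𝔼 d2, (e (-(β d2 * k)) * (Dl k h x) * conj (Dl k h (x + d2))) * (fun y => Dl k h (x + y)) (d1 + d2))]
      refine ec fun d1 => ?_
      simp only [mul_expect]
      rw [exp_comm]
      refine ec fun x => ec fun d2 => ?_
      rw [Dl_comm k, Dl_comm k]
      rw [show -((α d1 + β d2) * k) = -(α d1 * k) + -(β d2 * k) by ring, e_add]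
      generalize Dl k h = g
      simp only [Dl, map_mul, Complex.conj_conj]
      rw [show x + d2 + d1 = x + (d1 + d2) by ring]
      ring
    rw [← norm_real h0, e1]
    exact (nexp_le _).trans (exp_mono fun k => nexp_le _)
  have a3 : ∀ k x : ZMod n, ‖𝔼 d1, (e (-(α d1 * k)) * conj (Dl k h (x + d1))) * 𝔼 d2, (e (-(β d2 * k)) * (Dl k h x) * conj (Dl k h (x + d2))) * (fun y => Dl k h (x + y)) (d1 + d2)‖^4 ≤
      G 1 (Dl k h) := by
    intro k x
    have hk := Dl_bdd hh k
    refine (bilin (fun y => Dl k h (x + y)) (fun d1 => e (-(α d1 * k)) * conj (Dl k h (x + d1)))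
      (fun d2 => e (-(β d2 * k)) * (Dl k h x) * conj (Dl k h (x + d2))) ?_ ?_).trans (le_of_eq ?_)
    · intro d1; rw [norm_mul, norm_e, one_mul, RCLike.norm_conj]; exact hk _
    · intro d2; rw [norm_mul, norm_mul, norm_e, one_mul, RCLike.norm_conj]; exact mul_le_one₀ (hk _) (norm_nonneg _) (hk _)
    · simp only [G]
      refine ec fun d => ?_
      congr 2
      refine shc x (fun j => ?_)
      simp only [Dl]
      rw [show x + (j + d) = j + x + d by ring, show x + j = j + x by ring]
  calc _ = ((𝔼 d1, 𝔼 d2, ‖hat (Dl d2 (Dl d1 h)) (α d1 + β d2)‖)^2)^4 := by ring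
    _ ≤ (𝔼 d1, 𝔼 d2, ‖hat (Dl d2 (Dl d1 h)) (α d1 + β d2)‖^2)^4 := pow_le_pow_left₀ (by positivity) a1 4
    _ ≤ (𝔼 k, 𝔼 x, ‖𝔼 d1, (e (-(α d1 * k)) * conj (Dl k h (x + d1))) * 𝔼 d2, (e (-(β d2 * k)) * (Dl k h x) * conj (Dl k h (x + d2))) * (fun y => Dl k h (x + y)) (d1 + d2)‖)^4 :=
        pow_le_pow_left₀ h0 a2 4
    _ ≤ 𝔼 k, 𝔼 x, ‖𝔼 d1, (e (-(α d1 * k)) * conj (Dl k h (x + d1))) * 𝔼 d2, (e (-(β d2 * k)) * (Dl k h x) * conj (Dl k h (x + d2))) * (fun y => Dl k h (x + y)) (d1 + d2)‖^4 :=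
        (exp_pow_le _ (fun k => exp_nonneg fun x => norm_nonneg _) 2).trans
          (exp_mono fun k => exp_pow_le _ (fun x => norm_nonneg _) 2)
    _ ≤ 𝔼 k, 𝔼 x : ZMod n, G 1 (Dl k h) := exp_mono fun k => exp_mono fun x => a3 k x
    _ = G 2 h := by simp only [Fintype.expect_const]; rfl

open Classical in
lemma DL3 (h : U → ZMod n → ℂ) (hp : U → P → ZMod n → ℂ) (hrep : ∀ u x, h u x = 𝔼 p, hp u p x)
    (h1 : ∀ u x, ‖h u x‖ ≤ 1) (Mj : Finset (ZMod n)) (δ : ℝ)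
    (hBE : ∀ (d d' : ZMod n) (c : U → ℂ) (ψ : U → ZMod n), (∀ u, ‖c u‖ ≤ 1) →
      ‖𝔼 u, 𝔼 p, 𝔼 x, c u * (conj (hp u p (x + d)) * hp u p (x + d')) * e (ψ u * x)‖ ≤
        δ + 𝔼 u, ‖c u‖ * (if ψ u ∈ Mj then (1:ℝ) else 0)) :
    ∃ Y : ℝ, 0 ≤ Y ∧ (𝔼 u, G 2 (h u))^2 ≤ δ + Mj.card * Y ∧ Y^2 ≤ 𝔼 u, G 1 (h u) := by
  choose φ hφ using fun u d => G_one_le (Dl_bdd (h1 u) d)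
  choose α hα using fun u => Finite.exists_max (fun α => 𝔼 d, ‖hat (Dl d (h u)) α‖)
  refine ⟨𝔼 u, 𝔼 d, ‖hat (Dl d (h u)) (α u)‖, exp_nonneg fun _ => exp_nonneg fun _ => norm_nonneg _, ?_,
    (exp_sq_le _).trans (exp_mono fun u => one_diff _ _)⟩
  set Φ : U → ZMod n → ℂ := fun u d => hat (Dl d (h u)) (φ u d) with hΦ
  have hΦ1 : ∀ u d, ‖Φ u d‖ ≤ 1 := fun u d => hat_le_one (Dl_bdd (h1 u) d) _
  have hX0 : 0 ≤ 𝔼 u, G 2 (h u) := exp_nonneg fun u => G_nonneg _ _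
  have hX : 𝔼 u, G 2 (h u) ≤ 𝔼 u, 𝔼 d, ‖Φ u d‖^2 := exp_mono fun u => exp_mono fun d => hφ u d
  have hC0 : 0 ≤ 𝔼 u, 𝔼 d, ‖Φ u d‖^2 := hX0.trans hX
  set F : U × P × ZMod n → ZMod n → ℂ := fun i d =>
    conj (Φ i.1 d) * conj (hp i.1 i.2.1 (i.2.2 + d)) * e (φ i.1 d * i.2.2) with hF
  have e1 : ((𝔼 u, 𝔼 d, ‖Φ u d‖^2 : ℝ) : ℂ) = 𝔼 i : U × P × ZMod n, h i.1 i.2.2 * 𝔼 d, F i d := by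
    simp only [ofReal_exp, exp_prod]
    refine ec fun u => ?_
    have : ∀ d, ((‖Φ u d‖^2 : ℝ) : ℂ) = 𝔼 p, 𝔼 x, h u x * F (u,p,x) d := by
      intro d
      have hd : Φ u d = 𝔼 x, Dl d (h u) x * e (φ u d * x) := rfl
      rw [nsq]
      nth_rewrite 1 [hd]
      rw [expect_mul, exp_comm]
      refine ec fun x => ?_
      rw [Dl, hrep u (x + d), conj_exp, hF]
      simp only [mul_expect, expect_mul]
      refine ec fun p => ?_
      ring
    simp only [this]
    rw [exp_comm]
    refine ec fun p => ?_
    rw [exp_comm]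
    refine ec fun x => ?_
    rw [mul_expect]
  have k1 := kill (fun i : U × P × ZMod n => h i.1 i.2.2) F (fun i => h1 _ _)
  rw [← e1, norm_real hC0] at k1
  have k2 : ∀ d d', ‖𝔼 i, F i d * conj (F i d')‖ ≤ δ + 𝔼 u, ∑ ξ ∈ Mj, ‖hat (Dl d (h u)) (φ u d' + ξ)‖ := by
    intro d d'
    have e2 : 𝔼 i, F i d * conj (F i d') = 𝔼 u, 𝔼 p, 𝔼 x, (conj (Φ u d) * Φ u d') * (conj (hp u p (x + d)) * hp u p (x + d')) * e ((φ u d - φ u d') * x) := by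
      simp only [exp_prod]
      refine ec fun u => ec fun p => ec fun x => ?_
      simp only [hF, map_mul, Complex.conj_conj]
      rw [sub_mul, e_sub]
      ring
    rw [e2]
    refine (hBE d d' _ _ (fun u => ?_)).trans ?_
    · rw [norm_mul, RCLike.norm_conj]; exact mul_le_one₀ (hΦ1 _ _) (norm_nonneg _) (hΦ1 _ _)
    · refine add_le_add le_rfl (exp_mono fun u => ?_)
      refine le_trans ?_ (ind_sum Mj (φ u d) (φ u d') (fun ξ => ‖hat (Dl d (h u)) ξ‖) (fun _ => norm_nonneg _))
      refine mul_le_mul_of_nonneg_right ?_ (by positivity)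
      rw [norm_mul, RCLike.norm_conj]
      exact mul_le_of_le_one_right (norm_nonneg _) (hΦ1 _ _)
  calc (𝔼 u, G 2 (h u))^2 ≤ (𝔼 u, 𝔼 d, ‖Φ u d‖^2)^2 := pow_le_pow_left₀ hX0 hX 2
    _ ≤ 𝔼 d, 𝔼 d', ‖𝔼 i, F i d * conj (F i d')‖ := k1
    _ ≤ 𝔼 d, 𝔼 d', (δ + 𝔼 u, ∑ ξ ∈ Mj, ‖hat (Dl d (h u)) (φ u d' + ξ)‖) := exp_mono fun d => exp_mono fun d' => k2 d d'
    _ = 𝔼 d', (δ + 𝔼 u, ∑ ξ ∈ Mj, 𝔼 d, ‖hat (Dl d (h u)) (φ u d' + ξ)‖) := by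
        rw [exp_commR]
        refine ec fun d' => ?_
        rw [expect_add_distrib, Fintype.expect_const, exp_commR]
        congr 1
        refine ec fun u => ?_
        rw [Finset.expect_sum_comm]
    _ ≤ 𝔼 d' : ZMod n, (δ + 𝔼 u, ∑ ξ ∈ Mj, 𝔼 d, ‖hat (Dl d (h u)) (α u)‖) := by
        refine exp_mono fun d' => add_le_add le_rfl (exp_mono fun u => Finset.sum_le_sum fun ξ _ => hα u _)
    _ = _ := by
        rw [Fintype.expect_const]
        simp only [Finset.sum_const, nsmul_eq_mul]
        rw [mul_expect]

lemma swap4 {S : Type*} [Fintype S] [Nonempty S] (Z : S → S → S → S → ℝ) (B : ℝ) (h : ∀ d2' d1', 𝔼 d1, 𝔼 d2, Z d1 d1' d2 d2' ≤ B) :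
    𝔼 d2, 𝔼 d2', 𝔼 d1, 𝔼 d1', Z d1 d1' d2 d2' ≤ B := by
  have : 𝔼 d2, 𝔼 d2', 𝔼 d1, 𝔼 d1', Z d1 d1' d2 d2' = 𝔼 d2', 𝔼 d1', 𝔼 d1, 𝔼 d2, Z d1 d1' d2 d2' := by
    rw [exp_commR]
    refine ec fun d2' => ?_
    have : ∀ d2, 𝔼 d1, 𝔼 d1', Z d1 d1' d2 d2' = 𝔼 d1', 𝔼 d1, Z d1 d1' d2 d2' := fun d2 => exp_commR _
    simp only [this]
    rw [exp_commR]
    refine ec fun d1' => ?_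
    rw [exp_commR]
  rw [this]
  exact (exp_mono fun d2' => exp_mono fun d1' => h d2' d1').trans (by simp only [Fintype.expect_const]; exact le_rfl)

set_option maxHeartbeats 1000000 in
open Classical in
lemma DL4 (h : U → ZMod n → ℂ) (hp : U → P → ZMod n → ℂ) (hrep : ∀ u x, h u x = 𝔼 p, hp u p x)
    (h1 : ∀ u x, ‖h u x‖ ≤ 1) (Mj : Finset (ZMod n)) (δ : ℝ)
    (hBE : ∀ (s1 s2 s3 s4 : ZMod n) (c : U → ℂ) (ψ : U → ZMod n), (∀ u, ‖c u‖ ≤ 1) →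
      ‖𝔼 u, 𝔼 p, 𝔼 x, c u * (hp u p (x + s1) * conj (hp u p (x + s2)) * conj (hp u p (x + s3)) * hp u p (x + s4)) * e (ψ u * x)‖ ≤
        δ + 𝔼 u, ‖c u‖ * (if ψ u ∈ Mj then (1:ℝ) else 0)) :
    ∃ Y : ℝ, 0 ≤ Y ∧ (𝔼 u, G 3 (h u))^4 ≤ δ + Mj.card * Y ∧ Y^8 ≤ 𝔼 u, G 2 (h u) := by
  have hb : ∀ u d1 d2 x, ‖Dl d2 (Dl d1 (h u)) x‖ ≤ 1 := fun u d1 d2 => Dl_bdd (Dl_bdd (h1 u) d1) d2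
  choose φ hφ using fun u d1 d2 => G_one_le (hb u d1 d2)
  choose α hα using fun u => Finite.exists_max (fun α : (ZMod n → ZMod n) × (ZMod n → ZMod n) =>
    𝔼 d1, 𝔼 d2, ‖hat (Dl d2 (Dl d1 (h u))) (α.1 d1 + α.2 d2)‖)
  set Y : ℝ := 𝔼 u, 𝔼 d1, 𝔼 d2, ‖hat (Dl d2 (Dl d1 (h u))) ((α u).1 d1 + (α u).2 d2)‖ with hY
  refine ⟨Y, exp_nonneg fun _ => exp_nonneg fun _ => exp_nonneg fun _ => norm_nonneg _, ?_,
    (exp_pow_le _ (fun u => exp_nonneg fun _ => exp_nonneg fun _ => norm_nonneg _) 3).trans (exp_mono fun u => two_diff _ (h1 u) _ _)⟩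
  set Φ : U → ZMod n → ZMod n → ℂ := fun u d1 d2 => hat (Dl d2 (Dl d1 (h u))) (φ u d1 d2) with hΦ
  have hΦ1 : ∀ u d1 d2, ‖Φ u d1 d2‖ ≤ 1 := fun u d1 d2 => hat_le_one (hb u d1 d2) _
  have hX0 : 0 ≤ 𝔼 u, G 3 (h u) := exp_nonneg fun u => G_nonneg _ _
  have hX : 𝔼 u, G 3 (h u) ≤ 𝔼 u, 𝔼 d1, 𝔼 d2, ‖Φ u d1 d2‖^2 :=
    exp_mono fun u => exp_mono fun d1 => exp_mono fun d2 => hφ u d1 d2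
  have hC0 := hX0.trans hX
  set F : U × P × ZMod n × ZMod n → ZMod n → ℂ := fun i d2 =>
    conj (Φ i.1 i.2.2.2 d2) * conj (h i.1 (i.2.2.1 + d2)) * hp i.1 i.2.1 (i.2.2.1 + d2 + i.2.2.2) * e (φ i.1 i.2.2.2 d2 * i.2.2.1) with hF
  set A : U × P × ZMod n × ZMod n → ℂ := fun i => h i.1 i.2.2.1 * conj (h i.1 (i.2.2.1 + i.2.2.2)) with hA
  have hA1 : ∀ i, ‖A i‖ ≤ 1 := by
    intro i
    simp only [hA]
    rw [norm_mul, RCLike.norm_conj]; exact mul_le_one₀ (h1 _ _) (norm_nonneg _) (h1 _ _)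
  have e1 : ((𝔼 u, 𝔼 d1, 𝔼 d2, ‖Φ u d1 d2‖^2 : ℝ) : ℂ) = 𝔼 i : U × P × ZMod n × ZMod n, A i * 𝔼 d, F i d := by
    simp only [ofReal_exp, exp_prod]
    refine ec fun u => ?_
    have : ∀ d1 d2, ((‖Φ u d1 d2‖^2 : ℝ) : ℂ) = 𝔼 p, 𝔼 x, A (u,p,x,d1) * F (u,p,x,d1) d2 := by
      intro d1 d2
      have hd : Φ u d1 d2 = 𝔼 x, Dl d2 (Dl d1 (h u)) x * e (φ u d1 d2 * x) := rfl
      rw [nsq]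
      nth_rewrite 1 [hd]
      rw [expect_mul, exp_comm]
      refine ec fun x => ?_
      rw [Dl, Dl, Dl, map_mul, Complex.conj_conj, hrep u (x + d2 + d1), hF, hA]
      simp only [mul_expect, expect_mul]
      refine ec fun p => ?_
      ring
    simp only [this]
    have w : ∀ d1, 𝔼 d2, 𝔼 p, 𝔼 x, A (u,p,x,d1) * F (u,p,x,d1) d2 = 𝔼 p, 𝔼 x, A (u,p,x,d1) * 𝔼 d2, F (u,p,x,d1) d2 := by
      intro d1
      rw [exp_comm]
      refine ec fun p => ?_
      rw [exp_comm]
      refine ec fun x => ?_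
      rw [mul_expect]
    simp only [w]
    rw [exp_comm]
    refine ec fun p => ?_
    rw [exp_comm]
  have k1 := kill A F hA1
  rw [← e1, norm_real hC0] at k1
  have k2 : ∀ d2 d2', ‖𝔼 i, F i d2 * conj (F i d2')‖^2 ≤ 𝔼 d1, 𝔼 d1', (δ + 𝔼 u, ∑ ξ ∈ Mj,
      ‖hat (Dl d2 (Dl d1 (h u))) (φ u d1 d2' + φ u d1' d2 - φ u d1' d2' + ξ)‖) := by
    intro d2 d2'
    set F2 : U × P × ZMod n → ZMod n → ℂ := fun i d1 => conj (Φ i.1 d1 d2) * Φ i.1 d1 d2' *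
      (hp i.1 i.2.1 (i.2.2 + d2 + d1) * conj (hp i.1 i.2.1 (i.2.2 + d2' + d1))) * e ((φ i.1 d1 d2 - φ i.1 d1 d2') * i.2.2) with hF2
    have e2 : 𝔼 i, F i d2 * conj (F i d2') = 𝔼 i : U × P × ZMod n, (conj (h i.1 (i.2.2 + d2)) * h i.1 (i.2.2 + d2')) * 𝔼 d1, F2 i d1 := by
      simp only [exp_prod, mul_expect]
      refine ec fun u => ec fun p => ec fun x => ec fun d1 => ?_
      simp only [hF, hF2, map_mul, Complex.conj_conj]
      rw [sub_mul, e_sub]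
      ring
    rw [e2]
    refine (kill (fun i : U × P × ZMod n => conj (h i.1 (i.2.2 + d2)) * h i.1 (i.2.2 + d2')) F2 (fun i => ?_)).trans ?_
    · rw [norm_mul, RCLike.norm_conj]; exact mul_le_one₀ (h1 _ _) (norm_nonneg _) (h1 _ _)
    refine exp_mono fun d1 => exp_mono fun d1' => ?_
    have e3 : 𝔼 i, F2 i d1 * conj (F2 i d1') = 𝔼 u, 𝔼 p, 𝔼 x, (conj (Φ u d1 d2) * (Φ u d1 d2' * Φ u d1' d2 * conj (Φ u d1' d2'))) *
        (hp u p (x + (d2 + d1)) * conj (hp u p (x + (d2' + d1))) * conj (hp u p (x + (d2 + d1'))) * hp u p (x + (d2' + d1'))) *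
        e ((φ u d1 d2 - (φ u d1 d2' + φ u d1' d2 - φ u d1' d2')) * x) := by
      simp only [exp_prod]
      refine ec fun u => ec fun p => ec fun x => ?_
      simp only [hF2, map_mul, Complex.conj_conj]
      rw [show (φ u d1 d2 - (φ u d1 d2' + φ u d1' d2 - φ u d1' d2')) * x = (φ u d1 d2 - φ u d1 d2') * x - (φ u d1' d2 - φ u d1' d2') * x by ring, e_sub]
      simp only [← add_assoc]
      ring
    rw [e3]
    have hq : ∀ u, ‖Φ u d1 d2' * Φ u d1' d2 * conj (Φ u d1' d2')‖ ≤ 1 := by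
      intro u
      rw [norm_mul, norm_mul, RCLike.norm_conj]
      exact mul_le_one₀ (mul_le_one₀ (hΦ1 _ _ _) (norm_nonneg _) (hΦ1 _ _ _)) (norm_nonneg _) (hΦ1 _ _ _)
    refine (hBE _ _ _ _ _ _ (fun u => ?_)).trans ?_
    · rw [norm_mul, RCLike.norm_conj]; exact mul_le_one₀ (hΦ1 _ _ _) (norm_nonneg _) (hq u)
    · refine add_le_add le_rfl (exp_mono fun u => ?_)
      refine le_trans ?_ (ind_sum Mj (φ u d1 d2) (φ u d1 d2' + φ u d1' d2 - φ u d1' d2') (fun ξ => ‖hat (Dl d2 (Dl d1 (h u))) ξ‖) (fun _ => norm_nonneg _))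
      refine mul_le_mul_of_nonneg_right ?_ (by positivity)
      rw [norm_mul, RCLike.norm_conj]
      exact mul_le_of_le_one_right (norm_nonneg _) (hq u)
  have k3 : ∀ d2' d1', 𝔼 d1, 𝔼 d2, (δ + 𝔼 u, ∑ ξ ∈ Mj,
      ‖hat (Dl d2 (Dl d1 (h u))) (φ u d1 d2' + φ u d1' d2 - φ u d1' d2' + ξ)‖) ≤ δ + Mj.card * Y := by
    intro d2' d1'
    have w : 𝔼 d1, 𝔼 d2, (δ + 𝔼 u, ∑ ξ ∈ Mj,
      ‖hat (Dl d2 (Dl d1 (h u))) (φ u d1 d2' + φ u d1' d2 - φ u d1' d2' + ξ)‖) =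
        δ + 𝔼 u, ∑ ξ ∈ Mj, 𝔼 d1, 𝔼 d2, ‖hat (Dl d2 (Dl d1 (h u))) (φ u d1 d2' + (φ u d1' d2 - φ u d1' d2' + ξ))‖ := by
      simp only [expect_add_distrib, Fintype.expect_const]
      congr 1
      have w1 : ∀ d1, 𝔼 d2, 𝔼 u, ∑ ξ ∈ Mj, ‖hat (Dl d2 (Dl d1 (h u))) (φ u d1 d2' + φ u d1' d2 - φ u d1' d2' + ξ)‖ =
          𝔼 u, ∑ ξ ∈ Mj, 𝔼 d2, ‖hat (Dl d2 (Dl d1 (h u))) (φ u d1 d2' + (φ u d1' d2 - φ u d1' d2' + ξ))‖ := by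
        intro d1
        rw [exp_commR]
        refine ec fun u => ?_
        rw [Finset.expect_sum_comm]
        simp only [add_assoc, add_sub_assoc]
      simp only [w1]
      rw [exp_commR]
      refine ec fun u => ?_
      rw [Finset.expect_sum_comm]
    rw [w, hY, mul_expect]
    refine add_le_add le_rfl (exp_mono fun u => ?_)
    rw [← nsmul_eq_mul]
    exact Finset.sum_le_card_nsmul _ _ _ fun ξ _ => hα u ⟨fun d1 => φ u d1 d2', fun d2 => φ u d1' d2 - φ u d1' d2' + ξ⟩
  generalize hB : δ + Mj.card * Y = B at k3 ⊢
  generalize hZ : (fun d1 d1' d2 d2' => δ + 𝔼 u, ∑ ξ ∈ Mj,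
      ‖hat (Dl d2 (Dl d1 (h u))) (φ u d1 d2' + φ u d1' d2 - φ u d1' d2' + ξ)‖) = Z
  have k2' : ∀ d2 d2', ‖𝔼 i, F i d2 * conj (F i d2')‖^2 ≤ 𝔼 d1, 𝔼 d1', Z d1 d1' d2 d2' := by
    intro d2 d2'; rw [← hZ]; exact k2 d2 d2'
  have k3' : ∀ d2' d1', 𝔼 d1, 𝔼 d2, Z d1 d1' d2 d2' ≤ B := by
    intro d2' d1'; rw [← hZ]; exact k3 d2' d1'
  calc (𝔼 u, G 3 (h u))^4 ≤ (𝔼 u, 𝔼 d1, 𝔼 d2, ‖Φ u d1 d2‖^2)^4 := pow_le_pow_left₀ hX0 hX 4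
    _ = ((𝔼 u, 𝔼 d1, 𝔼 d2, ‖Φ u d1 d2‖^2)^2)^2 := by ring
    _ ≤ (𝔼 d2, 𝔼 d2', ‖𝔼 i, F i d2 * conj (F i d2')‖)^2 := pow_le_pow_left₀ (by positivity) k1 2
    _ ≤ 𝔼 d2, 𝔼 d2', ‖𝔼 i, F i d2 * conj (F i d2')‖^2 := (exp_sq_le _).trans (exp_mono fun d1 => exp_sq_le _)
    _ ≤ 𝔼 d2, 𝔼 d2', 𝔼 d1, 𝔼 d1', Z d1 d1' d2 d2' := exp_mono fun d2 => exp_mono fun d2' => k2' d2 d2'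
    _ ≤ B := swap4 Z B k3'

end DL
end NR

namespace NR

section DD
set_option linter.unusedSectionVars false
variable {n : ℕ} [NeZero n] {M : ℕ}

def sq (n : ℕ) (w : ℤ) (t : T3 M) (v u : Fin M) : ZMod n := (((Vt w t v - ((u:ℕ):ℤ))^2 : ℤ) : ZMod n)

noncomputable def dF (w : ℤ) (f0 : ZMod n → Fin M → ℂ) (f1 : ZMod n → ℤ → ℂ) (u : Fin M) (x : ZMod n) : ℂ :=
  𝔼 t : T3 M, 𝔼 v : Fin M, f0 (x - sq n w t v u) u * f1 (x - sq n w t v u) (Vt w t v)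

lemma Tswap (w : ℤ) (f0 : ZMod n → Fin M → ℂ) (f1 : ZMod n → ℤ → ℂ) (f2 : Fin M → ZMod n → ℂ) :
    T w f0 f1 f2 = 𝔼 u, 𝔼 t : T3 M, 𝔼 v : Fin M, 𝔼 x, f0 (x - sq n w t v u) u * f1 (x - sq n w t v u) (Vt w t v) * f2 u x := by
  rw [T]
  have : ∀ t : T3 M, 𝔼 j, 𝔼 v, 𝔼 u, f0 j u * f1 j (Vt w t v) * f2 u (j + (((Vt w t v - ((u:ℕ):ℤ))^2 : ℤ) : ZMod n)) =
      𝔼 u, 𝔼 v : Fin M, 𝔼 x, f0 (x - sq n w t v u) u * f1 (x - sq n w t v u) (Vt w t v) * f2 u x := by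
    intro t
    rw [exp_comm]
    conv_rhs => rw [exp_comm]
    refine ec fun v => ?_
    rw [exp_comm]
    refine ec fun u => ?_
    refine shc (sq n w t v u) (fun j => ?_)
    rw [add_sub_cancel_right, sq]
  simp only [this]
  rw [exp_comm]

lemma TF (w : ℤ) (f0 : ZMod n → Fin M → ℂ) (f1 : ZMod n → ℤ → ℂ) (f2 : Fin M → ZMod n → ℂ) :
    T w f0 f1 f2 = 𝔼 u, 𝔼 x, dF w f0 f1 u x * f2 u x := by
  rw [Tswap]
  refine ec fun u => ?_
  simp only [dF, expect_mul]
  conv_rhs => rw [exp_comm]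
  refine ec fun t => ?_
  rw [exp_comm]

lemma dF_le {w : ℤ} {f0 : ZMod n → Fin M → ℂ} {f1 : ZMod n → ℤ → ℂ} (h0 : ∀ j u, ‖f0 j u‖ ≤ 1) (h1 : ∀ j V, ‖f1 j V‖ ≤ 1)
    (u : Fin M) (x : ZMod n) : ‖dF w f0 f1 u x‖ ≤ 1 :=
  nexp_le_one fun t => nexp_le_one fun v => by
    rw [norm_mul]; exact mul_le_one₀ (h0 _ _) (norm_nonneg _) (h1 _ _)

open Classical in
def BEp (n : ℕ) [NeZero n] (M : ℕ) (w : ℤ) (R : ℕ) (δ : ℝ) : Prop :=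
  ∀ (g0 : ZMod n → Fin M → ℂ) (g1 : ZMod n → ℤ → ℂ) (_ : ∀ j u, ‖g0 j u‖ ≤ 1) (_ : ∀ j V, ‖g1 j V‖ ≤ 1)
    (c : Fin M → ℂ) (_ : ∀ u, ‖c u‖ ≤ 1) (ψ : Fin M → ZMod n),
    ‖T w g0 g1 (fun u j => c u * e (ψ u * j))‖ ≤ δ + 𝔼 u, ‖c u‖ * (if ψ u ∈ Maj R then (1:ℝ) else 0)

lemma BEx : ∃ C : ℕ, 1 ≤ C ∧ ∀ {n : ℕ} [NeZero n] {M K : ℕ} (_ : n = 64 * M^2) (_ : 2 ≤ K) (_ : K^C ≤ M)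
    (w : ℤ) (_ : |w| ≤ 3 * M), BEp n M w (K^C) (1 / K) := by
  classical
  obtain ⟨C, hC, H⟩ := BE
  refine ⟨C, hC, ?_⟩
  intro n _ M K hn hK hM w hw g0 g1 hg0 hg1 c hc ψ
  have e1 : T w g0 g1 (fun u j => c u * e (ψ u * j)) =
      T w g0 g1 (fun u j => (if ψ u ∈ Maj (K^C) then 0 else c u) * e (ψ u * j)) +
      𝔼 u, 𝔼 x, dF w g0 g1 u x * ((if ψ u ∈ Maj (K^C) then c u else 0) * e (ψ u * x)) := by
    rw [TF, TF, ← expect_add_distrib]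
    refine ec fun u => ?_
    rw [← expect_add_distrib]
    refine ec fun x => ?_
    split_ifs <;> ring
  rw [e1]
  refine (norm_add_le _ _).trans (add_le_add (H hn hK hM w hw g0 g1 hg0 hg1 _ (fun u => ?_) ψ (fun u hu => if_pos hu)) ?_)
  · split_ifs
    · simp
    · exact hc u
  · refine (nexp_le _).trans (exp_mono fun u => (nexp_le _).trans ?_)
    refine expect_le univ_nonempty (fun x _ => ?_)
    rw [norm_mul, norm_mul, norm_e, mul_one]
    refine (mul_le_of_le_one_left (norm_nonneg _) (dF_le hg0 hg1 u x)).trans (le_of_eq ?_)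
    split_ifs <;> simp

open Classical in
lemma BEq {ι : Type*} [Fintype ι] [Nonempty ι] {w : ℤ} {R : ℕ} {δ : ℝ} (H : BEp n M w R δ) (g0 : ι → ZMod n → Fin M → ℂ) (g1 : ι → ZMod n → ℤ → ℂ)
    (h0 : ∀ q j u, ‖g0 q j u‖ ≤ 1) (h1 : ∀ q j V, ‖g1 q j V‖ ≤ 1)
    (c : Fin M → ℂ) (hc : ∀ u, ‖c u‖ ≤ 1) (ψ : Fin M → ZMod n) :
    ‖𝔼 u, 𝔼 p : ι × T3 M × Fin M, 𝔼 x, c u * (g0 p.1 (x - sq n w p.2.1 p.2.2 u) u * g1 p.1 (x - sq n w p.2.1 p.2.2 u) (Vt w p.2.1 p.2.2)) * e (ψ u * x)‖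
      ≤ δ + 𝔼 u, ‖c u‖ * (if ψ u ∈ Maj R then (1:ℝ) else 0) := by
  have e1 : 𝔼 u, 𝔼 p : ι × T3 M × Fin M, 𝔼 x, c u * (g0 p.1 (x - sq n w p.2.1 p.2.2 u) u * g1 p.1 (x - sq n w p.2.1 p.2.2 u) (Vt w p.2.1 p.2.2)) * e (ψ u * x)
     = 𝔼 q, T w (g0 q) (g1 q) (fun u j => c u * e (ψ u * j)) := by
    simp only [exp_prod, Tswap]
    rw [exp_comm]
    refine ec fun q => ec fun u => ec fun _ =>
      ec fun _ => ec fun _ => ec fun v => ec fun x => ?_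
    ring
  rw [e1]
  refine (nexp_le _).trans (el fun q => H _ _ (h0 q) (h1 q) c hc ψ)

section chain
variable {ι : Type*} [Fintype ι] [Nonempty ι] {w : ℤ} {R : ℕ} {δ : ℝ}

noncomputable def hpF (w : ℤ) (a : ι → ZMod n → Fin M → ℂ) (b : ι → ZMod n → ℤ → ℂ) (u : Fin M) (p : ι × T3 M × Fin M) (x : ZMod n) : ℂ :=
  a p.1 (x - sq n w p.2.1 p.2.2 u) u * b p.1 (x - sq n w p.2.1 p.2.2 u) (Vt w p.2.1 p.2.2)

noncomputable def hF (w : ℤ) (a : ι → ZMod n → Fin M → ℂ) (b : ι → ZMod n → ℤ → ℂ) (u : Fin M) (x : ZMod n) : ℂ :=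
  𝔼 p, hpF w a b u p x

variable (a : ι → ZMod n → Fin M → ℂ) (b : ι → ZMod n → ℤ → ℂ)

lemma hF_le (ha : ∀ q j u, ‖a q j u‖ ≤ 1) (hb : ∀ q j V, ‖b q j V‖ ≤ 1) (u : Fin M) (x : ZMod n) : ‖hF w a b u x‖ ≤ 1 :=
  nexp_le_one fun p => by
    rw [hpF, norm_mul]; exact mul_le_one₀ (ha _ _ _) (norm_nonneg _) (hb _ _ _)

lemma ch3 (ha : ∀ q j u, ‖a q j u‖ ≤ 1) (hb : ∀ q j V, ‖b q j V‖ ≤ 1) [NeZero M] (H : BEp n M w R δ) :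
    ∃ Y : ℝ, 0 ≤ Y ∧ (𝔼 u, G 2 (hF w a b u))^2 ≤ δ + (Maj (n := n) R).card * Y ∧ Y^2 ≤ 𝔼 u, G 1 (hF w a b u) := by
  refine DL3 (hF w a b) (hpF w a b) (fun u x => rfl) (hF_le a b ha hb) (Maj R) δ ?_
  intro d d' c ψ hc
  have := BEq H (fun q j u => conj (a q (j + d) u) * a q (j + d') u) (fun q j V => conj (b q (j + d) V) * b q (j + d') V)
    (fun q j u => by rw [norm_mul, RCLike.norm_conj]; exact mul_le_one₀ (ha _ _ _) (norm_nonneg _) (ha _ _ _))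
    (fun q j u => by rw [norm_mul, RCLike.norm_conj]; exact mul_le_one₀ (hb _ _ _) (norm_nonneg _) (hb _ _ _)) c hc ψ
  have w1 : ∀ u, ∀ p : ι × T3 M × Fin M, ∀ x : ZMod n, conj (hpF w a b u p (x + d)) * hpF w a b u p (x + d') =
      (fun q j u => conj (a q (j + d) u) * a q (j + d') u) p.1 (x - sq n w p.2.1 p.2.2 u) u *
      (fun q j V => conj (b q (j + d) V) * b q (j + d') V) p.1 (x - sq n w p.2.1 p.2.2 u) (Vt w p.2.1 p.2.2) := by
    intro u p x
    simp only [hpF, map_mul, add_sub_right_comm]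
    ring
  simp only [w1]
  exact this

lemma ch4 (ha : ∀ q j u, ‖a q j u‖ ≤ 1) (hb : ∀ q j V, ‖b q j V‖ ≤ 1) [NeZero M] (H : BEp n M w R δ) :
    ∃ Y : ℝ, 0 ≤ Y ∧ (𝔼 u, G 3 (hF w a b u))^4 ≤ δ + (Maj (n := n) R).card * Y ∧ Y^8 ≤ 𝔼 u, G 2 (hF w a b u) := by
  refine DL4 (hF w a b) (hpF w a b) (fun u x => rfl) (hF_le a b ha hb) (Maj R) δ ?_
  intro s1 s2 s3 s4 c ψ hc
  have m4 : ∀ z1 z2 z3 z4 : ℂ, ‖z1‖ ≤ 1 → ‖z2‖ ≤ 1 → ‖z3‖ ≤ 1 → ‖z4‖ ≤ 1 → ‖z1 * conj z2 * conj z3 * z4‖ ≤ 1 := by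
    intro z1 z2 z3 z4 h1 h2 h3 h4
    rw [norm_mul, norm_mul, norm_mul, RCLike.norm_conj, RCLike.norm_conj]
    exact mul_le_one₀ (mul_le_one₀ (mul_le_one₀ h1 (norm_nonneg _) h2) (norm_nonneg _) h3) (norm_nonneg _) h4
  have := BEq H (fun q j u => a q (j + s1) u * conj (a q (j + s2) u) * conj (a q (j + s3) u) * a q (j + s4) u)
    (fun q j u => b q (j + s1) u * conj (b q (j + s2) u) * conj (b q (j + s3) u) * b q (j + s4) u)
    (fun q j u => m4 _ _ _ _ (ha _ _ _) (ha _ _ _) (ha _ _ _) (ha _ _ _))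
    (fun q j u => m4 _ _ _ _ (hb _ _ _) (hb _ _ _) (hb _ _ _) (hb _ _ _)) c hc ψ
  have w1 : ∀ u, ∀ p : ι × T3 M × Fin M, ∀ x : ZMod n, hpF w a b u p (x + s1) * conj (hpF w a b u p (x + s2)) * conj (hpF w a b u p (x + s3)) * hpF w a b u p (x + s4) =
      (fun q j u => a q (j + s1) u * conj (a q (j + s2) u) * conj (a q (j + s3) u) * a q (j + s4) u) p.1 (x - sq n w p.2.1 p.2.2 u) u *
      (fun q j u => b q (j + s1) u * conj (b q (j + s2) u) * conj (b q (j + s3) u) * b q (j + s4) u) p.1 (x - sq n w p.2.1 p.2.2 u) (Vt w p.2.1 p.2.2) := by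
    intro u p x
    simp only [hpF, map_mul, add_sub_right_comm]
    ring
  simp only [w1]
  exact this

open Classical in
lemma ch0 (ha : ∀ q j u, ‖a q j u‖ ≤ 1) (hb : ∀ q j V, ‖b q j V‖ ≤ 1) [NeZero M] (H : BEp n M w R δ) :
    ∃ φ : Fin M → ZMod n, 𝔼 u, G 1 (hF w a b u) ≤ δ + 𝔼 u, ‖hat (hF w a b u) (φ u)‖ * (if φ u ∈ Maj R then (1:ℝ) else 0) := by
  choose φ hφ using fun u => G_one_le (hF_le (w := w) a b ha hb u)
  refine ⟨φ, (exp_mono hφ).trans ?_⟩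
  have h0 : 0 ≤ 𝔼 u, ‖hat (hF w a b u) (φ u)‖^2 := exp_nonneg fun _ => by positivity
  have := BEq H a b ha hb (fun u => conj (hat (hF w a b u) (φ u))) (fun u => by
    rw [RCLike.norm_conj]; exact hat_le_one (hF_le a b ha hb u) _) φ
  have e1 : ((𝔼 u, ‖hat (hF w a b u) (φ u)‖^2 : ℝ):ℂ) = 𝔼 u, 𝔼 p, 𝔼 x, conj (hat (hF w a b u) (φ u)) * hpF w a b u p x * e (φ u * x) := by
    rw [ofReal_exp]
    refine ec fun u => ?_
    rw [nsq]
    generalize hc : conj (hat (hF w a b u) (φ u)) = c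
    rw [hat, expect_mul, exp_comm]
    refine ec fun x => ?_
    rw [hF, expect_mul, expect_mul]
    refine ec fun p => ?_
    ring
  simp only [RCLike.norm_conj] at this
  rw [← norm_real h0, e1]
  exact this

end chain
end DD
end NR

namespace NR

section kap
set_option linter.unusedSectionVars false
variable {n : ℕ} [NeZero n] {κ : Type*} [Fintype κ] [Nonempty κ]

noncomputable def kap {E : Type*} [AddCommMonoid E] [Module ℚ≥0 E] (z : κ → ZMod n) (g : ZMod n → E) (x : ZMod n) : E :=
  𝔼 a, 𝔼 a', g (x + z a - z a')

lemma re_exp {ι : Type*} [Fintype ι] (f : ι → ℂ) : (𝔼 i, f i).re = 𝔼 i, (f i).re := by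
  rw [Fintype.expect_eq_sum_div_card, Fintype.expect_eq_sum_div_card, Complex.div_natCast_re, Complex.re_sum]

lemma kap_symm (z : κ → ZMod n) (F g : ZMod n → ℂ) : 𝔼 x, F x * kap z g x = 𝔼 x, kap z F x * g x := by
  simp only [kap, mul_expect, expect_mul]
  rw [exp_comm]
  conv_rhs => rw [exp_comm]
  have h1 : ∀ a, 𝔼 x, 𝔼 a', F x * g (x + z a - z a') = 𝔼 a', 𝔼 x, F x * g (x + z a - z a') := fun a => exp_comm _
  have h2 : ∀ a, 𝔼 x, 𝔼 a', F (x + z a - z a') * g x = 𝔼 a', 𝔼 x, F (x + z a - z a') * g x := fun a => exp_comm _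
  simp only [h1, h2]
  rw [exp_comm]
  refine ec fun a => ec fun a' => ?_
  refine shc (z a' - z a) fun j => ?_
  rw [show j + (z a' - z a) + z a - z a' = j by ring, show j + z a' - z a = j + (z a' - z a) by ring]

lemma kap_P (z : κ → ZMod n) (F : ZMod n → ℂ) : ((𝔼 x, ‖𝔼 a, F (x + z a)‖^2 : ℝ) : ℂ) = 𝔼 x, F x * conj (kap z F x) := by
  rw [expsq_eq (fun x a => F (x + z a))]
  simp only [kap, conj_exp, mul_expect]
  conv_rhs => rw [exp_comm]
  have h1 : ∀ a, 𝔼 x, 𝔼 a', F x * conj (F (x + z a - z a')) = 𝔼 a', 𝔼 x, F x * conj (F (x + z a - z a')) := fun a => exp_comm _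
  simp only [h1]
  rw [exp_comm]
  refine ec fun a => ec fun a' => ?_
  refine shc (z a') fun j => ?_
  rw [show j + z a' + z a - z a' = j + z a by ring]

lemma kap_le (z : κ → ZMod n) (F : ZMod n → ℂ) : 𝔼 x, ‖kap z F x‖^2 ≤ 𝔼 x, ‖𝔼 a, F (x + z a)‖^2 := by
  have h1 : ∀ x, ‖kap z F x‖^2 ≤ 𝔼 a', ‖𝔼 a, F (x + -z a' + z a)‖^2 := by
    intro x
    have : kap z F x = 𝔼 a', 𝔼 a, F (x + -z a' + z a) := by
      rw [kap, exp_comm]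
      refine ec fun a => ec fun a' => ?_
      congr 1; ring
    rw [this]
    exact nexp_pow_le _ 1
  refine (exp_mono h1).trans ?_
  rw [exp_commR]
  refine el fun a' => ?_
  exact (shiftR (-z a') (fun x => ‖𝔼 a, F (x + z a)‖^2)).le

lemma kap_E (z : κ → ZMod n) (F : ZMod n → ℂ) :
    𝔼 x, ‖F x - kap z F x‖^2 ≤ (𝔼 x, F x * conj (F x - kap z F x)).re := by
  have h1 := kap_P z F
  have h2 := kap_le z F
  have h3 : 𝔼 x, ‖F x - kap z F x‖^2 = 𝔼 x, ‖F x‖^2 + 𝔼 x, ‖kap z F x‖^2 - 2 * (𝔼 x, F x * conj (kap z F x)).re := by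
    rw [re_exp, mul_expect, ← expect_add_distrib, ← expect_sub_distrib]
    refine ec fun x => ?_
    rw [← Complex.normSq_eq_norm_sq, ← Complex.normSq_eq_norm_sq, ← Complex.normSq_eq_norm_sq, Complex.normSq_sub]
  have h4 : (𝔼 x, F x * conj (F x - kap z F x)).re = 𝔼 x, ‖F x‖^2 - (𝔼 x, F x * conj (kap z F x)).re := by
    rw [re_exp, re_exp, ← expect_sub_distrib]
    refine ec fun x => ?_
    rw [map_sub, mul_sub, ← nsq, Complex.sub_re, Complex.ofReal_re]
  rw [← h1, Complex.ofReal_re] at h3 h4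
  rw [h3, h4]
  linarith

lemma hat_kap (z : κ → ZMod n) (F : ZMod n → ℂ) (φ : ZMod n) :
    hat (fun x => F x - kap z F x) φ = hat F φ * 𝔼 a, 𝔼 a', (1 - e (φ * (z a' - z a))) := by
  have : hat (fun x => kap z F x) φ = hat F φ * 𝔼 a, 𝔼 a', e (φ * (z a' - z a)) := by
    simp only [hat, kap, expect_mul, mul_expect]
    refine Finset.expect_comm _ _ _ |>.trans ?_
    refine ec fun a => ?_
    rw [exp_comm]
    refine ec fun a' => ?_
    refine shc (z a - z a') fun j => ?_
    rw [mul_assoc, ← e_add]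
    congr 2 <;> ring
  have h2 : 𝔼 a, 𝔼 a', (1 - e (φ * (z a' - z a))) = 1 - 𝔼 a, 𝔼 a', e (φ * (z a' - z a)) := by
    simp only [expect_sub_distrib, Fintype.expect_const]
  rw [h2, mul_sub, mul_one, ← this]
  simp only [hat, sub_mul, expect_sub_distrib]

lemma hat_kap_le (z : κ → ZMod n) {F : ZMod n → ℂ} (h : ∀ x, ‖F x‖ ≤ 1) (φ : ZMod n) (B : ℝ)
    (hB : ∀ a a', ‖e (φ * (z a' - z a)) - 1‖ ≤ B) : ‖hat (fun x => F x - kap z F x) φ‖ ≤ B := by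
  rw [hat_kap, norm_mul]
  refine (mul_le_of_le_one_left (norm_nonneg _) (hat_le_one h φ)).trans ?_
  refine (nexp_le _).trans (el fun a => ?_)
  refine (nexp_le _).trans (el fun a' => ?_)
  rw [norm_sub_rev]; exact hB a a'

lemma maj_phase {R S ℓ : ℕ} (hS : ∀ r, 1 ≤ r → r ≤ R → r ∣ S) {φ : ZMod n} (hφ : φ ∈ Maj R) (a a' : Fin ℓ) :
    ‖e (φ * (((S * a' : ℕ) : ZMod n) - ((S * a : ℕ) : ZMod n))) - 1‖ ≤ 7 * (S * ℓ * R) / n := by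
  obtain ⟨r, h1, h2, h3⟩ := mem_Maj.1 hφ
  obtain ⟨k, hk⟩ := hS r h1 h2
  refine (e_sub_one_le _).trans ?_
  have : nrm (φ * (((S * a' : ℕ) : ZMod n) - ((S * a : ℕ) : ZMod n))) ≤ S * ℓ * R := by
    have e1 : φ * (((S * a' : ℕ) : ZMod n) - ((S * a : ℕ) : ZMod n)) = ((k * ((a':ℕ) - (a:ℕ) : ℤ) : ℤ) : ZMod n) * ((r : ZMod n) * φ) := by
      rw [hk]; push_cast; ring
    rw [e1]
    refine (nrm_int_mul _ _).trans ?_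
    have h4 : k ≤ S := by rw [hk]; exact Nat.le_mul_of_pos_left _ h1
    have h5 : (k * ((a':ℕ) - (a:ℕ) : ℤ) : ℤ).natAbs ≤ S * ℓ := by
      rw [Int.natAbs_mul, Int.natAbs_natCast]
      refine Nat.mul_le_mul h4 ?_
      have := a.2; have := a'.2; omega
    exact Nat.mul_le_mul h5 h3
  have h7 : (nrm (φ * (((S * a' : ℕ) : ZMod n) - ((S * a : ℕ) : ZMod n))) : ℝ) ≤ S * ℓ * R := by exact_mod_cast this
  gcongr
end kap

lemma num_step {L R a b : ℕ} (hL : 2 ≤ L) (hR : 2 ≤ R) {X X' Y : ℝ} {c : ℕ} (hc : c ≤ R * ((2 * R + 1) * R)) (hX : 1 ≤ L * X) (hY : 0 ≤ Y)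
    (h1 : X^a ≤ 1 / ((L^(a+1) : ℕ):ℝ) + c * Y) (h2 : Y^b ≤ X') : 1 ≤ (((L^(a+1) * R^5)^b : ℕ) : ℝ) * X' := by
  have hc' : c ≤ R^5 := by
    refine hc.trans ?_
    have h4 : 2 * 2 ≤ R * R := Nat.mul_le_mul hR hR
    calc R * ((2 * R + 1) * R) ≤ R * ((R * R * R) * R) := by
          gcongr
          nlinarith
      _ = R^5 := by ring
  have hLR : (2:ℝ) ≤ L := by exact_mod_cast hL
  have hRR : (0:ℝ) < R := by exact_mod_cast (by omega : 0 < R)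
  have hcR : (c:ℝ) ≤ R^5 := by exact_mod_cast hc'
  have h3 : 1 ≤ (L:ℝ)^a * X^a := by rw [← mul_pow]; exact one_le_pow₀ hX
  have hLp : (0:ℝ) < (L:ℝ)^a := by positivity
  have h5 : 1 ≤ (L:ℝ)^(a+1) * R^5 * Y := by
    have h6 : (L:ℝ)^(a+1) * X^a ≤ 1 + (L:ℝ)^(a+1) * (R^5 * Y) := by
      calc (L:ℝ)^(a+1) * X^a ≤ (L:ℝ)^(a+1) * (1 / ((L^(a+1) : ℕ):ℝ) + c * Y) := by gcongr
        _ = 1 + (L:ℝ)^(a+1) * (c * Y) := by push_cast; field_simp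
        _ ≤ _ := by gcongr
    have h7 : (2:ℝ) ≤ (L:ℝ)^(a+1) * X^a := by rw [pow_succ]; nlinarith
    linarith
  push_cast
  calc (1:ℝ) ≤ ((L:ℝ)^(a+1) * R^5 * Y)^b := one_le_pow₀ h5
    _ = ((L:ℝ)^(a+1) * R^5)^b * Y^b := by rw [mul_pow]
    _ ≤ _ := by gcongr

section D2
set_option linter.unusedSectionVars false
variable {n : ℕ} [NeZero n] {M : ℕ} {κ : Type*} [Fintype κ] [Nonempty κ]

noncomputable def sgq (q : Bool × κ × κ) : ℂ := if q.1 then -1 else 1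
noncomputable def shq (z : κ → ZMod n) (q : Bool × κ × κ) : ZMod n := if q.1 then z q.2.1 - z q.2.2 else 0
noncomputable def aq (z : κ → ZMod n) (f0 : ZMod n → Fin M → ℂ) (q : Bool × κ × κ) (j : ZMod n) (u : Fin M) : ℂ :=
  sgq q * conj (f0 (j + shq z q) u)
noncomputable def bq (z : κ → ZMod n) (f1 : ZMod n → ℤ → ℂ) (q : Bool × κ × κ) (j : ZMod n) (V : ℤ) : ℂ :=
  conj (f1 (j + shq z q) V)

lemma hF_q (w : ℤ) (z : κ → ZMod n) (f0 : ZMod n → Fin M → ℂ) (f1 : ZMod n → ℤ → ℂ) (u : Fin M) (x : ZMod n) :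
    hF w (aq z f0) (bq z f1) u x = 2⁻¹ * conj (dF w f0 f1 u x - kap z (dF w f0 f1 u) x) := by
  have h1 : ∀ q : Bool × κ × κ, 𝔼 p : T3 M × Fin M, hpF w (aq z f0) (bq z f1) u (q, p) x = sgq q * conj (dF w f0 f1 u (x + shq z q)) := by
    intro q
    rw [exp_prod (ι := T3 M), dF, conj_exp, mul_expect]
    refine ec fun t => ?_
    rw [conj_exp, mul_expect]
    refine ec fun v => ?_
    simp only [hpF, aq, bq, map_mul, add_sub_right_comm]
    ring
  rw [hF, exp_prod]
  simp only [h1]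
  rw [exp_prod, Fintype.expect_eq_sum_div_card, Fintype.sum_bool, Fintype.card_bool]
  have h2 : 𝔼 k : κ × κ, sgq (true, k) * conj (dF w f0 f1 u (x + shq z (true, k))) = - conj (kap z (dF w f0 f1 u) x) := by
    rw [exp_prod, kap, conj_exp, ← Finset.expect_neg_distrib]
    refine ec fun a => ?_
    rw [conj_exp, ← Finset.expect_neg_distrib]
    refine ec fun a' => ?_
    simp [sgq, shq, add_sub_assoc]
  have h3 : 𝔼 k : κ × κ, sgq (false, k) * conj (dF w f0 f1 u (x + shq z (false, k))) = conj (dF w f0 f1 u x) := by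
    simp [sgq, shq]
  rw [h2, h3, map_sub]
  push_cast
  ring

lemma T_lower [NeZero M] (w : ℤ) (z : κ → ZMod n) (f0 : ZMod n → Fin M → ℂ) (f1 : ZMod n → ℤ → ℂ) (f2 : Fin M → ZMod n → ℂ)
    (h2 : ∀ u j, ‖f2 u j‖ ≤ 1) :
    ‖T w f0 f1 (fun u x => f2 u x - kap z (f2 u) x)‖^2 ≤ 2 * ‖T w f0 f1 (hF w (aq z f0) (bq z f1))‖ := by
  have e1 : T w f0 f1 (fun u x => f2 u x - kap z (f2 u) x) = 𝔼 u, 𝔼 x, f2 u x * (dF w f0 f1 u x - kap z (dF w f0 f1 u) x) := by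
    rw [TF]
    refine ec fun u => ?_
    simp only [mul_sub, expect_sub_distrib, kap_symm]
    congr 1
    · exact ec fun x => mul_comm _ _
    · rw [← kap_symm]; exact ec fun x => mul_comm _ _
  have e2 : T w f0 f1 (hF w (aq z f0) (bq z f1)) = 2⁻¹ * 𝔼 u, 𝔼 x, dF w f0 f1 u x * conj (dF w f0 f1 u x - kap z (dF w f0 f1 u) x) := by
    rw [TF, mul_expect]
    refine ec fun u => ?_
    rw [mul_expect]
    refine ec fun x => ?_
    rw [hF_q]; ring
  have h3 : ‖T w f0 f1 (fun u x => f2 u x - kap z (f2 u) x)‖^2 ≤ 𝔼 u, 𝔼 x, ‖dF w f0 f1 u x - kap z (dF w f0 f1 u) x‖^2 := by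
    rw [e1]
    exact (nexp_pow_le _ 1).trans (exp_mono fun u => cs_kill _ _ fun x => h2 u x)
  have h4 : 𝔼 u, 𝔼 x, ‖dF w f0 f1 u x - kap z (dF w f0 f1 u) x‖^2 ≤ (𝔼 u, 𝔼 x, dF w f0 f1 u x * conj (dF w f0 f1 u x - kap z (dF w f0 f1 u) x)).re := by
    rw [re_exp]
    exact exp_mono fun u => kap_E z _
  have h5 := Complex.re_le_norm (𝔼 u, 𝔼 x, dF w f0 f1 u x * conj (dF w f0 f1 u x - kap z (dF w f0 f1 u) x))
  rw [e2, norm_mul]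
  have : ‖(2⁻¹:ℂ)‖ = 2⁻¹ := by simp
  rw [this]
  linarith

lemma aq_le {z : κ → ZMod n} {f0 : ZMod n → Fin M → ℂ} (h0 : ∀ j u, ‖f0 j u‖ ≤ 1) (q : Bool × κ × κ) (j : ZMod n) (u : Fin M) :
    ‖aq z f0 q j u‖ ≤ 1 := by
  rw [aq, norm_mul, RCLike.norm_conj]
  refine mul_le_one₀ ?_ (norm_nonneg _) (h0 _ _)
  rw [sgq]; split_ifs <;> simp

lemma bq_le {z : κ → ZMod n} {f1 : ZMod n → ℤ → ℂ} (h0 : ∀ j u, ‖f1 j u‖ ≤ 1) (q : Bool × κ × κ) (j : ZMod n) (u : ℤ) :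
    ‖bq z f1 q j u‖ ≤ 1 := by
  rw [bq, RCLike.norm_conj]; exact h0 _ _

lemma hF_hat (w : ℤ) (z : κ → ZMod n) {f0 : ZMod n → Fin M → ℂ} {f1 : ZMod n → ℤ → ℂ} (h0 : ∀ j u, ‖f0 j u‖ ≤ 1) (h1 : ∀ j V, ‖f1 j V‖ ≤ 1)
    (u : Fin M) (φ : ZMod n) (B : ℝ) (hB : ∀ a a', ‖e (φ * (z a' - z a)) - 1‖ ≤ B) :
    ‖hat (hF w (aq z f0) (bq z f1) u) φ‖ ≤ B := by
  have h2 := hat_kap_le z (F := fun x => 2⁻¹ * conj (dF w f0 f1 u x)) (fun x => by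
    rw [norm_mul, RCLike.norm_conj]
    have := dF_le (w := w) h0 h1 u x
    have h3 : ‖(2⁻¹:ℂ)‖ = 2⁻¹ := by simp
    rw [h3]; linarith) φ B hB
  have e1 : (fun x => 2⁻¹ * conj (dF w f0 f1 u x) - kap z (fun x => 2⁻¹ * conj (dF w f0 f1 u x)) x) = hF w (aq z f0) (bq z f1) u := by
    funext x
    rw [hF_q, kap, kap]
    simp only [← mul_expect, map_sub, conj_exp]
    ring
  rwa [e1] at h2
end D2

lemma Thm2D : ∃ C : ℕ, 1 ≤ C ∧ ∀ {n : ℕ} [NeZero n] {M K S ℓ : ℕ} (_ : n = 64 * M^2) (_ : 2 ≤ K) (_ : K^C ≤ M)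
    (_ : 1 ≤ ℓ) (_ : ∀ r, 1 ≤ r → r ≤ K^C → r ∣ S) (_ : K^C * (S * ℓ) ≤ M^2)
    (w : ℤ) (_ : |w| ≤ 3 * M) (f0 : ZMod n → Fin M → ℂ) (f1 : ZMod n → ℤ → ℂ) (f2 : Fin M → ZMod n → ℂ)
    (_ : ∀ j u, ‖f0 j u‖ ≤ 1) (_ : ∀ j V, ‖f1 j V‖ ≤ 1) (_ : ∀ u j, ‖f2 u j‖ ≤ 1),
    ‖T w f0 f1 (fun u x => f2 u x - kap (fun a : Fin ℓ => ((S * a : ℕ) : ZMod n)) (f2 u) x)‖ ≤ 1 / K := by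
  classical
  obtain ⟨C1, hC1, HM⟩ := Main1
  obtain ⟨C2, hC2, HB⟩ := BEx
  obtain ⟨c0, hc0⟩ : ∃ c, c = 101 := ⟨_, rfl⟩
  obtain ⟨c3, hc3⟩ : ∃ c, c = c0 * (C1 + 1) := ⟨_, rfl⟩
  obtain ⟨r3, hr3⟩ : ∃ c, c = c3 * 5 * C2 := ⟨_, rfl⟩
  obtain ⟨c2, hc2⟩ : ∃ c, c = (c3 * 5 + r3 * 5) * 8 := ⟨_, rfl⟩
  obtain ⟨r2, hr2⟩ : ∃ c, c = c2 * 3 * C2 := ⟨_, rfl⟩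
  obtain ⟨c1, hc1⟩ : ∃ c, c = (c2 * 3 + r2 * 5) * 2 := ⟨_, rfl⟩
  obtain ⟨r1, hr1⟩ : ∃ c, c = c1 * 2 * C2 := ⟨_, rfl⟩
  have p0 : 1 ≤ c0 := by omega
  have p3 : 1 ≤ c3 := by rw [hc3]; exact Nat.mul_pos p0 (by omega)
  have q3 : 1 ≤ r3 := by rw [hr3]; exact Nat.mul_pos (by omega) hC2
  have p2 : 1 ≤ c2 := by omega
  have q2 : 1 ≤ r2 := by rw [hr2]; exact Nat.mul_pos (by omega) hC2
  have p1 : 1 ≤ c1 := by omega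
  have q1 : 1 ≤ r1 := by rw [hr1]; exact Nat.mul_pos (by omega) hC2
  obtain ⟨C, hC⟩ : ∃ c, c = c0 * C1 + r3 + r2 + (r1 + 3 * c1) := ⟨_, rfl⟩
  refine ⟨C, by omega, ?_⟩
  intro n _ M K S ℓ hn hK hM hℓ hS hSl w hw f0 f1 f2 h0 h1 h2
  have hK0 : 0 < K := by omega
  have hKp : ∀ a b : ℕ, a ≤ b → K^a ≤ K^b := fun a b hab => Nat.pow_le_pow_right hK0 hab
  have hK2 : ∀ a : ℕ, 1 ≤ a → 2 ≤ K^a := fun a ha => hK.trans (by simpa using hKp 1 a ha)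
  have hM0 : 0 < M := lt_of_lt_of_le (by positivity) hM
  have : NeZero M := ⟨by omega⟩
  have : Nonempty (Fin ℓ) := ⟨⟨0, hℓ⟩⟩
  have hKR : (2:ℝ) ≤ K := by exact_mod_cast hK
  have hKR0 : (0:ℝ) < K := by linarith
  by_contra hcon
  push Not at hcon
  obtain ⟨z, hz⟩ : ∃ z : Fin ℓ → ZMod n, z = fun a : Fin ℓ => ((S * a : ℕ) : ZMod n) := ⟨_, rfl⟩
  rw [← hz] at hcon
  have ha := aq_le (z := z) h0
  have hb := bq_le (z := z) h1
  have hh := hF_le (w := w) _ _ ha hb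
  have hT := T_lower w z f0 f1 f2 h2
  have hL := L1' (by omega) w f0 f1 (hF w (aq z f0) (bq z f1)) h0 h1 hh
  have hph : ∀ (φ : ZMod n) (B : ℝ), (∀ a a', ‖e (φ * (z a' - z a)) - 1‖ ≤ B) → ∀ u, ‖hat (hF w (aq z f0) (bq z f1) u) φ‖ ≤ B :=
    fun φ B hB u => hF_hat w z h0 h1 u φ B hB
  generalize aq z f0 = a at *
  generalize bq z f1 = b at *
  have t1 : 1 ≤ (K:ℝ)^3 * ‖T w f0 f1 (hF w a b)‖ := by
    have s1 : 1 / (K:ℝ)^2 ≤ 2 * ‖T w f0 f1 (hF w a b)‖ := by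
      refine le_trans ?_ hT
      rw [← one_div_pow]; exact pow_le_pow_left₀ (by positivity) hcon.le 2
    rw [div_le_iff₀ (by positivity)] at s1
    nlinarith [norm_nonneg (T w f0 f1 (hF w a b)), sq_nonneg (K:ℝ), mul_nonneg (norm_nonneg (T w f0 f1 (hF w a b))) (sq_nonneg (K:ℝ))]
  have t2 : 1 ≤ (K:ℝ)^100 * 𝔼 u, tri M (hF w a b u) := by
    have s0 : 0 ≤ 𝔼 u, tri M (hF w a b u) := exp_nonneg fun u => tri_nonneg _
    calc (1:ℝ) ≤ ((K:ℝ)^3 * ‖T w f0 f1 (hF w a b)‖)^32 := one_le_pow₀ t1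
      _ = (K:ℝ)^96 * ‖T w f0 f1 (hF w a b)‖^32 := by rw [mul_pow, ← pow_mul]
      _ ≤ (K:ℝ)^96 * (9 * 𝔼 u, tri M (hF w a b u)) := by gcongr
      _ ≤ (K:ℝ)^96 * (K^4 * 𝔼 u, tri M (hF w a b u)) := by
          gcongr
          calc (9:ℝ) ≤ 2^4 := by norm_num
            _ ≤ (K:ℝ)^4 := by gcongr
      _ = (K:ℝ)^100 * 𝔼 u, tri M (hF w a b u) := by rw [← mul_assoc, ← pow_add]
  have hK' : (K:ℝ)^c0 = K * K^100 := by rw [hc0, pow_succ]; ring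
  have t3 : 1 ≤ ((K^c3:ℕ):ℝ) * 𝔼 u, G 3 (hF w a b u) := by
    have s1 : ∀ u, tri M (hF w a b u) ≤ 1 / (K:ℝ)^c0 + ((K^c0:ℕ):ℝ)^C1 * G 3 (hF w a b u) := by
      intro u
      have g0 := G_nonneg 3 (hF w a b u)
      by_cases hu : 1 ≤ ((K^c0:ℕ):ℝ) * tri M (hF w a b u)
      · have := HM hn (hK2 c0 p0) (by rw [← pow_mul]; exact (hKp _ _ (by omega)).trans hM) _ (hh u) hu
        rw [Nat.cast_pow] at this
        have h1 := tri_le_one (M := M) (hh u)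
        have : 0 ≤ 1 / (K:ℝ)^c0 := by positivity
        linarith
      · push Not at hu
        push_cast at hu
        have : tri M (hF w a b u) ≤ 1 / (K:ℝ)^c0 := by rw [le_div_iff₀ (by positivity)]; linarith
        have : 0 ≤ ((K^c0:ℕ):ℝ)^C1 * G 3 (hF w a b u) := by positivity
        linarith
    have s2 := exp_mono s1
    rw [expect_add_distrib, Fintype.expect_const, ← mul_expect] at s2
    have g0 : 0 ≤ 𝔼 u, G 3 (hF w a b u) := exp_nonneg fun u => G_nonneg _ _
    have s3 : (K:ℝ) ≤ (K:ℝ)^c0 * 𝔼 u, tri M (hF w a b u) := by rw [hK']; nlinarith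
    have s4 : (K:ℝ)^c0 * 𝔼 u, tri M (hF w a b u) ≤ 1 + ((K^c3:ℕ):ℝ) * 𝔼 u, G 3 (hF w a b u) := by
      calc (K:ℝ)^c0 * 𝔼 u, tri M (hF w a b u) ≤ (K:ℝ)^c0 * (1 / (K:ℝ)^c0 + ((K^c0:ℕ):ℝ)^C1 * 𝔼 u, G 3 (hF w a b u)) := by gcongr
        _ = 1 + (((K:ℝ)^c0) * ((K:ℝ)^c0)^C1) * 𝔼 u, G 3 (hF w a b u) := by push_cast; field_simp
        _ = _ := by rw [← pow_succ', ← pow_mul, ← hc3]; push_cast; rfl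
    linarith
  have t4 : 1 ≤ ((K^c2:ℕ):ℝ) * 𝔼 u, G 2 (hF w a b u) := by
    have H := HB hn (K := K^(c3*5)) (hK2 _ (by omega)) (by
      rw [← pow_mul]; exact (hKp _ _ (by omega)).trans hM) w hw
    rw [← pow_mul, ← hr3] at H
    obtain ⟨Y, hY, y1, y2⟩ := ch4 a b ha hb H
    have := num_step (L := K^c3) (R := K^r3) (a := 4) (b := 8) (hK2 _ p3) (hK2 _ q3) (Maj_card _) t3 hY (by
      rw [← pow_mul]; exact y1) y2
    rwa [← pow_mul, ← pow_mul, ← pow_add, ← pow_mul, ← hc2] at this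
  have t5 : 1 ≤ ((K^c1:ℕ):ℝ) * 𝔼 u, G 1 (hF w a b u) := by
    have H := HB hn (K := K^(c2*3)) (hK2 _ (by omega)) (by
      rw [← pow_mul]; exact (hKp _ _ (by omega)).trans hM) w hw
    rw [← pow_mul, ← hr2] at H
    obtain ⟨Y, hY, y1, y2⟩ := ch3 a b ha hb H
    have := num_step (L := K^c2) (R := K^r2) (a := 2) (b := 2) (hK2 _ p2) (hK2 _ q2) (Maj_card _) t4 hY (by
      rw [← pow_mul]; exact y1) y2
    rwa [← pow_mul, ← pow_mul, ← pow_add, ← pow_mul, ← hc1] at this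
  have H := HB hn (K := K^(c1*2)) (hK2 _ (by omega)) (by
      rw [← pow_mul]; exact (hKp _ _ (by omega)).trans hM) w hw
  rw [← pow_mul, ← hr1] at H
  obtain ⟨φ, hφ⟩ := ch0 a b ha hb H
  obtain ⟨L, hLd⟩ : ∃ L : ℕ, L = K^c1 := ⟨_, rfl⟩
  rw [pow_mul, ← hLd] at hφ
  rw [← hLd] at t5
  have hL2 : 2 ≤ L := by rw [hLd]; exact hK2 _ p1
  have hLR : (2:ℝ) ≤ L := by exact_mod_cast hL2
  have hMR : (0:ℝ) < M := by exact_mod_cast hM0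
  have hB : (7 * (S * ℓ * ((K^r1:ℕ):ℝ)) / n : ℝ) ≤ 1 / (L:ℝ)^3 := by
    have hnR : (n:ℝ) = 64*M^2 := by rw [hn]; push_cast; ring
    rw [hnR, div_le_div_iff₀ (by positivity) (by positivity)]
    have : K^r1 * L^3 * (S * ℓ) ≤ M^2 := by
      refine le_trans (Nat.mul_le_mul_right _ ?_) hSl
      rw [hLd, ← pow_mul, ← pow_add]
      exact hKp _ _ (by omega)
    have : ((K^r1 : ℕ):ℝ) * L^3 * (S * ℓ) ≤ M^2 := by exact_mod_cast this
    have : 0 ≤ ((K^r1 : ℕ):ℝ) * L^3 * (S * ℓ) := by positivity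
    nlinarith
  have f : 𝔼 u, ‖hat (hF w a b u) (φ u)‖ * (if φ u ∈ Maj (K^r1) then (1:ℝ) else 0) ≤ 1 / (L:ℝ)^3 := by
    refine el fun u => ?_
    split_ifs with hu
    · rw [mul_one]
      refine (hph (φ u) _ (fun x y => ?_) u).trans hB
      have hS' : ∀ r, 1 ≤ r → r ≤ K^r1 → r ∣ S := fun r hr hr' => hS r hr (hr'.trans (hKp _ _ (by omega)))
      have := maj_phase hS' hu x y
      rw [hz]; exact this
    · rw [mul_zero]; positivity
  have g := hφ.trans (add_le_add le_rfl f)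
  push_cast at g
  have : (L:ℝ)^3 * (𝔼 u, G 1 (hF w a b u)) ≤ L + 1 := by
    calc (L:ℝ)^3 * (𝔼 u, G 1 (hF w a b u)) ≤ (L:ℝ)^3 * (1 / (L:ℝ)^2 + 1 / (L:ℝ)^3) := by gcongr
      _ = (L:ℝ) + 1 := by field_simp
  nlinarith [mul_le_mul_of_nonneg_left t5 (sq_nonneg (L:ℝ))]

end NR

namespace NR

section app
set_option linter.unusedSectionVars false
variable {L : ℕ} [NeZero L] {M : ℕ}

abbrev P4 (M : ℕ) := Fin M × T3 M

def yv (p p' : P4 M) : ℤ := Vt 0 p.2 p.1 - Vt 0 p'.2 p'.1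

noncomputable def Lam (M D : ℕ) (f h : ZMod L → ℝ) : ℝ :=
  𝔼 p : P4 M, 𝔼 p' : P4 M, 𝔼 x, f x * f (x + ((D * yv p p' : ℤ) : ZMod L)) * h (x + ((D^2 * (yv p p')^2 : ℤ) : ZMod L))

lemma yv_eq (p p' : P4 M) : Vt (-(((p'.2.1:ℕ):ℤ) + ((p'.2.2.1:ℕ):ℤ) + ((p'.2.2.2:ℕ):ℤ))) p.2 p.1 = yv p p' + ((p'.1:ℕ):ℤ) := by
  simp only [yv, Vt]; ring

lemma yv_le (p p' : P4 M) : |yv p p'| ≤ 4 * M := by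
  obtain ⟨a, b, c, d⟩ := p
  obtain ⟨a', b', c', d'⟩ := p'
  simp only [yv, Vt]
  have := a.2; have := b.2; have := c.2; have := d.2; have := a'.2; have := b'.2; have := c'.2; have := d'.2
  rw [abs_le]; constructor <;> omega

lemma yv_sq (p p' : P4 M) : (yv p p')^2 ≤ 16 * M^2 := by
  have := yv_le p p'
  rw [← sq_abs]
  nlinarith [abs_nonneg (yv p p')]

noncomputable def win (n M : ℕ) (j : ZMod n) : ℝ := if M^2 ≤ j.val ∧ j.val < 33 * M^2 then 1 else 0

lemma win_exp {n : ℕ} [NeZero n] (hn : n = 64 * M^2) : 𝔼 j : ZMod n, win n M j = 1 / 2 := by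
  have h := exp_ind (fun j : ZMod n => M^2 ≤ j.val ∧ j.val < 33 * M^2)
  have hc : (Finset.univ.filter (fun j : ZMod n => M^2 ≤ j.val ∧ j.val < 33 * M^2)).card = 32 * M^2 := by
    have : (Finset.univ.filter (fun j : ZMod n => M^2 ≤ j.val ∧ j.val < 33 * M^2)).card = (Finset.Ico (M^2) (33 * M^2)).card := by
      refine Finset.card_bij (fun j _ => j.val) ?_ ?_ ?_
      · intro j hj; simpa using hj
      · intro j _ j' _ hjj; exact ZMod.val_injective n hjj
      · intro k hk
        rw [Finset.mem_Ico] at hk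
        have hk' : ((k : ZMod n)).val = k := ZMod.val_cast_of_lt (by rw [hn]; omega)
        exact ⟨(k : ZMod n), by simp only [mem_filter, mem_univ, true_and]; rw [hk']; exact hk, hk'⟩
    rw [this, Nat.card_Ico]; omega
  rw [hc, ZMod.card] at h
  have hn0 : (n:ℝ) ≠ 0 := by exact_mod_cast NeZero.ne n
  have hnR : (n:ℝ) = 64*M^2 := by rw [hn]; push_cast; ring
  have h2 : (𝔼 j : ZMod n, win n M j) * n = 32 * M^2 := by
    simp only [win]; push_cast at h; exact h
  field_simp
  rw [hnR] at h2 hn0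
  have h3 : (M:ℝ)^2 ≠ 0 := fun h => hn0 (by rw [h]; ring)
  have h4 : ((𝔼 j : ZMod n, win n M j) * 2 - 1) * (32 * (M:ℝ)^2) = 0 := by linear_combination h2
  have := (mul_eq_zero.1 h4).resolve_right (by positivity)
  linarith

lemma val_int {n : ℕ} [NeZero n] (k : ℤ) (h0 : 0 ≤ k) (h1 : k < n) : (((k : ZMod n).val : ℕ) : ℤ) = k := by
  rw [ZMod.val_intCast]; exact Int.emod_eq_of_lt h0 h1

lemma kap_ofReal {κ : Type*} [Fintype κ] (z : κ → ZMod L) (f : ZMod L → ℝ) (x : ZMod L) :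
    ((kap z f x : ℝ) : ℂ) = 𝔼 a, 𝔼 a', ((f (x + z a - z a') : ℝ) : ℂ) := by
  rw [kap, ofReal_exp]; simp only [ofReal_exp]

lemma T_point {n : ℕ} [NeZero n] (hn : n = 64 * M^2) {S ℓ D : ℕ} (hS : S * ℓ ≤ M^2) (f : ZMod L → ℝ) (x : ZMod L) (p p' : P4 M) (j : ZMod n)
    (w : ℤ) (hw : w = -(((p'.2.1:ℕ):ℤ) + ((p'.2.2.1:ℕ):ℤ) + ((p'.2.2.2:ℕ):ℤ)))
    (F : ℤ → ZMod n → ℂ) (hF : ∀ V j, F V j = ((f (x + ((D * V + D^2 * (j.val:ℕ) : ℤ) : ZMod L)) : ℝ) : ℂ)) :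
    ((win n M j : ℝ) : ℂ) * F (p'.1:ℕ) j * F (Vt w p.2 p.1) j *
      (F (p'.1:ℕ) (j + (((Vt w p.2 p.1 - ((p'.1:ℕ):ℤ))^2 : ℤ) : ZMod n)) -
        kap (fun a : Fin ℓ => ((S * a : ℕ) : ZMod n)) (F (p'.1:ℕ)) (j + (((Vt w p.2 p.1 - ((p'.1:ℕ):ℤ))^2 : ℤ) : ZMod n))) =
    ((win n M j : ℝ) : ℂ) * (fun x : ZMod L => (((f x * f (x + ((D * yv p p' : ℤ) : ZMod L)) * (fun t => f t - kap (fun a : Fin ℓ => ((D^2 * (S * a) : ℕ) : ZMod L)) f t) (x + ((D^2 * (yv p p')^2 : ℤ) : ZMod L)) : ℝ)) : ℂ))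
      (x + ((D * (p'.1:ℕ) + D^2 * (j.val:ℕ) : ℤ) : ZMod L)) := by
  by_cases hj : M^2 ≤ j.val ∧ j.val < 33 * M^2
  swap
  · simp [win, hj]
  have hV : Vt w p.2 p.1 = yv p p' + ((p'.1:ℕ):ℤ) := by rw [hw]; exact yv_eq p p'
  have hy := yv_sq p p'
  have hy0 := sq_nonneg (yv p p')
  have hj1 : (M:ℤ)^2 ≤ (j.val : ℕ) := by exact_mod_cast hj.1
  have hj2 : ((j.val : ℕ):ℤ) < 33 * M^2 := by exact_mod_cast hj.2
  have hnZ : (n:ℤ) = 64 * M^2 := by rw [hn]; push_cast; ring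
  have hFk : ∀ (V k : ℤ), 0 ≤ k → k < n → F V (k : ZMod n) = ((f (x + ((D * V + D^2 * k : ℤ) : ZMod L)) : ℝ) : ℂ) := by
    intro V k h0 h1
    rw [hF, val_int k h0 h1]
  have hjc : j + (((Vt w p.2 p.1 - ((p'.1:ℕ):ℤ))^2 : ℤ) : ZMod n) = (((j.val:ℕ) + (yv p p')^2 : ℤ) : ZMod n) := by
    rw [hV]; push_cast; simp
  rw [hjc, hFk _ _ (by omega) (by omega), hF, hF, hV, mul_assoc, mul_assoc]
  have hk : kap (fun a : Fin ℓ => ((S * a : ℕ) : ZMod n)) (F (p'.1:ℕ)) (((j.val:ℕ) + (yv p p')^2 : ℤ) : ZMod n) =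
      ((kap (fun a : Fin ℓ => ((D^2 * (S * a) : ℕ) : ZMod L)) f (x + ((D * (p'.1:ℕ) + D^2 * ((j.val:ℕ) + (yv p p')^2) : ℤ) : ZMod L)) : ℝ) : ℂ) := by
    rw [kap_ofReal, kap]
    refine ec fun a => ec fun a' => ?_
    have hb : ∀ a : Fin ℓ, ((S * a : ℕ):ℤ) ≤ M^2 := by
      intro a
      have : S * a ≤ M^2 := (Nat.mul_le_mul_left _ a.2.le).trans hS
      exact_mod_cast this
    have h1 := hb a
    have h2 := hb a'
    have e1 : (((j.val:ℕ) + (yv p p')^2 : ℤ) : ZMod n) + ((S * a : ℕ) : ZMod n) - ((S * a' : ℕ) : ZMod n) =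
      (((j.val:ℕ) + (yv p p')^2 + (S * a : ℕ) - (S * a' : ℕ) : ℤ) : ZMod n) := by push_cast; ring
    rw [e1, hFk _ _ (by omega) (by omega)]
    congr 2
    push_cast; ring
  have a1 : x + ((D * (yv p p' + ((p'.1:ℕ):ℤ)) + D^2 * (j.val:ℕ) : ℤ) : ZMod L) = (x + ((D * (p'.1:ℕ) + D^2 * (j.val:ℕ) : ℤ) : ZMod L)) + ((D * yv p p' : ℤ) : ZMod L) := by
    push_cast; ring
  have a2 : x + ((D * (p'.1:ℕ) + D^2 * ((j.val:ℕ) + (yv p p')^2) : ℤ) : ZMod L) = (x + ((D * (p'.1:ℕ) + D^2 * (j.val:ℕ) : ℤ) : ZMod L)) + ((D^2 * (yv p p')^2 : ℤ) : ZMod L) := by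
    push_cast; ring
  rw [hk, a1, a2]
  simp only
  rw [Complex.ofReal_mul, Complex.ofReal_mul, Complex.ofReal_sub]
  ring

lemma Lam_tr {n : ℕ} [NeZero n] (hn : n = 64 * M^2) (hM : 1 ≤ M) {S ℓ D : ℕ} (hS : S * ℓ ≤ M^2) (f : ZMod L → ℝ) (f1 : ∀ x, |f x| ≤ 1) (B : ℝ)
    (hB : ∀ (w : ℤ) (_ : |w| ≤ 3 * M) (f0 : ZMod n → Fin M → ℂ) (f1 : ZMod n → ℤ → ℂ) (f2 : Fin M → ZMod n → ℂ)
      (_ : ∀ j u, ‖f0 j u‖ ≤ 1) (_ : ∀ j V, ‖f1 j V‖ ≤ 1) (_ : ∀ u j, ‖f2 u j‖ ≤ 1),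
      ‖T w f0 f1 (fun u x => f2 u x - kap (fun a : Fin ℓ => ((S * a : ℕ) : ZMod n)) (f2 u) x)‖ ≤ B) :
    |Lam M D f (fun t => f t - kap (fun a : Fin ℓ => ((D^2 * (S * a) : ℕ) : ZMod L)) f t)| ≤ 2 * B := by
  have : NeZero M := ⟨by omega⟩
  set g : ZMod L → ℝ := fun t => f t - kap (fun a : Fin ℓ => ((D^2 * (S * a) : ℕ) : ZMod L)) f t with hg
  set F : ZMod L → ℤ → ZMod n → ℂ := fun x V j => ((f (x + ((D * V + D^2 * (j.val:ℕ) : ℤ) : ZMod L)) : ℝ) : ℂ) with hF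
  have hF1 : ∀ x V j, ‖F x V j‖ ≤ 1 := by
    intro x V j; simp only [hF]; rw [Complex.norm_real]; exact f1 _
  set w : T3 M → ℤ := fun s => -(((s.1:ℕ):ℤ) + ((s.2.1:ℕ):ℤ) + ((s.2.2:ℕ):ℤ)) with hw
  have hw1 : ∀ s, |w s| ≤ 3 * M := by
    intro s
    have := s.1.2; have := s.2.1.2; have := s.2.2.2
    rw [abs_le]; simp only [hw]; constructor <;> omega
  set TT : T3 M → ZMod L → ℂ := fun s x => T (w s) (fun j u => ((win n M j : ℝ) : ℂ) * F x (u:ℕ) j) (fun j V => F x V j)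
    (fun u k => F x (u:ℕ) k - kap (fun a : Fin ℓ => ((S * a : ℕ) : ZMod n)) (F x (u:ℕ)) k) with hTT
  have b1 : ∀ s x, ‖TT s x‖ ≤ B := by
    intro s x
    refine hB (w s) (hw1 s) _ _ (fun u k => F x (u:ℕ) k) (fun j u => ?_) (fun j V => hF1 _ _ _) (fun u k => hF1 _ _ _)
    rw [norm_mul]
    refine mul_le_one₀ ?_ (norm_nonneg _) (hF1 _ _ _)
    rw [Complex.norm_real, win]; split_ifs <;> simp
  set Φ : P4 M → P4 M → ZMod L → ℝ := fun p p' x => f x * f (x + ((D * yv p p' : ℤ) : ZMod L)) * g (x + ((D^2 * (yv p p')^2 : ℤ) : ZMod L)) with hΦ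
  have e1 : 𝔼 s, 𝔼 x, TT s x = ((2⁻¹ * Lam M D f g : ℝ) : ℂ) := by
    have c1 : ∀ s x, TT s x = 𝔼 t, 𝔼 v, 𝔼 u, 𝔼 j, ((win n M j : ℝ) : ℂ) * ((Φ (v,t) (u,s) (x + ((D * (u:ℕ) + D^2 * (j.val:ℕ) : ℤ) : ZMod L)) : ℝ) : ℂ) := by
      intro s x
      simp only [hTT, T]
      refine ec fun t => ?_
      rw [exp_comm]
      refine ec fun v => ?_
      rw [exp_comm]
      refine ec fun u => ec fun j => ?_
      exact T_point hn hS f x (v,t) (u,s) j (w s) rfl (F x) (fun V j => rfl)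
    have c2 : ∀ s, 𝔼 x, TT s x = 𝔼 t, 𝔼 v, 𝔼 u, ((2⁻¹ * 𝔼 x, Φ (v,t) (u,s) x : ℝ) : ℂ) := by
      intro s
      simp only [c1]
      rw [exp_comm]
      refine ec fun t => ?_
      rw [exp_comm]
      refine ec fun v => ?_
      rw [exp_comm]
      refine ec fun u => ?_
      rw [exp_comm]
      have : ∀ j : ZMod n, 𝔼 x, ((win n M j : ℝ) : ℂ) * ((Φ (v,t) (u,s) (x + ((D * (u:ℕ) + D^2 * (j.val:ℕ) : ℤ) : ZMod L)) : ℝ) : ℂ) =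
          ((win n M j : ℝ) : ℂ) * 𝔼 x, ((Φ (v,t) (u,s) x : ℝ) : ℂ) := by
        intro j
        rw [← mul_expect]
        congr 1
        exact shift _ (fun x => ((Φ (v,t) (u,s) x : ℝ) : ℂ))
      simp only [this]
      rw [← expect_mul, ← ofReal_exp, ← ofReal_exp, win_exp hn]
      push_cast; norm_num
    simp only [c2]
    rw [Lam, mul_expect, ofReal_exp]
    conv_rhs => rw [exp_prod]
    have : ∀ v t, ((2⁻¹ * 𝔼 p' : P4 M, 𝔼 x, Φ (v,t) p' x : ℝ) : ℂ) = 𝔼 s, 𝔼 u, ((2⁻¹ * 𝔼 x, Φ (v,t) (u,s) x : ℝ) : ℂ) := by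
      intro v t
      rw [exp_prodR, exp_commR, mul_expect, ofReal_exp]
      refine ec fun s => ?_
      rw [mul_expect, ofReal_exp]
    have c3 : ∀ v : Fin M, 𝔼 t : T3 M, ((2⁻¹ * 𝔼 p' : P4 M, 𝔼 x, f x * f (x + ((D * yv (v,t) p' : ℤ) : ZMod L)) * g (x + ((D^2 * (yv (v,t) p')^2 : ℤ) : ZMod L)) : ℝ) : ℂ) =
      𝔼 s, 𝔼 t, 𝔼 u, ((2⁻¹ * 𝔼 x, Φ (v,t) (u,s) x : ℝ) : ℂ) := by
      intro v
      rw [exp_comm (ι := T3 M) (κ := T3 M)]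
      exact ec fun t => this v t
    refine Eq.trans ?_ (ec fun v => (c3 v).symm)
    conv_rhs => rw [exp_comm]
    refine ec fun s => ?_
    rw [exp_comm]
  have b2 : ‖𝔼 s, 𝔼 x, TT s x‖ ≤ B :=
    (nexp_le _).trans (el fun s => (nexp_le _).trans (el fun x => b1 s x))
  rw [e1, Complex.norm_real, Real.norm_eq_abs, abs_mul, abs_of_pos (by norm_num : (0:ℝ) < 2⁻¹)] at b2
  linarith

end app
end NR

namespace NR

section app2
set_option linter.unusedSectionVars false
variable {L : ℕ} [NeZero L] {κ : Type*} [Fintype κ] [Nonempty κ]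

lemma kapR_symm (z : κ → ZMod L) (F g : ZMod L → ℝ) : 𝔼 x, F x * kap z g x = 𝔼 x, kap z F x * g x := by
  simp only [kap, mul_expect, expect_mul]
  rw [exp_commR]
  conv_rhs => rw [exp_commR]
  have h1 : ∀ a, 𝔼 x, 𝔼 a', F x * g (x + z a - z a') = 𝔼 a', 𝔼 x, F x * g (x + z a - z a') := fun a => exp_commR _
  have h2 : ∀ a, 𝔼 x, 𝔼 a', F (x + z a - z a') * g x = 𝔼 a', 𝔼 x, F (x + z a - z a') * g x := fun a => exp_commR _
  simp only [h1, h2]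
  rw [exp_commR]
  refine ec fun a => ec fun a' => ?_
  refine shcR (z a' - z a) fun j => ?_
  rw [show j + (z a' - z a) + z a - z a' = j by ring, show j + z a' - z a = j + (z a' - z a) by ring]

lemma kapR_P (z : κ → ZMod L) (F : ZMod L → ℝ) : 𝔼 x, (𝔼 a, F (x + z a))^2 = 𝔼 x, F x * kap z F x := by
  have h := kap_P z (fun x => ((F x : ℝ) : ℂ))
  simp only [← ofReal_exp, kap, Complex.norm_real, Real.norm_eq_abs, sq_abs, Complex.conj_ofReal, ← Complex.ofReal_mul] at h
  simp only [kap]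
  exact_mod_cast h

lemma kapR_le (z : κ → ZMod L) (F : ZMod L → ℝ) : 𝔼 x, (kap z F x)^2 ≤ 𝔼 x, F x * kap z F x := by
  rw [← kapR_P]
  have h := kap_le z (fun x => ((F x : ℝ) : ℂ))
  simp only [← ofReal_exp, kap, Complex.norm_real, Real.norm_eq_abs, sq_abs] at h
  exact h

lemma kapR_mono (z : κ → ZMod L) {F G : ZMod L → ℝ} (h : ∀ x, F x ≤ G x) (x : ZMod L) : kap z F x ≤ kap z G x :=
  exp_mono fun _ => exp_mono fun _ => h _

lemma kapR_nonneg (z : κ → ZMod L) {F : ZMod L → ℝ} (h : ∀ x, 0 ≤ F x) (x : ZMod L) : 0 ≤ kap z F x :=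
  exp_nonneg fun _ => exp_nonneg fun _ => h _

lemma few (z : κ → ZMod L) {f : ZMod L → ℝ} (h0 : ∀ x, 0 ≤ f x) (b : ZMod L → ℝ) {α : ℝ} (hα : 0 ≤ α)
    (hb : ∀ x, b x = if kap z f x < α / 4 then f x else 0) : 𝔼 x, b x ≤ α / 4 := by
  have b0 : ∀ x, 0 ≤ b x := fun x => by rw [hb]; split_ifs <;> simp [h0]
  have bf : ∀ x, b x ≤ f x := fun x => by rw [hb]; split_ifs <;> simp [h0]
  have h1 : (𝔼 x, b x)^2 ≤ α / 4 * 𝔼 x, b x := by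
    have e1 : 𝔼 x, b x = 𝔼 x, 𝔼 a, b (x + z a) := by
      rw [exp_commR]
      have : ∀ a, 𝔼 x, b (x + z a) = 𝔼 x, b x := fun a => shiftR (z a) b
      simp only [this, Fintype.expect_const]
    calc (𝔼 x, b x)^2 = (𝔼 x, 𝔼 a, b (x + z a))^2 := by rw [← e1]
      _ ≤ 𝔼 x, (𝔼 a, b (x + z a))^2 := exp_sq_le _
      _ = 𝔼 x, b x * kap z b x := kapR_P z b
      _ ≤ 𝔼 x, (α / 4 * b x) := by
        refine exp_mono fun x => ?_
        have h2 := kapR_mono z bf x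
        by_cases hx : kap z f x < α / 4
        · nlinarith [b0 x]
        · have : b x = 0 := by rw [hb, if_neg hx]
          simp [this]
      _ = α / 4 * 𝔼 x, b x := by rw [mul_expect]
  have h3 : 0 ≤ 𝔼 x, b x := exp_nonneg b0
  by_contra hc
  push Not at hc
  nlinarith

lemma posit {κ' : Type*} [Fintype κ'] [Nonempty κ'] (z : κ → ZMod L) (z' : κ' → ZMod L) {f : ZMod L → ℝ} (h0 : ∀ x, 0 ≤ f x) {α : ℝ} (hα : 0 ≤ α)
    (hf : 𝔼 x, f x = α) : α^3 / 32 ≤ 𝔼 x, f x * kap z f x * kap z' f x := by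
  have f1 := few z h0 (fun x => if kap z f x < α / 4 then f x else 0) hα (fun x => rfl)
  have f2 := few z' h0 (fun x => if kap z' f x < α / 4 then f x else 0) hα (fun x => rfl)
  have h : 𝔼 x, (α^2 / 16 * (f x - (if kap z f x < α / 4 then f x else 0) - (if kap z' f x < α / 4 then f x else 0))) ≤
      𝔼 x, f x * kap z f x * kap z' f x := by
    refine exp_mono fun x => ?_
    have a1 := kapR_nonneg z h0 x
    have a2 := kapR_nonneg z' h0 x
    have a3 := h0 x
    have a4 : 0 ≤ f x * kap z f x * kap z' f x := by positivity
    have a5 : 0 ≤ α^2 / 16 * f x := by positivity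
    split_ifs with c1 c2 c2
    · linarith
    · linarith
    · linarith
    · push Not at c1 c2
      have : α / 4 * (α / 4) ≤ kap z f x * kap z' f x := mul_le_mul c1 c2 (by positivity) a1
      nlinarith
  rw [← mul_expect, expect_sub_distrib, expect_sub_distrib, hf] at h
  nlinarith [sq_nonneg α]

lemma tele (ℓ : ℕ) (φ : ℕ → ℝ) (h : ∀ k, 0 ≤ φ k) (h1 : ∀ k, φ k ≤ 1) : |𝔼 a : Fin ℓ, (φ (a + 1) - φ a)| ≤ 1 / ℓ := by
  rw [Fintype.expect_eq_sum_div_card, Fintype.card_fin, Fin.sum_univ_eq_sum_range (fun a => φ (a + 1) - φ a), Finset.sum_range_sub, abs_div, Nat.abs_cast]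
  gcongr
  rw [abs_le]
  constructor <;> linarith [h ℓ, h 0, h1 ℓ, h1 0]

lemma shift1 {S ℓ : ℕ} (hℓ : 1 ≤ ℓ) {f : ZMod L → ℝ} (h0 : ∀ x, 0 ≤ f x) (h1 : ∀ x, f x ≤ 1) (x : ZMod L) :
    |kap (fun a : Fin ℓ => ((S * a : ℕ) : ZMod L)) f (x + S) - kap (fun a : Fin ℓ => ((S * a : ℕ) : ZMod L)) f x| ≤ 1 / ℓ := by
  have : NeZero ℓ := ⟨by omega⟩
  have e : kap (fun a : Fin ℓ => ((S * a : ℕ) : ZMod L)) f (x + S) - kap (fun a : Fin ℓ => ((S * a : ℕ) : ZMod L)) f x =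
      𝔼 a' : Fin ℓ, 𝔼 a : Fin ℓ, ((fun k : ℕ => f (x + ((S * k : ℕ) : ZMod L) - ((S * a' : ℕ) : ZMod L))) (a + 1) - (fun k : ℕ => f (x + ((S * k : ℕ) : ZMod L) - ((S * a' : ℕ) : ZMod L))) a) := by
    rw [exp_commR, kap, kap, ← expect_sub_distrib]
    refine ec fun a => ?_
    rw [← expect_sub_distrib]
    refine ec fun a' => ?_
    simp only
    congr 2
    push_cast; ring
  rw [e]
  refine (Finset.abs_expect_le _ _).trans ?_
  refine el fun a' => ?_
  exact tele ℓ (fun k : ℕ => f (x + ((S * k : ℕ) : ZMod L) - ((S * a' : ℕ) : ZMod L))) (fun _ => h0 _) (fun _ => h1 _)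

lemma shiftN {S ℓ : ℕ} (hℓ : 1 ≤ ℓ) {f : ZMod L → ℝ} (h0 : ∀ x, 0 ≤ f x) (h1 : ∀ x, f x ≤ 1) (x : ZMod L) (h : ℕ) :
    |kap (fun a : Fin ℓ => ((S * a : ℕ) : ZMod L)) f (x + ((S * h : ℕ) : ZMod L)) - kap (fun a : Fin ℓ => ((S * a : ℕ) : ZMod L)) f x| ≤ h / ℓ := by
  induction h with
  | zero => simp
  | succ h ih =>
    have h2 := shift1 hℓ (S := S) h0 h1 (x + ((S * h : ℕ) : ZMod L))
    have e : x + ((S * (h + 1) : ℕ) : ZMod L) = x + ((S * h : ℕ) : ZMod L) + S := by push_cast; ring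
    rw [e]
    refine (abs_sub_le _ _ _).trans ((add_le_add h2 ih).trans ?_)
    push_cast
    rw [← add_div, add_comm]

lemma shiftk {S ℓ : ℕ} (hℓ : 1 ≤ ℓ) {f : ZMod L → ℝ} (h0 : ∀ x, 0 ≤ f x) (h1 : ∀ x, f x ≤ 1) (x : ZMod L) (h : ℤ) {H : ℕ} (hH : |h| ≤ H) :
    |kap (fun a : Fin ℓ => ((S * a : ℕ) : ZMod L)) f (x + ((S * h : ℤ) : ZMod L)) - kap (fun a : Fin ℓ => ((S * a : ℕ) : ZMod L)) f x| ≤ H / ℓ := by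
  obtain ⟨k, hk⟩ := Int.eq_nat_or_neg h
  have hc : (k : ℝ) / ℓ ≤ H / ℓ := by
    gcongr
    rcases hk with hk | hk <;> simpa [hk] using hH
  rcases hk with hk | hk
  · have h2 := shiftN hℓ (S := S) h0 h1 x k
    have e2 : x + ((S * h : ℤ) : ZMod L) = x + ((S * k : ℕ) : ZMod L) := by
      rw [hk]; push_cast; rfl
    rw [e2]; exact h2.trans hc
  · have h2 := shiftN hℓ (S := S) h0 h1 (x + ((S * h : ℤ) : ZMod L)) k
    have e2 : x + ((S * h : ℤ) : ZMod L) + ((S * k : ℕ) : ZMod L) = x := by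
      rw [hk]; push_cast; ring
    rw [e2, abs_sub_comm] at h2; exact h2.trans hc

lemma energy {κ' : Type*} [Fintype κ'] [Nonempty κ'] (z : κ → ZMod L) (z' : κ' → ZMod L) {f : ZMod L → ℝ} (h0 : ∀ x, 0 ≤ f x) (h1 : ∀ x, f x ≤ 1) {η : ℝ} (hη : 0 ≤ η)
    (h : ∀ x a a', |kap z' f (x + z a - z a') - kap z' f x| ≤ η) :
    𝔼 x, (kap z f x - kap z' f x)^2 ≤ 𝔼 x, f x * kap z f x - 𝔼 x, f x * kap z' f x + 2 * η := by
  have e1 : 𝔼 x, (kap z f x - kap z' f x)^2 = 𝔼 x, (kap z f x)^2 + 𝔼 x, (kap z' f x)^2 - 2 * 𝔼 x, kap z f x * kap z' f x := by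
    rw [mul_expect, ← expect_add_distrib, ← expect_sub_distrib]
    exact ec fun x => by ring
  have h2 := kapR_le z f
  have h3 := kapR_le z' f
  have h4 := kapR_symm z f (kap z' f)
  have h5 : 𝔼 x, f x * kap z' f x - η ≤ 𝔼 x, f x * kap z (kap z' f) x := by
    have : 𝔼 x, f x * kap z' f x - η = 𝔼 x, (f x * kap z' f x - η) := by
      rw [expect_sub_distrib, Fintype.expect_const]
    rw [this]
    refine exp_mono fun x => ?_
    have : kap z' f x - η ≤ kap z (kap z' f) x := by
      have : kap z' f x - η = 𝔼 a : κ, 𝔼 a' : κ, (kap z' f x - η) := by simp only [Fintype.expect_const]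
      rw [this]
      refine exp_mono fun a => exp_mono fun a' => ?_
      linarith [(abs_le.1 (h x a a')).1]
    nlinarith [h0 x, h1 x]
  linarith

end app2
end NR

namespace NR

section app3
set_option linter.unusedSectionVars false
variable {L : ℕ} [NeZero L]

lemma y_zero {M : ℕ} (hM : 1 ≤ M) : 𝔼 p : P4 M, 𝔼 p' : P4 M, (if yv p p' = 0 then (1:ℝ) else 0) ≤ 1 / M := by
  have : NeZero M := ⟨by omega⟩
  rw [exp_commR]
  refine el fun p' => ?_
  rw [exp_prodR, exp_commR]
  refine el fun t => ?_
  have h := exp_ind (fun v : Fin M => yv (v, t) p' = 0)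
  have hc : (Finset.univ.filter (fun v : Fin M => yv (v, t) p' = 0)).card ≤ 1 := by
    rw [Finset.card_le_one]
    intro a ha b hb
    replace ha := (Finset.mem_filter.1 ha).2
    replace hb := (Finset.mem_filter.1 hb).2
    simp only [yv, Vt] at ha hb
    ext; omega
  have hc' : ((Finset.univ.filter (fun v : Fin M => yv (v, t) p' = 0)).card : ℝ) ≤ 1 := by exact_mod_cast hc
  rw [← h, Fintype.card_fin] at hc'
  rw [le_div_iff₀ (by positivity)]
  exact hc'

lemma Lam_free {N M D : ℕ} (hL : L = 2 * N) (hM : 1 ≤ M) (hD : 1 ≤ D) (hN : (4 * D * M)^2 ≤ N) (A : Finset ℤ) (hA : A ⊆ Finset.Icc (1:ℤ) (N:ℤ))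
    (hfree : ¬ ∃ x y : ℤ, y ≠ 0 ∧ x ∈ A ∧ x + y ∈ A ∧ x + y ^ 2 ∈ A) (f : ZMod L → ℝ) (h0 : ∀ x, 0 ≤ f x) (h1 : ∀ x, f x ≤ 1)
    (hf : ∀ x, f x ≠ 0 → ∃ a ∈ A, (a : ZMod L) = x) : Lam M D f f ≤ 1 / M := by
  refine le_trans ?_ (y_zero hM)
  refine exp_mono fun p => exp_mono fun p' => ?_
  refine el fun x => ?_
  split_ifs with hy
  · have a1 := h0 x
    have a2 := h1 x
    exact mul_le_one₀ (mul_le_one₀ (h1 _) (h0 _) (h1 _)) (h0 _) (h1 _)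
  · refine le_of_eq ?_
    by_contra hne
    obtain ⟨h12, h3⟩ := mul_ne_zero_iff.1 hne
    obtain ⟨h1', h2⟩ := mul_ne_zero_iff.1 h12
    obtain ⟨a, ha, ha'⟩ := hf _ h1'
    obtain ⟨b, hb, hb'⟩ := hf _ h2
    obtain ⟨c, hc, hc'⟩ := hf _ h3
    have hsq : (D * yv p p')^2 ≤ (N:ℤ) := by
      have := yv_sq p p'
      calc (D * yv p p')^2 = (D:ℤ)^2 * (yv p p')^2 := by ring
        _ ≤ (D:ℤ)^2 * (16 * M^2) := by gcongr
        _ = ((4 * D * M)^2 : ℕ) := by push_cast; ring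
        _ ≤ N := by exact_mod_cast hN
    set Y : ℤ := D * yv p p' with hY
    have hY0 : Y ≠ 0 := by
      rw [hY]; exact mul_ne_zero (by exact_mod_cast (by omega : D ≠ 0)) hy
    have hY1 : |Y| ≤ N := by
      have := Int.one_le_abs hY0
      have h5 : |Y|^2 = Y^2 := sq_abs Y
      nlinarith
    have mem := fun t (ht : t ∈ A) => Finset.mem_Icc.1 (hA ht)
    have key : ∀ s t : ℤ, s ∈ A → t ∈ A → ∀ k : ℤ, |k| ≤ N → (t : ZMod L) = (s : ZMod L) + (k : ZMod L) → t = s + k := by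
      intro s t hs ht k hk he
      have m1 := mem s hs
      have m2 := mem t ht
      have h6 : ((t - s - k : ℤ) : ZMod L) = 0 := by push_cast; rw [he]; ring
      rw [ZMod.intCast_zmod_eq_zero_iff_dvd] at h6
      have h7 : |t - s - k| < (L:ℤ) := by
        have := abs_le.1 hk
        rw [hL, abs_lt]; push_cast; constructor <;> omega
      have := Int.eq_zero_of_abs_lt_dvd h6 h7
      omega
    have hb2 := key a b ha hb Y hY1 (by rw [ha', hb'])
    have hc2 := key a c ha hc (Y^2) (by rw [abs_of_nonneg (sq_nonneg _)]; exact hsq) (by rw [ha', hc', hY, mul_pow])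
    exact hfree ⟨a, Y, hY0, ha, hb2 ▸ hb, hc2 ▸ hc⟩

lemma Lam_sub (M D : ℕ) (f h k : ZMod L → ℝ) : Lam M D f (fun x => h x - k x) = Lam M D f h - Lam M D f k := by
  simp only [Lam, mul_sub, expect_sub_distrib]

lemma Lam_l1 {M : ℕ} (hM : 1 ≤ M) (D : ℕ) (f h : ZMod L → ℝ) (h0 : ∀ x, 0 ≤ f x) (h1 : ∀ x, f x ≤ 1) : Lam M D f h ≤ 𝔼 x, |h x| := by
  have : NeZero M := ⟨by omega⟩
  refine el fun p => el fun p' => ?_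
  rw [← shiftR ((D^2 * (yv p p')^2 : ℤ) : ZMod L) (fun x => |h x|)]
  refine exp_mono fun x => ?_
  have a1 : f x * f (x + ((D * yv p p' : ℤ) : ZMod L)) ≤ 1 := mul_le_one₀ (h1 _) (h0 _) (h1 _)
  have a2 : 0 ≤ f x * f (x + ((D * yv p p' : ℤ) : ZMod L)) := mul_nonneg (h0 _) (h0 _)
  refine (le_abs_self _).trans ?_
  rw [abs_mul, abs_of_nonneg a2]
  exact mul_le_of_le_one_left (abs_nonneg _) a1

lemma Lam_low {M D : ℕ} (hM : 1 ≤ M) {κ : Type*} [Fintype κ] [Nonempty κ] (z : κ → ZMod L) {f : ZMod L → ℝ} (h0 : ∀ x, 0 ≤ f x) (h1 : ∀ x, f x ≤ 1) {α η : ℝ} (hα : 0 ≤ α)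
    (hf : 𝔼 x, f x = α) (hη : 0 ≤ η)
    (h : ∀ (x : ZMod L) (p p' : P4 M), |kap z f (x + ((D^2 * (yv p p')^2 : ℤ) : ZMod L)) - kap z f x| ≤ η) :
    α^3 / 32 - η ≤ Lam M D f (kap z f) := by
  have : NeZero M := ⟨by omega⟩
  have h2 := posit (fun p : P4 M => ((D * Vt 0 p.2 p.1 : ℤ) : ZMod L)) z h0 hα hf
  have e : 𝔼 x, f x * kap (fun p : P4 M => ((D * Vt 0 p.2 p.1 : ℤ) : ZMod L)) f x * kap z f x =
      𝔼 p : P4 M, 𝔼 p' : P4 M, 𝔼 x, f x * f (x + ((D * yv p p' : ℤ) : ZMod L)) * kap z f x := by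
    have e1 : ∀ x, f x * kap (fun p : P4 M => ((D * Vt 0 p.2 p.1 : ℤ) : ZMod L)) f x * kap z f x =
        𝔼 p : P4 M, 𝔼 p' : P4 M, f x * f (x + ((D * yv p p' : ℤ) : ZMod L)) * kap z f x := by
      intro x
      rw [show kap (fun p : P4 M => ((D * Vt 0 p.2 p.1 : ℤ) : ZMod L)) f x = 𝔼 p : P4 M, 𝔼 p' : P4 M, f (x + ((D * yv p p' : ℤ) : ZMod L)) from ?_]
      · simp only [mul_expect, expect_mul]
      · rw [kap]
        refine ec fun p => ec fun p' => ?_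
        congr 1
        rw [yv]; push_cast; ring
    rw [ec fun x => e1 x, exp_commR]
    refine ec fun p => ?_
    rw [exp_commR]
  rw [e] at h2
  have h3 : 𝔼 p : P4 M, 𝔼 p' : P4 M, 𝔼 x, (f x * f (x + ((D * yv p p' : ℤ) : ZMod L)) * kap z f x - η) ≤ Lam M D f (kap z f) := by
    refine exp_mono fun p => exp_mono fun p' => exp_mono fun x => ?_
    have a1 : f x * f (x + ((D * yv p p' : ℤ) : ZMod L)) ≤ 1 := mul_le_one₀ (h1 _) (h0 _) (h1 _)
    have a2 : 0 ≤ f x * f (x + ((D * yv p p' : ℤ) : ZMod L)) := mul_nonneg (h0 _) (h0 _)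
    have := (abs_le.1 (h x p p')).1
    nlinarith
  simp only [expect_sub_distrib, Fintype.expect_const] at h3
  linarith

lemma step {S R m D' : ℕ} (hS : 1 ≤ S) (hR : 1 ≤ R) (hm : 1 ≤ m) {D M l l' : ℕ} (hD : D = S * D') (hM : M = S * R * m) (hl : l = S * R * m^2)
    (hl' : l' = S * R * (4 * S * R * m)^2) {f : ZMod L → ℝ} (h0 : ∀ x, 0 ≤ f x) (h1 : ∀ x, f x ≤ 1) {α B : ℝ} (hα : 0 ≤ α)
    (hf : 𝔼 x, f x = α) (hff : Lam M D f f ≤ 1 / M)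
    (hB : |Lam M D f (fun t => f t - kap (fun a : Fin l => ((D^2 * (S * a) : ℕ) : ZMod L)) f t)| ≤ B) (δ : ℝ)
    (hδ : 𝔼 x, f x * kap (fun a : Fin l => ((D^2 * (S * a) : ℕ) : ZMod L)) f x - 𝔼 x, f x * kap (fun a : Fin l' => ((D'^2 * (S * a) : ℕ) : ZMod L)) f x ≤ δ) :
    α^3 / 32 ≤ 1 / R + 1 / M + B + √(δ + 2 * (1 / (16 * R^2))) := by
  have hl1 : 1 ≤ l := by rw [hl]; exact Nat.one_le_iff_ne_zero.2 (by positivity)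
  have hl1' : 1 ≤ l' := by rw [hl']; exact Nat.one_le_iff_ne_zero.2 (by positivity)
  have hM1 : 1 ≤ M := by rw [hM]; exact Nat.one_le_iff_ne_zero.2 (by positivity)
  have : NeZero l := ⟨by omega⟩
  have : NeZero l' := ⟨by omega⟩
  have hSR : (0:ℝ) < S := by exact_mod_cast hS
  have hRR : (0:ℝ) < R := by exact_mod_cast hR
  have hmR : (0:ℝ) < m := by exact_mod_cast hm
  set z : Fin l → ZMod L := fun a => ((D^2 * (S * a) : ℕ) : ZMod L) with hz
  set z' : Fin l' → ZMod L := fun a => ((D'^2 * (S * a) : ℕ) : ZMod L) with hz'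
  have hzz : z' = fun a : Fin l' => (((D'^2 * S) * a : ℕ) : ZMod L) := by
    rw [hz']; funext a; rw [mul_assoc]
  have c1 : ∀ (x : ZMod L) (p p' : P4 M), |kap z' f (x + ((D^2 * (yv p p')^2 : ℤ) : ZMod L)) - kap z' f x| ≤ 1 / R := by
    intro x p p'
    have h2 := shiftk (S := D'^2 * S) hl1' h0 h1 x (S * (yv p p')^2) (H := S * (16 * M^2)) (by
      rw [abs_of_nonneg (by positivity)]
      push_cast
      have := yv_sq p p'
      gcongr)
    rw [← hzz] at h2
    have e : x + ((((D'^2 * S : ℕ):ℤ) * (S * (yv p p')^2) : ℤ) : ZMod L) = x + ((D^2 * (yv p p')^2 : ℤ) : ZMod L) := by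
      rw [hD]; push_cast; ring
    rw [e] at h2
    refine h2.trans (le_of_eq ?_)
    rw [hM, hl']; push_cast
    field_simp
    norm_num
  have c2 : ∀ x a a', |kap z' f (x + z a - z a') - kap z' f x| ≤ 1 / (16 * R^2) := by
    intro x a a'
    have h2 := shiftk (S := D'^2 * S) hl1' h0 h1 x (S^2 * ((a:ℕ) - (a':ℕ) : ℤ)) (H := S^2 * l) (by
      rw [abs_mul, abs_of_nonneg (by positivity)]
      push_cast
      have : |((a:ℕ) - (a':ℕ) : ℤ)| ≤ l := by
        have := a.2; have := a'.2
        rw [abs_le]; constructor <;> omega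
      gcongr)
    rw [← hzz] at h2
    have e : x + ((((D'^2 * S : ℕ):ℤ) * (S^2 * ((a:ℕ) - (a':ℕ) : ℤ)) : ℤ) : ZMod L) = x + z a - z a' := by
      simp only [hz]; rw [hD]; push_cast; ring
    rw [e] at h2
    refine h2.trans (le_of_eq ?_)
    rw [hl, hl']; push_cast
    field_simp
    norm_num
  have d1 := Lam_low (D := D) hM1 z' h0 h1 hα hf (by positivity) c1
  have d2 := energy z z' h0 h1 (by positivity) c2
  have d3 := Lam_l1 hM1 D f (fun x => kap z' f x - kap z f x) h0 h1
  have d4 : 𝔼 x, |kap z' f x - kap z f x| ≤ √(δ + 2 * (1 / (16 * R^2))) := by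
    refine Real.le_sqrt_of_sq_le ?_
    refine (exp_sq_le _).trans ?_
    have : 𝔼 x, |kap z' f x - kap z f x|^2 = 𝔼 x, (kap z f x - kap z' f x)^2 :=
      ec fun x => by rw [sq_abs]; ring
    rw [this]
    linarith
  have e1 := Lam_sub M D f f (kap z f)
  have e2 := Lam_sub M D f (kap z' f) (kap z f)
  have hB' := (abs_le.1 hB).1
  linarith

end app3
end NR

namespace NR

section fin

lemma exp_A {N L : ℕ} [NeZero L] (hL : L = 2 * N) (A : Finset ℤ) (hA : A ⊆ Finset.Icc (1:ℤ) (N:ℤ)) (p : ZMod L → Prop) [DecidablePred p]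
    (hp : ∀ x, p x ↔ ∃ a ∈ A, (a : ZMod L) = x) : 𝔼 x : ZMod L, (if p x then (1:ℝ) else 0) = A.card / (2 * N) := by
  have h := exp_ind p
  have hc : (Finset.univ.filter p).card = A.card := by
    symm
    refine Finset.card_bij (fun a _ => (a : ZMod L)) ?_ ?_ ?_
    · intro a ha
      rw [mem_filter, hp]
      exact ⟨mem_univ _, a, ha, rfl⟩
    · intro a ha b hb hab
      have m1 := Finset.mem_Icc.1 (hA ha)
      have m2 := Finset.mem_Icc.1 (hA hb)
      have h6 : ((a - b : ℤ) : ZMod L) = 0 := by push_cast; rw [hab]; ring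
      rw [ZMod.intCast_zmod_eq_zero_iff_dvd] at h6
      have h7 : |a - b| < (L:ℤ) := by
        rw [hL, abs_lt]; push_cast; constructor <;> omega
      have := Int.eq_zero_of_abs_lt_dvd h6 h7
      omega
    · intro x hx
      obtain ⟨a, ha, hx⟩ := (hp x).1 (Finset.mem_filter.1 hx).2
      exact ⟨a, ha, hx⟩
  rw [hc, ZMod.card] at h
  have hL0 : (L:ℝ) ≠ 0 := by exact_mod_cast NeZero.ne L
  have hLR : (L:ℝ) = 2 * N := by exact_mod_cast hL
  rw [← hLR, eq_div_iff hL0, h]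

lemma pick {I : ℕ} (hI : 1 ≤ I) (E : ℕ → ℝ) (h0 : 0 ≤ E 0) (h1 : E I ≤ 1) : ∃ i < I, E (i + 1) - E i ≤ 1 / I := by
  by_contra hc
  push Not at hc
  have h := Finset.sum_lt_sum_of_nonempty (s := Finset.range I) (f := fun _ => (1:ℝ) / I) (g := fun i => E (i + 1) - E i)
    ⟨0, by simp; omega⟩ (fun i hi => hc i (Finset.mem_range.1 hi))
  rw [Finset.sum_range_sub, Finset.sum_const, card_range, nsmul_eq_mul, mul_one_div_cancel (by positivity)] at h
  linarith

lemma main_K : ∃ C : ℕ, 1 ≤ C ∧ ∀ (K N : ℕ), 2 ≤ K → (4 * (K^C).factorial * K^C)^(2 * K^2 + 2) ≤ N → ∀ A : Finset ℤ, A ⊆ Finset.Icc (1:ℤ) (N:ℤ) →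
    (¬ ∃ x y : ℤ, y ≠ 0 ∧ x ∈ A ∧ x + y ∈ A ∧ x + y ^ 2 ∈ A) → ((A.card : ℝ) / (2 * N))^3 ≤ 192 / K := by
  classical
  obtain ⟨C, hC, HT⟩ := Thm2D
  refine ⟨C, hC, fun K N hK hN A hA hfree => ?_⟩
  have hRK : K ≤ K^C := Nat.le_self_pow (by omega) K
  have HT' := fun (n : ℕ) (i : NeZero n) (M S ℓ : ℕ) => @HT n i M K S ℓ
  obtain ⟨R, hR⟩ : ∃ R, R = K^C := ⟨_, rfl⟩
  rw [← hR] at hRK hN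
  simp only [← hR] at HT'
  obtain ⟨S, hS⟩ : ∃ S, S = R.factorial := ⟨_, rfl⟩
  rw [← hS] at hN
  have hS1 : 1 ≤ S := by rw [hS]; exact Nat.factorial_pos _
  have hdvd : ∀ r, 1 ≤ r → r ≤ R → r ∣ S := fun r h1 h2 => by rw [hS]; exact Nat.dvd_factorial h1 h2
  have hR1 : 1 ≤ R := by omega
  have hQ1 : 1 ≤ 4 * S * R := Nat.one_le_iff_ne_zero.2 (by positivity)
  have hN1 : 1 ≤ N := (Nat.one_le_pow _ _ hQ1).trans hN
  obtain ⟨L, hL⟩ : ∃ L, L = 2 * N := ⟨_, rfl⟩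
  have : NeZero L := ⟨by omega⟩
  set f : ZMod L → ℝ := fun x => if ∃ a ∈ A, (a : ZMod L) = x then 1 else 0 with hf
  have f0 : ∀ x, 0 ≤ f x := fun x => by simp only [hf]; split_ifs <;> simp
  have f1 : ∀ x, f x ≤ 1 := fun x => by simp only [hf]; split_ifs <;> simp
  have fA : ∀ x, f x ≠ 0 → ∃ a ∈ A, (a : ZMod L) = x := fun x hx => by
    by_contra hc
    exact hx (if_neg hc)
  have fE : 𝔼 x, f x = (A.card : ℝ) / (2 * N) := exp_A hL A hA _ (fun x => Iff.rfl)
  obtain ⟨I, hI⟩ : ∃ I, I = K^2 := ⟨_, rfl⟩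
  have hI1 : 1 ≤ I := by rw [hI]; exact Nat.one_le_pow _ _ (by omega)
  set E : ℕ → ℝ := fun i => 𝔼 x, f x * kap (fun a : Fin (S * R * ((4 * S * R)^(I - i))^2) => (((S^i)^2 * (S * a) : ℕ) : ZMod L)) f x with hE
  obtain ⟨i, hi, hd⟩ := pick hI1 E
    (exp_nonneg fun x => mul_nonneg (f0 x) (exp_nonneg fun _ => exp_nonneg fun _ => f0 _))
    (exp_le_one fun x => mul_le_one₀ (f1 x) (exp_nonneg fun _ => exp_nonneg fun _ => f0 _) (exp_le_one fun _ => exp_le_one fun _ => f1 _))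
  obtain ⟨m, hm⟩ : ∃ m, m = (4 * S * R)^(I - (i + 1)) := ⟨_, rfl⟩
  have hm' : (4 * S * R)^(I - i) = 4 * S * R * m := by
    rw [hm, ← pow_succ']; congr 1; omega
  have hm1 : 1 ≤ m := by rw [hm]; exact Nat.one_le_pow _ _ hQ1
  obtain ⟨M, hM⟩ : ∃ M, M = S * R * m := ⟨_, rfl⟩
  have hM1 : 1 ≤ M := by rw [hM]; exact Nat.one_le_iff_ne_zero.2 (by positivity)
  have hMR : R ≤ M := by
    rw [hM]
    calc R = 1 * R * 1 := by ring
      _ ≤ S * R * m := by gcongr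
  obtain ⟨D, hD⟩ : ∃ D, D = S^(i+1) := ⟨_, rfl⟩
  have hD1 : 1 ≤ D := by rw [hD]; exact Nat.one_le_pow _ _ hS1
  have hDM : (4 * D * M)^2 ≤ N := by
    refine le_trans ?_ hN
    have : 4 * D * M ≤ (4 * S * R)^(I + 1) := by
      calc 4 * D * M = (4 * S * R) * (S^(i+1) * m) := by rw [hD, hM]; ring
        _ ≤ (4 * S * R) * ((4 * S * R)^(i+1) * m) := by
          gcongr
          calc S = 1 * S * 1 := by ring
            _ ≤ 4 * S * R := by gcongr; norm_num
        _ = (4 * S * R)^(I + 1) := by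
          rw [hm, ← pow_add, ← pow_succ']; congr 1; omega
    calc (4 * D * M)^2 ≤ ((4 * S * R)^(I + 1))^2 := by gcongr
      _ = (4 * S * R)^(2 * K^2 + 2) := by rw [← pow_mul, hI]; congr 1; ring
  have hff := Lam_free hL hM1 hD1 hDM A hA hfree f f0 f1 fA
  obtain ⟨l, hl⟩ : ∃ l, l = S * R * m^2 := ⟨_, rfl⟩
  have hl1 : 1 ≤ l := by rw [hl]; exact Nat.one_le_iff_ne_zero.2 (by positivity)
  obtain ⟨n, hn⟩ : ∃ n, n = 64 * M^2 := ⟨_, rfl⟩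
  have : NeZero n := ⟨by rw [hn]; positivity⟩
  have hRl : R * (S * l) ≤ M^2 := by rw [hl, hM]; exact le_of_eq (by ring)
  have hSl : S * l ≤ M^2 := le_trans (Nat.le_mul_of_pos_left _ hR1) hRl
  have hB := Lam_tr (D := D) hn hM1 hSl f (fun x => by rw [abs_of_nonneg (f0 x)]; exact f1 x) (1 / (K:ℝ))
    (HT' n _ M S l hn hK hMR hl1 hdvd hRl)
  have fin := step hS1 hR1 hm1 (D' := S^i) (D := D) (M := M) (l := l) (l' := S * R * (4 * S * R * m)^2) (by rw [hD, pow_succ']) hM hl rfl f0 f1 (by rw [← fE]; exact exp_nonneg f0) fE hff hB (1 / (I:ℝ)) (by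
      simp only [hE] at hd
      rw [hm', ← hm, ← hl, ← hD] at hd
      exact hd)
  have hK0 : (0:ℝ) < K := by exact_mod_cast (by omega : 0 < K)
  have hRK' : (K:ℝ) ≤ R := by exact_mod_cast hRK
  have hMK' : (K:ℝ) ≤ M := by exact_mod_cast hRK.trans hMR
  have g1 : 1 / (R:ℝ) ≤ 1 / K := one_div_le_one_div_of_le hK0 hRK'
  have g2 : 1 / (M:ℝ) ≤ 1 / K := one_div_le_one_div_of_le hK0 hMK'
  have g3 : √(1 / (I:ℝ) + 2 * (1 / (16 * R^2))) ≤ 2 / K := by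
    rw [Real.sqrt_le_left (by positivity)]
    have h1 : 1 / (16 * (R:ℝ)^2) ≤ 1 / (16 * (K:ℝ)^2) := by gcongr
    have h2 : 1 / (16 * (K:ℝ)^2) = 1 / 16 * (1 / (K:ℝ)^2) := by field_simp
    have h3 : (2 / (K:ℝ))^2 = 4 * (1 / (K:ℝ)^2) := by field_simp; norm_num
    have h4 : (I:ℝ) = (K:ℝ)^2 := by rw [hI]; push_cast; ring
    have h5 : 0 ≤ 1 / (K:ℝ)^2 := by positivity
    rw [h3, h4]
    linarith
  have g4 : 192 / (K:ℝ) = 192 * (1 / K) := by ring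
  have g5 : 2 / (K:ℝ) = 2 * (1 / K) := by ring
  rw [g4]
  linarith

lemma main_log : ∃ P : ℕ, 1 ≤ P ∧ ∀ (K N : ℕ), 2 ≤ K → (K:ℝ)^P ≤ Real.log N → ∀ A : Finset ℤ, A ⊆ Finset.Icc (1:ℤ) (N:ℤ) →
    (¬ ∃ x y : ℤ, y ≠ 0 ∧ x ∈ A ∧ x + y ∈ A ∧ x + y ^ 2 ∈ A) → ((A.card : ℝ) / (2 * N))^3 ≤ 192 / K := by
  obtain ⟨C, hC, H⟩ := main_K
  refine ⟨4 + 4 * C, by omega, fun K N hK hN A hA hfree => H K N hK ?_ A hA hfree⟩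
  have hRK : K ≤ K^C := Nat.le_self_pow (by omega) K
  obtain ⟨R, hR⟩ : ∃ R, R = K^C := ⟨_, rfl⟩
  rw [← hR] at hRK ⊢
  have hR2 : 2 ≤ R := by omega
  have b1 : 4 * R.factorial * R ≤ R^(R + 3) := by
    calc 4 * R.factorial * R ≤ R^2 * R^R * R := by
          gcongr
          · nlinarith
          · exact Nat.factorial_le_pow R
      _ = R^(R+3) := by ring
  have b2 : (4 * R.factorial * R)^(2 * K^2 + 2) ≤ R^((R + 3) * (2 * K^2 + 2)) := by
    rw [pow_mul]; gcongr
  refine b2.trans ?_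
  have hN0 : (0:ℝ) < N := by
    rcases Nat.eq_zero_or_pos N with h | h
    · rw [h] at hN; simp at hN
      have : (0:ℝ) < (K:ℝ)^(4 + 4 * C) := by have : (0:ℝ) < K := by exact_mod_cast (by omega : 0 < K)
                                             positivity
      linarith
    · exact_mod_cast h
  have hR0 : (0:ℝ) < R := by exact_mod_cast (by omega : 0 < R)
  have key : ((R^((R + 3) * (2 * K^2 + 2)) : ℕ) : ℝ) ≤ N := by
    rw [← Real.log_le_log_iff (by positivity) hN0]
    refine le_trans ?_ hN
    push_cast
    rw [Real.log_pow]
    have c1 : Real.log R ≤ R := (Real.log_le_sub_one_of_pos hR0).trans (by linarith)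
    have c2 : (R + 3) * (2 * K^2 + 2) ≤ R^3 * K^4 := by
      have h4 : 2 * 2 ≤ R * R := Nat.mul_le_mul hR2 hR2
      have h5 : 2 * 2 ≤ K * K := Nat.mul_le_mul hK hK
      refine Nat.mul_le_mul ?_ ?_
      · nlinarith
      · nlinarith
    calc (((R + 3) * (2 * K^2 + 2) : ℕ) : ℝ) * Real.log R ≤ ((R^3 * K^4 : ℕ) : ℝ) * R := by
          refine mul_le_mul (by exact_mod_cast c2) c1 (Real.log_natCast_nonneg R) (by positivity)
      _ = (K:ℝ)^(4 + 4 * C) := by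
          rw [hR]; push_cast; ring
  exact_mod_cast key

end fin
end NR

theorem nonlinear_roth_density_bound : ∃ c C : ℝ, 0 < c ∧ 0 < C ∧ ∀ N : ℕ, 2 ≤ N → ∀ A : Finset ℤ, A ⊆ Finset.Icc (1:ℤ) (N:ℤ) → (¬ ∃ x y : ℤ, y ≠ 0 ∧ x ∈ A ∧ x + y ∈ A ∧ x + y ^ 2 ∈ A) → (A.card : ℝ) ≤ C * (N : ℝ) / Real.log N ^ c := by
  obtain ⟨P, hP, H⟩ := NR.main_log
  have hP0 : (0:ℝ) < P := by exact_mod_cast hP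
  refine ⟨1 / (3 * P), 16, by positivity, by norm_num, fun N hN A hA hfree => ?_⟩
  have hN2 : (2:ℝ) ≤ N := by exact_mod_cast hN
  have hl : 0 < Real.log N := Real.log_pos (by linarith)
  obtain ⟨l, hl'⟩ : ∃ l, l = Real.log N := ⟨_, rfl⟩
  rw [← hl'] at hl ⊢
  obtain ⟨s, hs⟩ : ∃ s : ℝ, s = l ^ (1 / (3 * (P:ℝ))) := ⟨_, rfl⟩
  have hs0 : 0 < s := by rw [hs]; exact Real.rpow_pos_of_pos hl _
  have hsP : (s^3)^P = l := by
    rw [hs, ← Real.rpow_natCast, ← Real.rpow_natCast, ← Real.rpow_mul hl.le, ← Real.rpow_mul hl.le]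
    rw [show 1 / (3 * (P:ℝ)) * ((3:ℕ):ℝ) * (P:ℝ) = 1 by push_cast; field_simp, Real.rpow_one]
  have hcard : (A.card : ℝ) ≤ N := by
    have := Finset.card_le_card hA
    rw [Int.card_Icc] at this
    have h2 : A.card ≤ N := by omega
    exact_mod_cast h2
  rw [← hs, le_div_iff₀ hs0]
  by_cases hc : s^3 < 2
  · have : s ≤ 2 := by
      by_contra h
      push Not at h
      nlinarith [mul_pos hs0 hs0]
    nlinarith
  push Not at hc
  obtain ⟨K, hK⟩ : ∃ K, K = ⌊s^3⌋₊ := ⟨_, rfl⟩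
  have hK2 : 2 ≤ K := by rw [hK]; exact Nat.le_floor (by exact_mod_cast hc)
  have hK1 : (K:ℝ) ≤ s^3 := by rw [hK]; exact Nat.floor_le (by positivity)
  have hK3 : s^3 < K + 1 := by rw [hK]; exact Nat.lt_floor_add_one _
  have hK2' : (2:ℝ) ≤ K := by exact_mod_cast hK2
  have h := H K N hK2 (by rw [← hl', ← hsP]; gcongr) A hA hfree
  have h2 : ((A.card : ℝ) / (2 * N) * s)^3 ≤ 8^3 := by
    rw [mul_pow]
    calc ((A.card : ℝ) / (2 * N))^3 * s^3 ≤ 192 / K * (2 * K) := by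
          refine mul_le_mul h (by linarith) (by positivity) (by positivity)
      _ ≤ 8^3 := by field_simp; norm_num
  have h3 : (A.card : ℝ) / (2 * N) * s ≤ 8 := le_of_pow_le_pow_left₀ (by norm_num) (by norm_num) h2
  rw [div_mul_eq_mul_div, div_le_iff₀ (by positivity)] at h3
  linarith
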